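/- Suppose Assumption 1 holds and that γ·(σ−1) ≤ 1. Then the value function V is of class C² on (0,∞)² and satisfies the HJB equation in the classical sense: θ·V(k,h) = H_max(k,h, ∇V(k,h), D²V(k,h)) for every (k,h) ∈ (0,∞)². -/

import Mathlib

open MeasureTheory ProbabilityTheory Real Set Matrix
open scoped ENNReal NNReal

noncomputable section

namespace HabitModel

/-- A standard Brownian motion with respect to the filtration `F`: adapted, with continuous
paths started at `0`, whose increments are independent of the past and Gaussian. -/
structure IsStdBM {Ω : Type*} {mΩ : MeasurableSpace Ω} (P : Measure Ω)
    (F : Filtration ℝ mΩ) (W : ℝ → Ω → ℝ) : Prop where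
  adapted : Adapted F W
  cont : ∀ ω, Continuous fun t => W t ω
  init : ∀ ω, W 0 ω = 0
  indep_incr : ∀ s t : ℝ, 0 ≤ s → s ≤ t →
    Indep (MeasurableSpace.comap (fun ω => W t ω - W s ω) inferInstance) (F s) P
  gauss_incr : ∀ s t : ℝ, 0 ≤ s → s ≤ t →
    P.map (fun ω => W t ω - W s ω) = gaussianReal 0 (Real.toNNReal (t - s))

/-- The stochastic setting of the model: a filtered probability space carrying two
independent standard Brownian motions, together with the model parameters. -/
structure Setting (Ω : Type*) [mΩ : MeasurableSpace Ω] where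
  P : Measure Ω
  isProb : IsProbabilityMeasure P
  F : Filtration ℝ mΩ
  W1 : ℝ → Ω → ℝ
  W2 : ℝ → Ω → ℝ
  bm1 : IsStdBM P F W1
  bm2 : IsStdBM P F W2
  indepW : Indep (⨆ t : ℝ, MeasurableSpace.comap (W1 t) inferInstance)
      (⨆ t : ℝ, MeasurableSpace.comap (W2 t) inferInstance) P
  B : ℝ
  β₁ : ℝ
  β₂ : ℝ
  ρ : ℝ
  θ : ℝ
  σ : ℝ
  γ : ℝ
  R : ℝ
  hB : 0 ≤ B
  hβ₁ : 0 < β₁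
  hβ₂ : 0 < β₂
  hρ₀ : 0 < ρ
  hρ₁ : ρ < 1
  hθ : 0 < θ
  hσ : 1 < σ
  hγ₀ : 0 ≤ γ
  hγ₁ : γ < 1
  hR : 0 < R

variable {Ω : Type*} [mΩ : MeasurableSpace Ω]

/-- Pathwise-explicit solution of `dk_t = (B k_t - c_t) dt + β₁ k_t dW¹_t`, `k_0 = k₀`. -/
def kProc (S : Setting Ω) (k₀ : ℝ) (c : ℝ → Ω → ℝ) (t : ℝ) (ω : Ω) : ℝ :=
  Real.exp ((S.B - S.β₁ ^ 2 / 2) * t + S.β₁ * S.W1 t ω) *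
    (k₀ - ∫ s in (0:ℝ)..t, c s ω * Real.exp (-((S.B - S.β₁ ^ 2 / 2) * s) - S.β₁ * S.W1 s ω))

/-- Pathwise-explicit solution of `dh_t = ρ (c_t - h_t) dt + β₂ h_t dW²_t`, `h_0 = h₀`. -/
def hProc (S : Setting Ω) (h₀ : ℝ) (c : ℝ → Ω → ℝ) (t : ℝ) (ω : Ω) : ℝ :=
  Real.exp ((-S.ρ - S.β₂ ^ 2 / 2) * t + S.β₂ * S.W2 t ω) *
    (h₀ + S.ρ * ∫ s in (0:ℝ)..t, c s ω * Real.exp ((S.ρ + S.β₂ ^ 2 / 2) * s - S.β₂ * S.W2 s ω))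

/-- Admissibility of a control `c` for the initial condition `(k₀, h₀)`: progressively
measurable, a.s. locally integrable trajectories, `c > 0` ℙ⊗dt-a.e., positive state
processes, and `c ≤ R·k` ℙ⊗dt-a.e. -/
structure IsAdmissible (S : Setting Ω) (k₀ h₀ : ℝ) (c : ℝ → Ω → ℝ) : Prop where
  prog : ProgMeasurable S.F c
  locInt : ∀ᵐ ω ∂S.P, ∀ t : ℝ, 0 ≤ t → IntervalIntegrable (fun s => c s ω) volume 0 t
  cpos : ∀ᵐ ω ∂S.P, ∀ᵐ t ∂(volume.restrict (Set.Ici (0:ℝ))), 0 < c t ω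
  kpos : ∀ᵐ ω ∂S.P, ∀ t : ℝ, 0 ≤ t → 0 < kProc S k₀ c t ω
  hpos : ∀ᵐ ω ∂S.P, ∀ t : ℝ, 0 ≤ t → 0 < hProc S h₀ c t ω
  cbdd : ∀ᵐ ω ∂S.P, ∀ᵐ t ∂(volume.restrict (Set.Ici (0:ℝ))), c t ω ≤ S.R * kProc S k₀ c t ω

/-- The (nonnegative) cost `-J(k₀,h₀;c) ∈ [0,∞]`; note that
`(1/(1-σ))·(c/h^γ)^(1-σ) = -(1/(σ-1))·(h^γ/c)^(σ-1)`. -/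
def Jcost (S : Setting Ω) (k₀ h₀ : ℝ) (c : ℝ → Ω → ℝ) : ℝ≥0∞ :=
  ∫⁻ ω, (∫⁻ t in Set.Ioi (0:ℝ),
    ENNReal.ofReal ((S.σ - 1)⁻¹ * ((hProc S h₀ c t ω) ^ S.γ / c t ω) ^ (S.σ - 1) *
      Real.exp (-S.θ * t))) ∂S.P

/-- The utility functional `J(k₀,h₀;c) ∈ [-∞,0]`. -/
def J (S : Setting Ω) (k₀ h₀ : ℝ) (c : ℝ → Ω → ℝ) : EReal := -(Jcost S k₀ h₀ c : EReal)

/-- The infimum of the costs `-J(k₀,h₀;c)` over admissible controls. -/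
def Vcost (S : Setting Ω) (k₀ h₀ : ℝ) : ℝ≥0∞ :=
  ⨅ c : {c : ℝ → Ω → ℝ // IsAdmissible S k₀ h₀ c}, Jcost S k₀ h₀ c.1

/-- The value function `V(k₀,h₀) = sup_{c ∈ 𝓐(k₀,h₀)} J(k₀,h₀;c) ∈ [-∞,0]`
(the supremum of `J = -Jcost` equals minus the infimum of the costs). -/
def V (S : Setting Ω) (k₀ h₀ : ℝ) : EReal := -(Vcost S k₀ h₀ : EReal)

/-- Assumption 1 on the model parameters (with `λ = max{2, 1/(γ(σ-1))}`; it forces `γ > 0`). -/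
def Assumption1 (S : Setting Ω) : Prop :=
  S.B ≤ S.R ∧ 0 < S.γ ∧
    (S.ρ + (S.β₂ ^ 2 - S.β₁ ^ 2) / 2 ≤ 0 →
      (S.σ - 1) * (-S.γ * S.ρ - (S.γ * S.β₂ ^ 2 - S.β₁ ^ 2) / 2 +
        max 2 (1 / (S.γ * (S.σ - 1))) * (S.σ - 1) * (S.β₁ ^ 2 + S.γ ^ 2 * S.β₂ ^ 2)) < S.θ) ∧
    (0 < S.ρ + (S.β₂ ^ 2 - S.β₁ ^ 2) / 2 →
      (S.σ - 1) * (S.β₁ ^ 2 * (1 - S.γ) / 2 +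
        max 2 (1 / (S.γ * (S.σ - 1))) * (S.σ - 1) * (S.β₁ ^ 2 + S.γ ^ 2 * S.β₂ ^ 2)) < S.θ)

/-- The function `g(c; h, p_k, p_h) = -c·(p_k - ρ·p_h) - (1/(σ-1))·(h^γ/c)^(σ-1)`. -/
def gFun (ρ σ γ : ℝ) (c h pk ph : ℝ) : ℝ :=
  -c * (pk - ρ * ph) - (σ - 1)⁻¹ * (h ^ γ / c) ^ (σ - 1)

/-- The maximized Hamiltonian term `G(k,h,p_k,p_h)`. -/
def GFun (ρ σ γ R : ℝ) (k h pk ph : ℝ) : ℝ :=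
  if pk - ρ * ph ≤ h ^ (γ * (σ - 1)) * (R * k) ^ (-σ) then
    -(R * k) * (pk - ρ * ph) - (σ - 1)⁻¹ * (h ^ γ / (R * k)) ^ (σ - 1)
  else
    -(1 + (σ - 1)⁻¹) * (h ^ γ * (pk - ρ * ph)) ^ (1 - 1 / σ)

/-- The maximum value Hamiltonian `H_max(k,h,p,Q)` (only the diagonal entries of `Q` enter). -/
def Hmax (B β₁ β₂ ρ σ γ R : ℝ) (k h : ℝ) (p : ℝ × ℝ)
    (Q : Matrix (Fin 2) (Fin 2) ℝ) : ℝ :=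
  B * k * p.1 - ρ * h * p.2 + (1 / 2) * β₁ ^ 2 * k ^ 2 * Q 0 0
    + (1 / 2) * β₂ ^ 2 * h ^ 2 * Q 1 1 + GFun ρ σ γ R k h p.1 p.2

/-- `F̃(Q, p, v, (k,h)) = -θ·v + H_max(k,h,p,Q)`. -/
def Ftilde (B β₁ β₂ ρ θ σ γ R : ℝ) (Q : Matrix (Fin 2) (Fin 2) ℝ)
    (p : ℝ × ℝ) (v : ℝ) (z : ℝ × ℝ) : ℝ :=
  -θ * v + Hmax B β₁ β₂ ρ σ γ R z.1 z.2 p Q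

/-- First partial derivative in the first (capital) variable. -/
def pd1 (v : ℝ × ℝ → ℝ) (z : ℝ × ℝ) : ℝ := fderiv ℝ v z (1, 0)

/-- First partial derivative in the second (habit) variable. -/
def pd2 (v : ℝ × ℝ → ℝ) (z : ℝ × ℝ) : ℝ := fderiv ℝ v z (0, 1)

/-- The gradient `∇v` as a pair. -/
def gradVec (v : ℝ × ℝ → ℝ) (z : ℝ × ℝ) : ℝ × ℝ := (pd1 v z, pd2 v z)

/-- The Hessian `D²v` as a 2×2 matrix. -/
def hessMat (v : ℝ × ℝ → ℝ) (z : ℝ × ℝ) : Matrix (Fin 2) (Fin 2) ℝ :=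
  Matrix.of ![![pd1 (pd1 v) z, pd2 (pd1 v) z], ![pd1 (pd2 v) z, pd2 (pd2 v) z]]

end HabitModel

namespace HabitModel

/-! ## Picard iteration -/
section Picard
open Filter Topology
variable {E : Type*} [NormedAddCommGroup E] [NormedSpace ℝ E]

def picIt (f : ℝ → E → E) (x0 : E) : ℕ → ℝ → E
  | 0 => fun _ => x0
  | k + 1 => fun t => x0 + ∫ s in (0:ℝ)..t, f s (picIt f x0 k s)

lemma picIt_cont [CompleteSpace E] {f : ℝ → E → E} (hf : Continuous fun q : ℝ × E => f q.1 q.2) (x0 : E) (k : ℕ) :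
    Continuous (picIt f x0 k) := by
  induction k with
  | zero => exact continuous_const
  | succ k ih =>
    have : Continuous fun s => f s (picIt f x0 k s) := hf.comp (continuous_id.prodMk ih)
    exact continuous_const.add
      (intervalIntegral.continuous_primitive (fun a b => this.intervalIntegrable a b) 0)

theorem picard_exists [CompleteSpace E] {f : ℝ → E → E}
    (hf : Continuous fun q : ℝ × E => f q.1 q.2) {K : ℝ} (hK : 0 < K)
    (hL : ∀ t x y, ‖f t x - f t y‖ ≤ K * ‖x - y‖) (x0 : E) :
    ∃ Y : ℝ → E, Continuous Y ∧ Y 0 = x0 ∧ (∀ t, 0 ≤ t → HasDerivAt Y (f t (Y t)) t) ∧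
      ∀ t, 0 ≤ t → Tendsto (fun k => picIt f x0 k t) atTop (𝓝 (Y t)) := by
  have hpc := picIt_cont hf x0
  have hfc : ∀ k, Continuous fun s => f s (picIt f x0 k s) :=
    fun k => hf.comp (continuous_id.prodMk (hpc k))
  -- uniform geometric bound on [0,T]
  have hb : ∀ T : ℝ, 0 ≤ T → ∃ C : ℝ, 0 ≤ C ∧ ∀ k t, 0 ≤ t → t ≤ T →
      dist (picIt f x0 k t) (picIt f x0 (k+1) t) ≤ C * (1/2)^k := by
    intro T hT
    obtain ⟨C, hC⟩ := isCompact_Icc.exists_bound_of_continuousOn (s := Icc (0:ℝ) T)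
      (f := fun t => picIt f x0 1 t - picIt f x0 0 t) ((hpc 1).sub (hpc 0)).continuousOn
    have hC0 : 0 ≤ C := le_trans (norm_nonneg _) (hC 0 ⟨le_rfl, hT⟩)
    have key : ∀ k t, 0 ≤ t → t ≤ T →
        ‖picIt f x0 (k+1) t - picIt f x0 k t‖ ≤ C * (1/2)^k * Real.exp (2*K*t) := by
      intro k
      induction k with
      | zero =>
        intro t h0 h1
        have := hC t ⟨h0, h1⟩
        have h2 : 1 ≤ Real.exp (2*K*t) := Real.one_le_exp (by positivity)
        calc _ ≤ C := this
          _ ≤ _ := by simp; nlinarith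
      | succ k ih =>
        intro t h0 h1
        have e1 : picIt f x0 (k+1+1) t - picIt f x0 (k+1) t =
            ∫ s in (0:ℝ)..t, (f s (picIt f x0 (k+1) s) - f s (picIt f x0 k s)) := by
          rw [intervalIntegral.integral_sub ((hfc _).intervalIntegrable _ _)
            ((hfc _).intervalIntegrable _ _)]
          simp only [picIt]; abel
        rw [e1]
        have hder : ∀ s ∈ uIcc 0 t, HasDerivAt (fun s => C * (1/2)^(k+1) * Real.exp (2*K*s))
            (K * (C * (1/2)^k * Real.exp (2*K*s))) s := by
          intro s _
          have := ((hasDerivAt_id s).const_mul (2*K)).exp.const_mul (C * (1/2)^(k+1))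
          exact this.congr_deriv (by simp only [id]; ring)
        have hcont : Continuous fun s : ℝ => K * (C * (1/2)^k * Real.exp (2*K*s)) := by fun_prop
        have hint := intervalIntegral.integral_eq_sub_of_hasDerivAt hder
          (hcont.intervalIntegrable _ _)
        calc _ ≤ ∫ s in (0:ℝ)..t, K * (C * (1/2)^k * Real.exp (2*K*s)) := by
              apply intervalIntegral.norm_integral_le_of_norm_le h0
              · apply Filter.Eventually.of_forall
                intro s hs
                exact (hL _ _ _).trans (mul_le_mul_of_nonneg_left
                  (ih s hs.1.le (hs.2.trans h1)) hK.le)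
              · exact hcont.intervalIntegrable _ _
          _ ≤ _ := by
              rw [hint]
              have : 0 ≤ C * (1/2)^(k+1) * Real.exp (2*K*0) := by positivity
              linarith
    refine ⟨C * Real.exp (2*K*T), by positivity, fun k t h0 h1 => ?_⟩
    rw [dist_comm, dist_eq_norm]
    refine (key k t h0 h1).trans ?_
    have : Real.exp (2*K*t) ≤ Real.exp (2*K*T) := by gcongr
    have h3 : 0 ≤ C * (1/2:ℝ)^k := by positivity
    nlinarith
  have hlim : ∀ t : ℝ, 0 ≤ t → ∃ y, Tendsto (fun k => picIt f x0 k t) atTop (𝓝 y) := by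
    intro t ht
    obtain ⟨C, _, hC⟩ := hb t ht
    exact cauchySeq_tendsto_of_complete
      (cauchySeq_of_le_geometric (1/2) C (by norm_num) (fun k => hC k t ht le_rfl))
  choose! y hy using hlim
  have hun : ∀ T : ℝ, 0 ≤ T → ∃ C : ℝ, 0 ≤ C ∧ ∀ k t, 0 ≤ t → t ≤ T →
      dist (picIt f x0 k t) (y t) ≤ C * (1/2)^k := by
    intro T hT
    obtain ⟨C, hC0, hC⟩ := hb T hT
    refine ⟨2 * C, by positivity, fun k t h0 h1 => ?_⟩
    have := dist_le_of_le_geometric_of_tendsto (1/2) C (by norm_num)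
      (fun k => hC k t h0 h1) (hy t h0) k
    calc _ ≤ _ := this
      _ = _ := by ring
  have hpow : ∀ C : ℝ, Tendsto (fun k : ℕ => C * (1/2:ℝ)^k) atTop (𝓝 0) := by
    intro C
    have := (tendsto_pow_atTop_nhds_zero_of_lt_one (r := (1/2:ℝ)) (by norm_num) (by norm_num)).const_mul C
    simpa using this
  have hyc : ∀ T : ℝ, 0 ≤ T → ContinuousOn y (Icc 0 T) := by
    intro T hT
    obtain ⟨C, hC0, hC⟩ := hun T hT
    have hU : TendstoUniformlyOn (fun k => picIt f x0 k) y atTop (Icc 0 T) := by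
      rw [Metric.tendstoUniformlyOn_iff]
      intro ε hε
      filter_upwards [(hpow C).eventually (gt_mem_nhds hε)] with k hk t ht
      rw [dist_comm]
      exact (hC k t ht.1 ht.2).trans_lt hk
    exact hU.continuousOn (Filter.Frequently.of_forall fun k => (hpc k).continuousOn)
  have hyc' : ContinuousOn y (Ici 0) := by
    intro t ht
    have h1 := hyc (t+1) (by have : (0:ℝ) ≤ t := ht; linarith) t ⟨ht, by linarith⟩
    refine h1.mono_of_mem_nhdsWithin ?_
    rw [mem_nhdsWithin]
    exact ⟨Iio (t+1), isOpen_Iio, by simp, fun s hs => ⟨hs.2, hs.1.le⟩⟩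
  let yt : ℝ → E := fun t => y (max t 0)
  have hytc : Continuous yt :=
    hyc'.comp_continuous (continuous_id.max continuous_const) (fun t => Set.mem_Ici.2 (le_max_right _ _))
  have hfy : Continuous fun s => f s (yt s) := hf.comp (continuous_id.prodMk hytc)
  let Y : ℝ → E := fun t => x0 + ∫ s in (0:ℝ)..t, f s (yt s)
  have hYder : ∀ t, HasDerivAt Y (f t (yt t)) t := fun t =>
    (intervalIntegral.integral_hasDerivAt_right (hfy.intervalIntegrable _ _)
      (hfy.stronglyMeasurableAtFilter _ _) hfy.continuousAt).const_add x0
  have hYy : ∀ t, 0 ≤ t → Y t = y t := by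
    intro t ht
    have h1 : Tendsto (fun k => picIt f x0 (k+1) t) atTop (𝓝 (y t)) :=
      (hy t ht).comp (tendsto_add_atTop_nat 1)
    have h2 : Tendsto (fun k => picIt f x0 (k+1) t) atTop (𝓝 (Y t)) := by
      obtain ⟨C, hC0, hC⟩ := hun t ht
      rw [tendsto_iff_dist_tendsto_zero]
      refine squeeze_zero (fun _ => dist_nonneg) (fun k => ?_) (hpow (K * C * t))
      have e1 : picIt f x0 (k+1) t - Y t =
          ∫ s in (0:ℝ)..t, (f s (picIt f x0 k s) - f s (yt s)) := by
        rw [intervalIntegral.integral_sub ((hfc _).intervalIntegrable _ _)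
            (hfy.intervalIntegrable _ _)]
        simp only [picIt, Y]; abel
      rw [dist_eq_norm, e1]
      have := intervalIntegral.norm_integral_le_of_norm_le_const (a := 0) (b := t)
        (C := K * (C * (1/2)^k)) (f := fun s => f s (picIt f x0 k s) - f s (yt s)) (by
          intro s hs
          rw [uIoc_of_le ht] at hs
          have hm : yt s = y s := by simp [yt, hs.1.le]
          rw [hm]
          refine (hL _ _ _).trans (mul_le_mul_of_nonneg_left ?_ hK.le)
          rw [← dist_eq_norm]
          exact hC k s hs.1.le hs.2)
      calc _ ≤ _ := this
        _ = _ := by rw [sub_zero, abs_of_nonneg ht]; ring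
    exact tendsto_nhds_unique h2 h1
  refine ⟨Y, continuous_iff_continuousAt.2 fun t => (hYder t).continuousAt, by simp [Y], ?_, ?_⟩
  · intro t ht
    have := hYder t
    rwa [show yt t = Y t by rw [hYy t ht]; simp [yt, ht]] at this
  · intro t ht
    rw [hYy t ht]; exact hy t ht

end Picard

end HabitModel

namespace HabitModel

/-! ## The reduced one-dimensional Hamiltonian -/

structure OP where
  D : ℝ
  E : ℝ
  L : ℝ
  m : ℝ
  a : ℝ
  b : ℝ
  r : ℝ
  R : ℝ
  η : ℝ
  hD : 0 < D
  hL : 0 < L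
  hm : 0 < m
  ha : 0 < a
  ha1 : a ≤ 1
  hb : 0 < b
  hr : 0 < r
  hR : 0 < R
  hη : 0 < η
  hbr : ∀ s, 0 ≤ s → s ≤ 1 → D * (a^2*s^2 + a*s*(1-s)) + E*a*s - L ≤ -η

namespace OP
variable (p : OP)

def uO (z q : ℝ) : ℝ := (max (p.R ^ (-(p.b+1))) (q * exp (-p.a*z))) ^ (-(1/(p.b+1)))

def Hm (z q : ℝ) : ℝ := p.uO z q * q + p.b⁻¹ * exp (p.a*z) * (p.uO z q) ^ (-p.b)

def F (z x y : ℝ) : ℝ := p.D⁻¹ * (p.L * x - p.E * y - p.Hm z (p.m*x + (1 + p.r*exp (-z))*y))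

lemma hb1 : 0 < p.b + 1 := by linarith [p.hb]

lemma max_pos (z q : ℝ) : 0 < max (p.R ^ (-(p.b+1))) (q * exp (-p.a*z)) :=
  lt_max_of_lt_left (rpow_pos_of_pos p.hR _)

lemma uO_pos (z q : ℝ) : 0 < p.uO z q := rpow_pos_of_pos (p.max_pos z q) _

lemma uO_rpow (z q : ℝ) : (p.uO z q) ^ (-(p.b+1)) = max (p.R ^ (-(p.b+1))) (q * exp (-p.a*z)) := by
  unfold uO
  rw [← rpow_mul (p.max_pos z q).le]
  have : -(1/(p.b+1)) * (-(p.b+1)) = 1 := by have := p.hb1.ne'; field_simp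
  rw [this, rpow_one]

lemma uO_le (z q : ℝ) : p.uO z q ≤ p.R := by
  have h1 : p.R ^ (-(p.b+1)) ≤ (p.uO z q) ^ (-(p.b+1)) := by
    rw [uO_rpow]; exact le_max_left _ _
  by_contra h
  push Not at h
  have := rpow_lt_rpow_of_neg p.hR h (neg_lt_zero.2 p.hb1)
  linarith

lemma tangent {u v b : ℝ} (hu : 0 < u) (hv : 0 < v) (hb : 0 < b) :
    v ^ (-b) - b * v ^ (-(b+1)) * (u - v) ≤ u ^ (-b) := by
  have hx : 0 < u / v := by positivity
  have h1 : 1 - b * (u/v - 1) ≤ (u/v) ^ (-b) := by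
    rw [rpow_def_of_pos hx]
    have := add_one_le_exp (log (u/v) * -b)
    have h2 := log_le_sub_one_of_pos hx
    nlinarith
  have h3 : u ^ (-b) = v ^ (-b) * (u/v) ^ (-b) := by
    rw [← mul_rpow hv.le hx.le]; congr 1; field_simp
  have h4 : v ^ (-(b+1)) * v = v ^ (-b) := by
    rw [← rpow_add_one hv.ne']; congr 1; ring
  have hvb : 0 < v ^ (-b) := rpow_pos_of_pos hv _
  rw [h3]
  calc _ = v ^ (-b) * (1 - b * (u/v - 1)) := by
        rw [← h4]; field_simp
    _ ≤ _ := by gcongr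

lemma Hm_le (z q u : ℝ) (hu : 0 < u) (huR : u ≤ p.R) :
    p.Hm z q ≤ u * q + p.b⁻¹ * exp (p.a*z) * u ^ (-p.b) := by
  have hA : 0 < exp (p.a*z) := exp_pos _
  have hv := p.uO_pos z q
  have ht := tangent hu hv p.hb
  have hw := p.uO_rpow z q
  have hexp : exp (p.a*z) * exp (-p.a*z) = 1 := by rw [← exp_add]; simp
  unfold Hm
  set v := p.uO z q with hvdef
  have key : 0 ≤ (u - v) * (q - exp (p.a*z) * v ^ (-(p.b+1))) := by
    rw [hw]
    rcases le_total (p.R ^ (-(p.b+1))) (q * exp (-p.a*z)) with h | h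
    · rw [max_eq_right h]
      have : q - exp (p.a*z) * (q * exp (-p.a*z)) = 0 := by
        linear_combination -q * hexp
      rw [this, mul_zero]
    · rw [max_eq_left h] at hw ⊢
      have hvR : v = p.R := by
        have : (v ^ (-(p.b+1))) ^ (-(1/(p.b+1))) = (p.R ^ (-(p.b+1))) ^ (-(1/(p.b+1))) := by rw [hw]
        rw [← rpow_mul hv.le, ← rpow_mul p.hR.le] at this
        have e : -(p.b+1) * -(1/(p.b+1)) = 1 := by have := p.hb1.ne'; field_simp
        rw [e, rpow_one, rpow_one] at this; exact this
      have h5 : q ≤ exp (p.a*z) * p.R ^ (-(p.b+1)) := by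
        have := mul_le_mul_of_nonneg_left h hA.le
        have e : exp (p.a*z) * (q * exp (-p.a*z)) = q := by linear_combination q * hexp
        linarith
      rw [hvR]
      nlinarith
  have hbi : p.b⁻¹ * p.b = 1 := inv_mul_cancel₀ p.hb.ne'
  have h6 : p.b⁻¹ * exp (p.a*z) * (v ^ (-p.b) - p.b * v ^ (-(p.b+1)) * (u - v)) ≤
      p.b⁻¹ * exp (p.a*z) * u ^ (-p.b) :=
    mul_le_mul_of_nonneg_left ht (mul_nonneg (inv_nonneg.2 p.hb.le) hA.le)
  have h7 : p.b⁻¹ * exp (p.a*z) * (v ^ (-p.b) - p.b * v ^ (-(p.b+1)) * (u - v)) =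
     p.b⁻¹ * exp (p.a*z) * v ^ (-p.b) - exp (p.a*z) * v ^ (-(p.b+1)) * (u-v) := by
    linear_combination (- exp (p.a*z) * v ^ (-(p.b+1)) * (u-v)) * hbi
  nlinarith

lemma Hm_lip (z q q' : ℝ) : |p.Hm z q - p.Hm z q'| ≤ p.R * |q - q'| := by
  have main : ∀ q q', p.Hm z q - p.Hm z q' ≤ p.R * |q - q'| := by
    intro q q'
    have h := p.Hm_le z q (p.uO z q') (p.uO_pos _ _) (p.uO_le _ _)
    have e : p.Hm z q' = p.uO z q' * q' + p.b⁻¹ * exp (p.a*z) * (p.uO z q') ^ (-p.b) := rfl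
    have h2 : p.uO z q' * (q - q') ≤ p.R * |q - q'| :=
      (mul_le_mul_of_nonneg_left (le_abs_self _) (p.uO_pos _ _).le).trans
        (mul_le_mul_of_nonneg_right (p.uO_le _ _) (abs_nonneg _))
    nlinarith
  rw [abs_le]
  constructor
  · have := main q' q; rw [abs_sub_comm] at this; linarith
  · exact main q q'

lemma uO_cont : Continuous fun w : ℝ × ℝ => p.uO w.1 w.2 := by
  unfold uO
  apply Continuous.rpow_const
  · fun_prop
  · intro w; left; exact (p.max_pos _ _).ne'

lemma Hm_cont : Continuous fun w : ℝ × ℝ => p.Hm w.1 w.2 := by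
  unfold Hm
  have h := p.uO_cont
  have h2 : Continuous fun w : ℝ × ℝ => (p.uO w.1 w.2) ^ (-p.b) :=
    h.rpow_const fun w => Or.inl (p.uO_pos _ _).ne'
  fun_prop

lemma F_cont : Continuous fun w : ℝ × ℝ × ℝ => p.F w.1 w.2.1 w.2.2 := by
  unfold F
  have h : Continuous fun w : ℝ × ℝ × ℝ => p.Hm w.1 (p.m*w.2.1 + (1 + p.r*exp (-w.1))*w.2.2) :=
    p.Hm_cont.comp (f := fun w : ℝ × ℝ × ℝ => (w.1, p.m*w.2.1 + (1 + p.r*exp (-w.1))*w.2.2))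
      (by fun_prop)
  fun_prop

lemma F_lip (z x y x' y' : ℝ) : |p.F z x y - p.F z x' y'| ≤
    p.D⁻¹ * ((p.L + p.R * p.m) * |x - x'| + (|p.E| + p.R * (1 + p.r * exp (-z))) * |y - y'|) := by
  unfold F
  rw [← mul_sub, abs_mul, abs_of_pos (inv_pos.2 p.hD)]
  refine mul_le_mul_of_nonneg_left ?_ (inv_pos.2 p.hD).le
  have h1 := p.Hm_lip z (p.m*x + (1 + p.r*exp (-z))*y) (p.m*x' + (1 + p.r*exp (-z))*y')
  have hc : 0 < 1 + p.r*exp (-z) := by have := p.hr; positivity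
  have h2 : |(p.m*x + (1 + p.r*exp (-z))*y) - (p.m*x' + (1 + p.r*exp (-z))*y')| ≤
      p.m * |x-x'| + (1 + p.r*exp (-z)) * |y-y'| := by
    rw [show (p.m*x + (1 + p.r*exp (-z))*y) - (p.m*x' + (1 + p.r*exp (-z))*y') =
      p.m*(x-x') + (1 + p.r*exp (-z))*(y-y') by ring]
    refine (abs_add_le _ _).trans ?_
    rw [abs_mul, abs_mul, abs_of_pos p.hm, abs_of_pos hc]
  rw [show p.L * x - p.E * y - p.Hm z (p.m*x + (1 + p.r*exp (-z))*y) -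
     (p.L * x' - p.E * y' - p.Hm z (p.m*x' + (1 + p.r*exp (-z))*y')) =
     p.L * (x-x') + (-(p.E * (y-y'))) +
       -(p.Hm z (p.m*x + (1 + p.r*exp (-z))*y) - p.Hm z (p.m*x' + (1 + p.r*exp (-z))*y')) by ring]
  refine (abs_add_three _ _ _).trans ?_
  rw [abs_neg, abs_neg, abs_mul, abs_mul, abs_of_pos p.hL]
  have h3 := h1.trans (mul_le_mul_of_nonneg_left h2 p.hR.le)
  linarith

lemma Hm_zero_pos (z : ℝ) : 0 < p.Hm z 0 := by
  unfold Hm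
  have := p.uO_pos z 0
  have := p.hb
  have := rpow_pos_of_pos (p.uO_pos z 0) (-p.b)
  rw [mul_zero, zero_add]; positivity

/-- sub-solution -/
lemma F_zero_neg (z : ℝ) : p.F z 0 0 < 0 := by
  unfold F
  have := p.Hm_zero_pos z
  have h := inv_pos.2 p.hD
  simp only [mul_zero, add_zero, sub_zero, zero_sub]
  nlinarith

/-- super-solution -/
lemma exists_super : ∃ C : ℝ, 0 < C ∧ ∃ Φ Φ1 Φ2 : ℝ → ℝ, (∀ z, Φ z = C * (1 + exp z) ^ p.a) ∧
    (∀ z, HasDerivAt Φ (Φ1 z) z) ∧ (∀ z, HasDerivAt Φ1 (Φ2 z) z) ∧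
    ∀ z, Φ2 z < p.F z (Φ z) (Φ1 z) := by
  have ha := p.ha
  have hm := p.hm
  have hr := p.hr
  have hb := p.hb
  have hη := p.hη
  set u0 := min p.R (p.η / (2 * (p.m + p.a + p.r * p.a))) with hu0
  have hu0p : 0 < u0 := lt_min p.hR (by positivity)
  have hu0R : u0 ≤ p.R := min_le_left _ _
  have hu0η : u0 * (p.m + p.a + p.r * p.a) ≤ p.η / 2 := by
    have h1 : u0 ≤ p.η / (2 * (p.m + p.a + p.r * p.a)) := min_le_right _ _
    rw [le_div_iff₀ (by positivity)] at h1
    linarith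
  have hup : 0 < u0 ^ (-p.b) := rpow_pos_of_pos hu0p _
  set C := 4 * p.b⁻¹ * u0 ^ (-p.b) / p.η with hC
  have hCp : 0 < C := by positivity
  let f : ℝ → ℝ := fun z => (1 + exp z) ^ p.a
  let s : ℝ → ℝ := fun z => exp z / (1 + exp z)
  have h1e : ∀ z, 0 < 1 + exp z := fun z => by positivity
  have hs' : ∀ z, HasDerivAt s (s z * (1 - s z)) z := by
    intro z
    have := (hasDerivAt_exp z).div ((hasDerivAt_exp z).const_add 1) (h1e z).ne'
    refine this.congr_deriv ?_
    simp only [s]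
    have := (h1e z).ne'
    field_simp
  have hf' : ∀ z, HasDerivAt f (p.a * s z * f z) z := by
    intro z
    have := ((hasDerivAt_exp z).const_add 1).rpow_const (p := p.a) (Or.inl (h1e z).ne')
    refine this.congr_deriv ?_
    simp only [s, f]
    rw [rpow_sub_one (h1e z).ne']
    ring
  refine ⟨C, hCp, fun z => C * f z, fun z => C * (p.a * s z * f z),
    fun z => C * (f z * (p.a^2 * s z^2 + p.a * s z * (1 - s z))), fun z => rfl,
    fun z => (hf' z).const_mul C, fun z => ?_, fun z => ?_⟩
  · refine ((((hs' z).const_mul p.a).mul (hf' z)).const_mul C).congr_deriv ?_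
    ring
  · have hfp : 0 < f z := rpow_pos_of_pos (h1e z) _
    have hs0 : 0 ≤ s z := by have := h1e z; simp only [s]; positivity
    have hs1 : s z ≤ 1 := by
      simp only [s]; rw [div_le_one (h1e z)]; linarith
    have hse : exp (-z) * s z ≤ 1 := by
      simp only [s]
      rw [← mul_div_assoc, ← exp_add, neg_add_cancel, exp_zero, div_le_one (h1e z)]
      linarith [exp_pos z]
    have hbr := p.hbr (s z) hs0 hs1
    have hH := p.Hm_le z (p.m*(C * f z) + (1 + p.r*exp (-z))*(C * (p.a * s z * f z))) u0 hu0p hu0R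
    have hez : exp (p.a * z) ≤ f z := by
      simp only [f]
      rw [mul_comm, exp_mul]
      exact rpow_le_rpow (exp_pos z).le (by linarith) ha.le
    have hcost : p.b⁻¹ * exp (p.a*z) * u0 ^ (-p.b) < p.η/2 * (C * f z) := by
      have e : p.η/2 * (C * f z) = 2 * (p.b⁻¹ * f z * u0 ^ (-p.b)) := by
        rw [hC]; field_simp; ring
      rw [e]
      have h1 : p.b⁻¹ * exp (p.a*z) * u0 ^ (-p.b) ≤ p.b⁻¹ * f z * u0 ^ (-p.b) := by gcongr
      have h2 : 0 < p.b⁻¹ * f z * u0 ^ (-p.b) := by positivity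
      linarith
    have hu : u0 * (p.m + p.a * s z + p.r * p.a * (exp (-z) * s z)) ≤ p.η/2 := by
      refine le_trans ?_ hu0η
      apply mul_le_mul_of_nonneg_left _ hu0p.le
      have : p.a * s z ≤ p.a := by nlinarith
      have : p.r * p.a * (exp (-z) * s z) ≤ p.r * p.a := by
        have : 0 < p.r * p.a := by positivity
        nlinarith
      linarith
    have hCf : 0 < C * f z := by positivity
    have hfin : p.D * (C * (f z * (p.a^2 * s z^2 + p.a * s z * (1 - s z)))) <
        p.L * (C * f z) - p.E * (C * (p.a * s z * f z)) -
          p.Hm z (p.m*(C * f z) + (1 + p.r*exp (-z))*(C * (p.a * s z * f z))) := by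
      have h1 := mul_le_mul_of_nonneg_left hbr hCf.le
      have h2 := mul_le_mul_of_nonneg_left hu hCf.le
      nlinarith
    unfold F
    rw [inv_mul_eq_div, lt_div_iff₀ p.hD]
    linarith

end OP
end HabitModel

namespace HabitModel
open Filter Topology

/-- slope barrier -/
lemma slope_barrier {v v' : ℝ → ℝ} {T L A : ℝ} (hL : 0 < L) (hA : 0 ≤ A)
    (hv : ∀ t, 0 ≤ t → HasDerivAt v (v' t) t)
    (hv' : ∀ t, 0 ≤ t → -A - L * |v t| ≤ v' t) (h0 : (A + 1) * exp ((L+1)*T) + 1 ≤ v 0) :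
    ∀ t ∈ Icc 0 T, 0 < v t := by
  set s := (A + 1) * exp ((L+1)*T) with hs
  have key : ∀ ⦃x⦄, x ∈ Icc (0:ℝ) T → -v x ≤ -(s * exp (-(L+1)*x)) := by
    refine image_le_of_deriv_right_lt_deriv_boundary (f' := fun x => - v' x)
      (B' := fun x => s * (L+1) * exp (-(L+1)*x)) ?_ ?_ ?_ ?_ ?_
    · intro t ht
      exact (hv t ht.1).neg.continuousAt.continuousWithinAt
    · intro t ht
      exact (hv t ht.1).neg.hasDerivWithinAt
    · simp; linarith
    · intro x
      have h1 : HasDerivAt (fun x : ℝ => -(L+1)*x) (-(L+1)) x := by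
        simpa using (hasDerivAt_id x).const_mul (-(L+1))
      refine (h1.exp.const_mul s).neg.congr_deriv ?_
      ring
    · intro x hx he
      have he' : v x = s * exp (-(L+1)*x) := by linarith
      have hsx : A + 1 ≤ s * exp (-(L+1)*x) := by
        rw [hs, mul_assoc, ← exp_add]
        have : 1 ≤ exp ((L+1)*T + -(L+1)*x) := one_le_exp (by nlinarith [hx.2])
        nlinarith
      have h2 := hv' x hx.1
      rw [he', abs_of_pos (by linarith)] at h2
      nlinarith
  intro t ht
  have := key ht
  have h3 : 0 < s * exp (-(L+1)*t) := by rw [hs]; positivity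
  linarith

theorem bvp_exists {F : ℝ → ℝ → ℝ → ℝ} {T L A : ℝ} (hT : 0 < T) (hL : 0 < L)
    (hF : Continuous fun w : ℝ × ℝ × ℝ => F w.1 w.2.1 w.2.2)
    (hLip : ∀ t x y x' y', |F t x y - F t x' y'| ≤ L * (|x-x'| + |y-y'|))
    (hA : ∀ t x, |F t x 0| ≤ A) :
    ∃ φ ψ : ℝ → ℝ, φ 0 = 0 ∧ φ T = 0 ∧ ∀ t, 0 ≤ t → HasDerivAt φ (ψ t) t ∧
      HasDerivAt ψ (F t (φ t) (ψ t)) t := by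
  have hA0 : 0 ≤ A := (abs_nonneg _).trans (hA 0 0)
  let f : ℝ → ℝ × ℝ → ℝ × ℝ := fun t q => (q.2, F t q.1 q.2)
  have hfc : Continuous fun q : ℝ × (ℝ × ℝ) => f q.1 q.2 := by
    refine Continuous.prodMk (by fun_prop) ?_
    exact hF
  have hfL : ∀ t x y, ‖f t x - f t y‖ ≤ (2*L+1) * ‖x - y‖ := by
    intro t x y
    have h1 : |x.1 - y.1| ≤ ‖x - y‖ := norm_fst_le (x - y)
    have h2 : |x.2 - y.2| ≤ ‖x - y‖ := norm_snd_le (x - y)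
    have h3 := hLip t x.1 x.2 y.1 y.2
    have h4 := norm_nonneg (x - y)
    refine (Prod.norm_def _).trans_le (max_le ?_ ?_)
    · simp only [f, Prod.mk_sub_mk, Real.norm_eq_abs]; nlinarith
    · simp only [f, Prod.mk_sub_mk, Real.norm_eq_abs]; nlinarith
  choose Y hYc hY0 hYd _ using fun s : ℝ => picard_exists hfc (K := 2*L+1) (by linarith) hfL ((0, s) : ℝ × ℝ)
  have hd1 : ∀ s t, 0 ≤ t → HasDerivAt (fun t => (Y s t).1) (Y s t).2 t := fun s t ht =>
    (hasFDerivAt_fst (𝕜 := ℝ) (p := Y s t)).comp_hasDerivAt (f := Y s) t (hYd s t ht)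
  have hd2 : ∀ s t, 0 ≤ t → HasDerivAt (fun t => (Y s t).2) (F t (Y s t).1 (Y s t).2) t := fun s t ht =>
    (hasFDerivAt_snd (𝕜 := ℝ) (p := Y s t)).comp_hasDerivAt (f := Y s) t (hYd s t ht)
  have hcont : Continuous fun s => (Y s T).1 := by
    have hd : ∀ s s', dist (Y s T) (Y s' T) ≤ |s - s'| * exp ((2*L+1) * T) := by
      intro s s'
      have hK : (0:ℝ) ≤ 2*L+1 := by linarith
      have := dist_le_of_trajectories_ODE (v := f) (K := ⟨2*L+1, hK⟩) (f := Y s) (g := Y s')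
        (a := 0) (b := T) (δ := |s - s'|) ?_ (hYc s).continuousOn
        (fun t ht => (hYd s t ht.1).hasDerivWithinAt)
        (hYc s').continuousOn (fun t ht => (hYd s' t ht.1).hasDerivWithinAt) ?_ T ⟨hT.le, le_rfl⟩
      · rw [sub_zero] at this; exact this
      · intro t
        refine LipschitzWith.of_dist_le_mul fun x y => ?_
        rw [dist_eq_norm, dist_eq_norm]; exact hfL t x y
      · rw [hY0, hY0, Prod.dist_eq]
        simp [Real.dist_eq]
    refine continuous_fst.comp (?_ : Continuous fun s => Y s T)
    refine (LipschitzWith.of_dist_le_mul (K := ⟨exp ((2*L+1) * T), (exp_pos _).le⟩) fun s s' => ?_).continuous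
    rw [Real.dist_eq, mul_comm]; exact hd s s'
  have hb : ∀ t x y, |F t x y| ≤ A + L * |y| := by
    intro t x y
    have h1 := hLip t x y x 0
    have h2 := hA t x
    simp only [sub_self, abs_zero, zero_add, sub_zero] at h1
    have := abs_sub_abs_le_abs_sub (F t x y) (F t x 0)
    linarith
  set s0 := (A + 1) * exp ((L+1)*T) + 1
  have hpos : 0 ≤ (Y s0 T).1 := by
    have hv := slope_barrier (v := fun t => (Y s0 t).2) (T := T) hL hA0 (hd2 s0)
      (fun t ht => by
        have := neg_abs_le (F t (Y s0 t).1 (Y s0 t).2)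
        have := hb t (Y s0 t).1 (Y s0 t).2
        linarith) (by rw [hY0])
    have hm : MonotoneOn (fun t => (Y s0 t).1) (Icc 0 T) := by
      refine monotoneOn_of_deriv_nonneg (convex_Icc _ _) (continuous_fst.comp (hYc s0)).continuousOn ?_ ?_
      · intro t ht; rw [interior_Icc] at ht
        exact (hd1 s0 t ht.1.le).differentiableAt.differentiableWithinAt
      · intro t ht; rw [interior_Icc] at ht
        rw [(hd1 s0 t ht.1.le).deriv]; exact (hv t ⟨ht.1.le, ht.2.le⟩).le
    have := hm ⟨le_rfl, hT.le⟩ ⟨hT.le, le_rfl⟩ hT.le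
    simpa [hY0] using this
  have hneg : (Y (-s0) T).1 ≤ 0 := by
    have hv := slope_barrier (v := fun t => -(Y (-s0) t).2) (T := T) hL hA0 (fun t ht => (hd2 (-s0) t ht).neg)
      (fun t ht => by
        have := le_abs_self (F t (Y (-s0) t).1 (Y (-s0) t).2)
        have := hb t (Y (-s0) t).1 (Y (-s0) t).2
        rw [abs_neg]
        linarith) (by rw [hY0]; simp [s0])
    have hm : AntitoneOn (fun t => (Y (-s0) t).1) (Icc 0 T) := by
      refine antitoneOn_of_deriv_nonpos (convex_Icc _ _) (continuous_fst.comp (hYc (-s0))).continuousOn ?_ ?_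
      · intro t ht; rw [interior_Icc] at ht
        exact (hd1 (-s0) t ht.1.le).differentiableAt.differentiableWithinAt
      · intro t ht; rw [interior_Icc] at ht
        rw [(hd1 (-s0) t ht.1.le).deriv]
        have := (hv t ⟨ht.1.le, ht.2.le⟩).le
        linarith
    have := hm ⟨le_rfl, hT.le⟩ ⟨hT.le, le_rfl⟩ hT.le
    simpa [hY0] using this
  obtain ⟨s, hs⟩ : (0:ℝ) ∈ Set.range fun s => (Y s T).1 :=
    mem_range_of_exists_le_of_exists_ge hcont ⟨-s0, hneg⟩ ⟨s0, hpos⟩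
  exact ⟨fun t => (Y s t).1, fun t => (Y s t).2, by simp [hY0], hs,
    fun t ht => ⟨hd1 s t ht, hd2 s t ht⟩⟩

/-- second-derivative test -/
lemma no_min_of_neg {g g1 : ℝ → ℝ} {z c : ℝ} (hg : ∀ᶠ w in 𝓝 z, HasDerivAt g (g1 w) w)
    (hg1 : HasDerivAt g1 c z) (hc : c < 0) (hm : IsLocalMin g z) : False := by
  have h0 : g1 z = 0 := hm.hasDerivAt_eq_zero hg.self_of_nhds
  have hs : ∀ᶠ w in 𝓝[>] z, g1 w < 0 := by
    have h1 := (hasDerivAt_iff_tendsto_slope.1 hg1).mono_left (nhdsGT_le_nhdsNE z)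
    filter_upwards [h1.eventually (gt_mem_nhds hc), self_mem_nhdsWithin] with w hw hzw
    rw [slope_def_field, h0, sub_zero] at hw
    have hz : 0 < w - z := sub_pos.2 hzw
    by_contra hcon
    push Not at hcon
    exact absurd hw (not_lt.2 (div_nonneg hcon hz.le))
  have hall : ∀ᶠ w in 𝓝[>] z, g1 w < 0 ∧ HasDerivAt g (g1 w) w ∧ g z ≤ g w :=
    hs.and ((hg.filter_mono nhdsWithin_le_nhds).and (hm.filter_mono nhdsWithin_le_nhds))
  obtain ⟨u, hu, hsub⟩ := (mem_nhdsGT_iff_exists_Ioc_subset).1 hall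
  have hzu : z < u := hu
  obtain ⟨ξ, hξ, he⟩ := exists_hasDerivAt_eq_slope g g1 hzu
    (fun w hw => by
      rcases eq_or_lt_of_le hw.1 with h | h
      · rw [← h]; exact hg.self_of_nhds.continuousAt.continuousWithinAt
      · exact (hsub ⟨h, hw.2⟩).2.1.continuousAt.continuousWithinAt)
    (fun w hw => (hsub ⟨hw.1, hw.2.le⟩).2.1)
  have h1 := (hsub ⟨hξ.1, hξ.2.le⟩).1
  have h2 := (hsub (⟨hzu, le_rfl⟩ : u ∈ Ioc z u)).2.2
  rw [he, div_lt_iff₀ (sub_pos.2 hzu)] at h1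
  linarith

/-- maximum principle on `[0,T]` -/
lemma nonneg_of_no_min {g g1 g2 : ℝ → ℝ} {T : ℝ} (hT : 0 < T)
    (hg : ∀ t, 0 ≤ t → HasDerivAt g (g1 t) t) (hg1 : ∀ t, 0 ≤ t → HasDerivAt g1 (g2 t) t)
    (h0 : 0 ≤ g 0) (hTT : 0 ≤ g T) (hneg : ∀ t ∈ Ioo 0 T, g t < 0 → g1 t = 0 → g2 t < 0) :
    ∀ t ∈ Icc 0 T, 0 ≤ g t := by
  obtain ⟨z, hz, hmin⟩ := isCompact_Icc.exists_isMinOn (nonempty_Icc.2 hT.le)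
    (fun t ht => (hg t ht.1).continuousAt.continuousWithinAt : ContinuousOn g (Icc 0 T))
  intro t ht
  by_contra hlt
  push Not at hlt
  have hgz : g z < 0 := (hmin ht).trans_lt hlt
  have hz0 : 0 < z := lt_of_le_of_ne hz.1 (by rintro rfl; linarith)
  have hzT : z < T := lt_of_le_of_ne hz.2 (by rintro rfl; linarith)
  have hloc : IsLocalMin g z := hmin.isLocalMin (Icc_mem_nhds hz0 hzT)
  have hev : ∀ᶠ w in 𝓝 z, HasDerivAt g (g1 w) w := by
    filter_upwards [lt_mem_nhds hz0] with w hw using hg w hw.le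
  exact no_min_of_neg hev (hg1 z hz.1)
    (hneg z ⟨hz0, hzT⟩ hgz (hloc.hasDerivAt_eq_zero (hg z hz.1))) hloc

/-- interior derivative bound -/
lemma deriv_bound {g g1 g2 : ℝ → ℝ} {α ℓ M A L : ℝ} (hℓ : 0 < ℓ) (hL : 0 ≤ L) (hA : 0 ≤ A)
    (hg : ∀ t ∈ Icc α (α+ℓ), HasDerivAt g (g1 t) t)
    (hg1 : ∀ t ∈ Icc α (α+ℓ), HasDerivAt g1 (g2 t) t)
    (hM : ∀ t ∈ Icc α (α+ℓ), |g t| ≤ M) (h2 : ∀ t ∈ Icc α (α+ℓ), |g2 t| ≤ A + L * |g1 t|)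
    (hℓL : ℓ * L ≤ 1/2) : ∀ t ∈ Icc α (α+ℓ), |g1 t| ≤ 4 * M / ℓ + 2 * ℓ * A := by
  have hc1 : ContinuousOn g1 (Icc α (α+ℓ)) := fun t ht => (hg1 t ht).continuousAt.continuousWithinAt
  obtain ⟨w, hw, hmax⟩ := isCompact_Icc.exists_isMaxOn (nonempty_Icc.2 (by linarith : α ≤ α + ℓ))
    hc1.abs
  set N := |g1 w|
  have hN : ∀ t ∈ Icc α (α+ℓ), |g1 t| ≤ N := fun t ht => hmax ht
  have hlt : α < α + ℓ := by linarith
  obtain ⟨ξ, hξ, he⟩ := exists_hasDerivAt_eq_slope g g1 hlt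
    (fun t ht => (hg t ht).continuousAt.continuousWithinAt) (fun t ht => hg t ⟨ht.1.le, ht.2.le⟩)
  have hξ' : |g1 ξ| ≤ 2 * M / ℓ := by
    rw [he, abs_div, add_sub_cancel_left, abs_of_pos hℓ]
    gcongr
    have h3 := hM _ (right_mem_Icc.2 hlt.le)
    have h4 := hM _ (left_mem_Icc.2 hlt.le)
    refine (abs_sub _ _).trans ?_
    linarith
  have hd : ‖g1 w - g1 ξ‖ ≤ (A + L * N) * ‖w - ξ‖ := by
    refine (convex_Icc α (α+ℓ)).norm_image_sub_le_of_norm_hasDerivWithin_le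
      (fun t ht => (hg1 t ht).hasDerivWithinAt) (fun t ht => ?_) ⟨hξ.1.le, hξ.2.le⟩ hw
    refine (h2 t ht).trans ?_
    have := hN t ht
    gcongr
  have hwξ : ‖w - ξ‖ ≤ ℓ := by
    rw [Real.norm_eq_abs, abs_le]; constructor <;> linarith [hw.1, hw.2, hξ.1, hξ.2]
  have hN0 : 0 ≤ N := abs_nonneg _
  have h5 : N ≤ |g1 ξ| + (A + L*N) * ℓ := by
    have h6 : |g1 w| - |g1 ξ| ≤ |g1 w - g1 ξ| := abs_sub_abs_le_abs_sub _ _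
    rw [Real.norm_eq_abs] at hd
    have : (A + L*N) * ‖w - ξ‖ ≤ (A + L*N) * ℓ := by gcongr
    linarith
  have h7 : ℓ * L * N ≤ 1/2 * N := by gcongr
  have h8 : 4 * M / ℓ = 2 * (2 * M / ℓ) := by ring
  intro t ht
  have := hN t ht
  rw [h8]
  nlinarith

/-- compactness: limits of ODE solutions -/
lemma ode_limit {F : ℝ → ℝ → ℝ → ℝ} (hF : Continuous fun w : ℝ × ℝ × ℝ => F w.1 w.2.1 w.2.2)
    (φ ψ : ℕ → ℝ → ℝ)
    (h : ∀ z : ℝ, ∃ C : ℝ, 0 ≤ C ∧ ∀ᶠ n in atTop, ∀ w ∈ Icc (z-1) (z+1),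
      |φ n w| ≤ C ∧ |ψ n w| ≤ C ∧ |F w (φ n w) (ψ n w)| ≤ C ∧ HasDerivAt (φ n) (ψ n w) w ∧
      HasDerivAt (ψ n) (F w (φ n w) (ψ n w)) w) :
    ∃ (U : Ultrafilter ℕ) (φ' ψ' : ℝ → ℝ), (U : Filter ℕ) ≤ atTop ∧
      (∀ z, Tendsto (fun n => φ n z) U (𝓝 (φ' z))) ∧ (∀ z, Tendsto (fun n => ψ n z) U (𝓝 (ψ' z))) ∧
      ∀ z, HasDerivAt φ' (ψ' z) z ∧ HasDerivAt ψ' (F z (φ' z) (ψ' z)) z := by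
  let U : Ultrafilter ℕ := Filter.hyperfilter ℕ
  have hU : (U : Filter ℕ) ≤ atTop := by
    rw [← Nat.cofinite_eq_atTop]; exact Filter.hyperfilter_le_cofinite
  have hlim : ∀ (u : ℕ → ℝ) (C : ℝ), (∀ᶠ n in atTop, |u n| ≤ C) → ∃ x, Tendsto u U (𝓝 x) := by
    intro u C hu
    obtain ⟨x, -, hx⟩ := (isCompact_Icc (a := -C) (b := C)).ultrafilter_le_nhds (U.map u) (by
      rw [le_principal_iff]
      have h1 := hu.filter_mono hU
      show ∀ᶠ n in (U : Filter ℕ), u n ∈ Icc (-C) C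
      filter_upwards [h1] with n hn using abs_le.1 hn)
    exact ⟨x, hx⟩
  choose C hC0 hC using h
  have self_mem : ∀ z : ℝ, z ∈ Icc (z-1) (z+1) := fun z => ⟨by linarith, by linarith⟩
  choose φ' hφ' using fun z => hlim (fun n => φ n z) (C z) ((hC z).mono fun n hn => (hn z (self_mem z)).1)
  choose ψ' hψ' using fun z => hlim (fun n => ψ n z) (C z) ((hC z).mono fun n hn => (hn z (self_mem z)).2.1)
  refine ⟨U, φ', ψ', hU, hφ', hψ', fun z => ?_⟩
  have hseg : ∀ δ : ℝ, |δ| ≤ 1 → uIcc z (z+δ) ⊆ Icc (z-1) (z+1) := by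
    intro δ hδ w hw
    rw [abs_le] at hδ
    rcases mem_uIcc.1 hw with h | h <;> constructor <;> linarith [h.1, h.2]
  have hlip : ∀ᶠ n in atTop, ∀ w ∈ Icc (z-1) (z+1), |φ n w - φ n z| ≤ C z * |w - z| ∧
      |ψ n w - ψ n z| ≤ C z * |w - z| := by
    filter_upwards [hC z] with n hn w hw
    constructor
    · exact (convex_Icc (z-1) (z+1)).norm_image_sub_le_of_norm_hasDerivWithin_le
        (fun t ht => (hn t ht).2.2.2.1.hasDerivWithinAt) (fun t ht => (hn t ht).2.1) (self_mem z) hw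
    · exact (convex_Icc (z-1) (z+1)).norm_image_sub_le_of_norm_hasDerivWithin_le
        (fun t ht => (hn t ht).2.2.2.2.hasDerivWithinAt) (fun t ht => (hn t ht).2.2.1) (self_mem z) hw
  -- generic step
  have step : ∀ (u u1 : ℕ → ℝ → ℝ) (u' : ℝ → ℝ) (d : ℝ),
      (∀ z, Tendsto (fun n => u n z) U (𝓝 (u' z))) →
      (∀ᶠ n in (U : Filter ℕ), ∀ w ∈ Icc (z-1) (z+1), HasDerivAt (u n) (u1 n w) w) →
      (∀ ε > 0, ∃ η > 0, η ≤ 1 ∧ ∀ᶠ n in (U : Filter ℕ), ∀ w, |w - z| ≤ η → |u1 n w - d| ≤ ε) →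
      HasDerivAt u' d z := by
    intro u u1 u' d hu hder hmod
    rw [hasDerivAt_iff_isLittleO_nhds_zero, Asymptotics.isLittleO_iff]
    intro ε hε
    obtain ⟨η, hη, hη1, hev⟩ := hmod ε hε
    filter_upwards [Metric.ball_mem_nhds (0:ℝ) hη] with δ hδ
    rw [Metric.mem_ball, dist_zero_right, Real.norm_eq_abs] at hδ
    have hbound : ∀ᶠ n in (U : Filter ℕ), |u n (z+δ) - u n z - δ * d| ≤ ε * |δ| := by
      filter_upwards [hder, hev] with n hn hn2
      have hd : ∀ t ∈ uIcc z (z+δ), HasDerivAt (fun t => u n t - t * d) (u1 n t - d) t := by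
        intro t ht
        refine ((hn t (hseg δ (hδ.le.trans hη1) ht)).sub ((hasDerivAt_id t).mul_const d)).congr_deriv ?_
        rw [one_mul]
      have := (convex_uIcc z (z+δ)).norm_image_sub_le_of_norm_hasDerivWithin_le (C := ε)
        (fun t ht => (hd t ht).hasDerivWithinAt) (fun t ht => hn2 t ?_) left_mem_uIcc right_mem_uIcc
      · rw [add_sub_cancel_left, Real.norm_eq_abs, Real.norm_eq_abs] at this
        convert this using 2
        ring
      · have h1 := abs_sub_left_of_mem_uIcc ht
        rw [add_sub_cancel_left] at h1
        exact h1.trans hδ.le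
    have hl : Tendsto (fun n => |u n (z+δ) - u n z - δ * d|) U (𝓝 |u' (z+δ) - u' z - δ * d|) :=
      (((hu (z+δ)).sub (hu z)).sub_const _).abs
    have := le_of_tendsto hl hbound
    simpa [smul_eq_mul] using this
  constructor
  · refine step φ ψ φ' (ψ' z) hφ' ((hC z).filter_mono hU |>.mono fun n hn w hw => (hn w hw).2.2.2.1) ?_
    intro ε hε
    have hC1 : 0 < C z + 1 := by linarith [hC0 z]
    refine ⟨min 1 (ε / (2 * (C z + 1))), by positivity, min_le_left _ _, ?_⟩
    filter_upwards [hlip.filter_mono hU, (hψ' z).eventually (Metric.ball_mem_nhds _ (half_pos hε))]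
      with n h1 h2 w hw
    have hw1 := hw.trans (min_le_left _ _)
    have hw2 := hw.trans (min_le_right _ _)
    rw [le_div_iff₀ (by positivity)] at hw2
    rw [abs_le] at hw1
    have h3 := (h1 w ⟨by linarith, by linarith⟩).2
    rw [Real.dist_eq] at h2
    have := abs_sub_le (ψ n w) (ψ n z) (ψ' z)
    nlinarith [abs_nonneg (w - z)]
  · refine step ψ (fun n w => F w (φ n w) (ψ n w)) ψ' _ hψ'
      ((hC z).filter_mono hU |>.mono fun n hn w hw => (hn w hw).2.2.2.2) ?_
    intro ε hε
    obtain ⟨κ, hκ, hFκ⟩ := Metric.continuousAt_iff.1 (hF.continuousAt (x := (z, φ' z, ψ' z))) ε hε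
    have hC1 : 0 < C z + 1 := by linarith [hC0 z]
    refine ⟨min 1 (κ / (4 * (C z + 1))), by positivity, min_le_left _ _, ?_⟩
    filter_upwards [hlip.filter_mono hU, (hψ' z).eventually (Metric.ball_mem_nhds _ (half_pos hκ)),
      (hφ' z).eventually (Metric.ball_mem_nhds _ (half_pos hκ))]
      with n h1 h2 h2' w hw
    have hw1 := hw.trans (min_le_left _ _)
    have hw2 := hw.trans (min_le_right _ _)
    rw [le_div_iff₀ (by positivity)] at hw2
    rw [abs_le] at hw1
    obtain ⟨h3, h4⟩ := h1 w ⟨by linarith, by linarith⟩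
    rw [Real.dist_eq] at h2 h2'
    have h5 := abs_sub_le (ψ n w) (ψ n z) (ψ' z)
    have h6 := abs_sub_le (φ n w) (φ n z) (φ' z)
    have h7 := abs_nonneg (w - z)
    have := hC0 z
    have := hFκ (x := (w, φ n w, ψ n w)) (by
      rw [Prod.dist_eq, Prod.dist_eq, Real.dist_eq, Real.dist_eq, Real.dist_eq]
      refine max_lt ?_ (max_lt ?_ ?_) <;> dsimp only <;> nlinarith)
    rw [Real.dist_eq] at this
    exact this.le

end HabitModel

namespace HabitModel
open Filter Topology
namespace OP
variable (p : OP)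

lemma one_add_exp_rpow_le {a : ℝ} (ha1 : a ≤ 1) (z : ℝ) :
    (1 + exp z) ^ a ≤ 2 * exp |z| := by
  have h1 : 1 ≤ 1 + exp z := by linarith [exp_pos z]
  have h2 : (1 + exp z) ^ a ≤ (1 + exp z) ^ (1:ℝ) := rpow_le_rpow_of_exponent_le h1 ha1
  rw [rpow_one] at h2
  have h3 : exp z ≤ exp |z| := exp_le_exp.2 (le_abs_self z)
  have h4 : 1 ≤ exp |z| := one_le_exp (abs_nonneg z)
  linarith

lemma F_growth {C : ℝ} (hC : 0 < C) : ∃ K : ℝ, 0 < K ∧ ∀ z x y, 0 ≤ x → x ≤ C * (1 + exp z) ^ p.a →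
    |p.F z x y| ≤ K * exp |z| * (1 + |y|) := by
  have hD := p.hD; have hL := p.hL; have hm := p.hm; have ha := p.ha; have hb := p.hb
  have hr := p.hr; have hR := p.hR
  have hRb : 0 < p.R ^ (-p.b) := rpow_pos_of_pos hR _
  set K1 := p.b⁻¹ * p.R ^ (-p.b) + (p.L + p.R * p.m) * (2*C)
  set K2 := |p.E| + p.R * (1 + p.r)
  have hK1 : 0 < K1 := by positivity
  have hK2 : 0 < K2 := by positivity
  refine ⟨p.D⁻¹ * (K1 + K2), by positivity, fun z x y hx hxC => ?_⟩
  have h1 := p.F_lip z x y 0 0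
  have he1 : 1 ≤ exp |z| := one_le_exp (abs_nonneg z)
  have hez : exp (-z) ≤ exp |z| := exp_le_exp.2 (neg_le_abs z)
  have h0 : |p.F z 0 0| ≤ p.D⁻¹ * (p.b⁻¹ * p.R ^ (-p.b) * exp |z|) := by
    unfold F
    simp only [mul_zero, add_zero, sub_zero, zero_sub]
    rw [abs_mul, abs_neg, abs_of_pos (p.Hm_zero_pos z), abs_of_pos (inv_pos.2 hD)]
    have h2 := p.Hm_le z 0 p.R hR le_rfl
    have h3 : exp (p.a * z) ≤ exp |z| := by
      apply exp_le_exp.2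
      calc p.a * z ≤ p.a * |z| := by gcongr; exact le_abs_self z
        _ ≤ 1 * |z| := by gcongr; exact p.ha1
        _ = |z| := one_mul _
    have h4 : p.b⁻¹ * exp (p.a*z) * p.R ^ (-p.b) ≤ p.b⁻¹ * p.R ^ (-p.b) * exp |z| := by
      calc _ ≤ p.b⁻¹ * exp |z| * p.R ^ (-p.b) := by gcongr
        _ = _ := by ring
    refine mul_le_mul_of_nonneg_left ?_ (inv_pos.2 hD).le
    linarith
  simp only [sub_zero] at h1
  rw [abs_of_nonneg hx] at h1
  have hx2 : x ≤ 2 * C * exp |z| := by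
    have := one_add_exp_rpow_le p.ha1 z
    nlinarith
  have h5 : |p.F z x y| ≤ |p.F z 0 0| + |p.F z x y - p.F z 0 0| := by
    have := abs_sub_abs_le_abs_sub (p.F z x y) (p.F z 0 0); linarith
  have h6 : (p.L + p.R * p.m) * x ≤ (p.L + p.R * p.m) * (2 * C) * exp |z| := by
    calc _ ≤ (p.L + p.R * p.m) * (2 * C * exp |z|) := by gcongr
      _ = _ := by ring
  have h7 : (|p.E| + p.R * (1 + p.r * exp (-z))) * |y| ≤ K2 * exp |z| * |y| := by
    refine mul_le_mul_of_nonneg_right ?_ (abs_nonneg y)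
    calc |p.E| + p.R * (1 + p.r * exp (-z)) ≤ |p.E| * exp |z| + p.R * (exp |z| + p.r * exp |z|) := by
          gcongr
          exact le_mul_of_one_le_right (abs_nonneg _) he1
      _ = _ := by ring
  have hDi : 0 < p.D⁻¹ := inv_pos.2 hD
  calc |p.F z x y| ≤ p.D⁻¹ * (p.b⁻¹ * p.R ^ (-p.b) * exp |z|) + p.D⁻¹ *
        ((p.L + p.R * p.m) * (2 * C) * exp |z| + K2 * exp |z| * |y|) := by
        refine h5.trans (add_le_add h0 (h1.trans ?_))
        gcongr
    _ = p.D⁻¹ * exp |z| * (K1 + K2 * |y|) := by ring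
    _ ≤ p.D⁻¹ * exp |z| * ((K1 + K2) * (1 + |y|)) := by
        have := abs_nonneg y
        gcongr; nlinarith
    _ = _ := by ring

lemma bvp (N C : ℝ) (hN : 0 < N) (hC : 0 < C) (Φ Φ1 Φ2 : ℝ → ℝ)
    (hΦ : ∀ z, Φ z = C * (1 + exp z) ^ p.a)
    (h1 : ∀ z, HasDerivAt Φ (Φ1 z) z) (h2 : ∀ z, HasDerivAt Φ1 (Φ2 z) z)
    (h3 : ∀ z, Φ2 z < p.F z (Φ z) (Φ1 z)) :
    ∃ φ ψ : ℝ → ℝ, ∀ z ∈ Icc (-N) N, 0 ≤ φ z ∧ φ z ≤ Φ z ∧ HasDerivAt φ (ψ z) z ∧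
      HasDerivAt ψ (p.F z (φ z) (ψ z)) z := by
  have hΦp : ∀ z, 0 ≤ Φ z := fun z => by rw [hΦ]; positivity
  have hΦc : Continuous Φ := continuous_iff_continuousAt.2 fun z => (h1 z).continuousAt
  let zc : ℝ → ℝ := fun t => max (-N) (min N (t - N))
  have hzc : Continuous zc := by fun_prop
  have hzc1 : ∀ t, zc t ∈ Icc (-N) N := fun t => ⟨le_max_left _ _, max_le (by linarith) (min_le_left _ _)⟩
  have hzc2 : ∀ t ∈ Icc 0 (2*N), zc t = t - N := by
    intro t ht
    simp only [zc]
    rw [min_eq_right (by linarith [ht.2]), max_eq_right (by linarith [ht.1])]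
  let cl : ℝ → ℝ → ℝ := fun t x => max 0 (min (Φ (zc t)) x)
  have hcl0 : ∀ t x, 0 ≤ cl t x := fun t x => le_max_left _ _
  have hcl1 : ∀ t x, cl t x ≤ Φ (zc t) := fun t x => max_le (hΦp _) (min_le_left _ _)
  have hclL : ∀ t x x', |cl t x - cl t x'| ≤ |x - x'| := by
    intro t x x'
    refine (abs_max_sub_max_le_max _ _ _ _).trans ?_
    rw [sub_self, abs_zero]
    refine max_le (abs_nonneg _) ((abs_min_sub_min_le_max _ _ _ _).trans ?_)
    rw [sub_self, abs_zero]
    exact max_le (abs_nonneg _) le_rfl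
  let G : ℝ → ℝ → ℝ → ℝ := fun t x y => p.F (zc t) (cl t x) y
  have hGc : Continuous fun w : ℝ × ℝ × ℝ => G w.1 w.2.1 w.2.2 :=
    p.F_cont.comp (f := fun w : ℝ × ℝ × ℝ => (zc w.1, cl w.1 w.2.1, w.2.2)) (by fun_prop)
  have hD := p.hD; have hL := p.hL; have hm := p.hm; have ha := p.ha; have hb := p.hb
  have hr := p.hr; have hR := p.hR
  set L1 := p.D⁻¹ * (p.L + p.R * p.m)
  set L2 := p.D⁻¹ * (|p.E| + p.R * (1 + p.r * exp N))
  have hL1 : 0 < L1 := by positivity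
  have hL2 : 0 < L2 := by positivity
  have hGL : ∀ t x y x' y', |G t x y - G t x' y'| ≤ (L1 + L2) * (|x-x'| + |y-y'|) := by
    intro t x y x' y'
    refine (p.F_lip (zc t) (cl t x) y (cl t x') y').trans ?_
    have e : exp (-zc t) ≤ exp N := exp_le_exp.2 (by linarith [(hzc1 t).1])
    calc _ ≤ p.D⁻¹ * ((p.L + p.R * p.m) * |x - x'| + (|p.E| + p.R * (1 + p.r * exp N)) * |y - y'|) := by
          refine mul_le_mul_of_nonneg_left (add_le_add ?_ ?_) (inv_pos.2 hD).le
          · exact mul_le_mul_of_nonneg_left (hclL t x x') (by positivity)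
          · gcongr
      _ = L1 * |x - x'| + L2 * |y-y'| := by ring
      _ ≤ _ := by nlinarith [abs_nonneg (x-x'), abs_nonneg (y-y')]
  obtain ⟨K, hK, hFK⟩ := p.F_growth hC
  have hGA : ∀ t x, |G t x 0| ≤ K * exp N := by
    intro t x
    have := hFK (zc t) (cl t x) 0 (hcl0 t x) ((hcl1 t x).trans_eq (hΦ _))
    rw [abs_zero, add_zero, mul_one] at this
    refine this.trans ?_
    gcongr
    exact abs_le.2 (hzc1 t)
  obtain ⟨f, g, hf0, hfT, hfg⟩ := bvp_exists (T := 2*N) (by linarith) (by positivity : 0 < L1 + L2) hGc hGL hGA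
  have hlow : ∀ t ∈ Icc 0 (2*N), 0 ≤ f t := by
    refine nonneg_of_no_min (by linarith) (fun t ht => (hfg t ht).1) (fun t ht => (hfg t ht).2)
      hf0.ge hfT.ge ?_
    intro t ht hft hgt
    have : cl t (f t) = 0 := by
      simp only [cl]; rw [min_eq_right (hft.le.trans (hΦp _)), max_eq_left hft.le]
    simp only [G]; rw [this, hgt]; exact p.F_zero_neg _
  have hs : ∀ t : ℝ, HasDerivAt (fun t : ℝ => t - N) 1 t := fun t => (hasDerivAt_id t).sub_const N
  have hup : ∀ t ∈ Icc 0 (2*N), 0 ≤ Φ (t - N) - f t := by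
    refine nonneg_of_no_min (g1 := fun t => Φ1 (t-N) - g t)
      (g2 := fun t => Φ2 (t-N) - G t (f t) (g t)) (by linarith) (fun t ht => ?_) (fun t ht => ?_)
      ?_ ?_ ?_
    · refine HasDerivAt.fun_sub ?_ (hfg t ht).1
      exact ((h1 (t-N)).comp t (hs t)).congr_deriv (mul_one _)
    · refine HasDerivAt.fun_sub ?_ (hfg t ht).2
      exact ((h2 (t-N)).comp t (hs t)).congr_deriv (mul_one _)
    · rw [hf0, sub_zero]; exact hΦp _
    · rw [hfT, sub_zero]; exact hΦp _
    · intro t ht hft hgt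
      have hz : zc t = t - N := hzc2 t ⟨ht.1.le, ht.2.le⟩
      have : cl t (f t) = Φ (t-N) := by
        simp only [cl]; rw [hz, min_eq_left (by linarith), max_eq_right (hΦp _)]
      simp only [G]; rw [this, hz, ← (sub_eq_zero.1 hgt)]
      have := h3 (t-N)
      linarith
  refine ⟨fun z => f (z+N), fun z => g (z+N), fun z hz => ?_⟩
  have ht : z + N ∈ Icc 0 (2*N) := ⟨by linarith [hz.1], by linarith [hz.2]⟩
  have hl := hlow _ ht
  have hu := hup _ ht
  rw [add_sub_cancel_right] at hu
  have hsa : HasDerivAt (fun z : ℝ => z + N) 1 z := (hasDerivAt_id z).add_const N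
  refine ⟨hl, by linarith, ?_, ?_⟩
  · exact ((hfg _ ht.1).1.comp z hsa).congr_deriv (mul_one _)
  · refine ((hfg _ ht.1).2.comp z hsa).congr_deriv ?_
    have hzz : zc (z+N) = z := by rw [hzc2 _ ht]; ring
    simp only [G, cl, hzz]
    rw [min_eq_right (by linarith), max_eq_right hl, mul_one]

theorem exists_sol : ∃ (φ φ1 : ℝ → ℝ) (C : ℝ), 0 < C ∧ (∀ z, HasDerivAt φ (φ1 z) z) ∧
    (∀ z, HasDerivAt φ1 (p.F z (φ z) (φ1 z)) z) ∧ (∀ z, 0 ≤ φ z) ∧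
    (∀ z, φ z ≤ C * (1 + exp z) ^ p.a) ∧ (∀ z, |φ1 z| ≤ C * exp (2*|z|)) ∧
    (∀ z, |p.F z (φ z) (φ1 z)| ≤ C * exp (3*|z|)) := by
  obtain ⟨C, hC, Φ, Φ1, Φ2, hΦ, h1, h2, h3⟩ := p.exists_super
  obtain ⟨K, hK, hFK⟩ := p.F_growth hC
  choose φ ψ hb using fun n : ℕ => p.bvp (n+1) C (by positivity) hC Φ Φ1 Φ2 hΦ h1 h2 h3
  set K' := 24*C*(6*K+1)+1
  have hK' : 0 < K' := by positivity
  -- derivative bound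
  have hder : ∀ n : ℕ, ∀ z : ℝ, |z| ≤ n → |ψ n z| ≤ K' * exp (2*|z|) := by
    intro n z hz
    rw [abs_le] at hz
    set e := exp |z| with he
    have he1 : 1 ≤ e := one_le_exp (abs_nonneg z)
    set L0 := 3 * K * e
    have hL0 : 0 < L0 := by positivity
    set ℓ := 1 / (2*L0+1) with hℓd
    have hℓ : 0 < ℓ := by positivity
    have hℓ1 : ℓ ≤ 1 := by rw [hℓd, div_le_one (by positivity)]; linarith
    have hℓL : ℓ * L0 ≤ 1/2 := by
      rw [hℓd, one_div, inv_mul_le_iff₀ (by positivity)]; linarith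
    have hI : ∀ t ∈ Icc z (z+ℓ), t ∈ Icc (-((n:ℝ)+1)) (n+1) := fun t ht =>
      ⟨by linarith [ht.1], by linarith [ht.2]⟩
    have het : ∀ t ∈ Icc z (z+ℓ), exp |t| ≤ 3 * e := by
      intro t ht
      have : |t| ≤ |z| + 1 := by
        have h4 : |t - z| ≤ 1 := by rw [abs_le]; constructor <;> linarith [ht.1, ht.2]
        have := abs_sub_abs_le_abs_sub t z
        linarith
      calc exp |t| ≤ exp (|z| + 1) := exp_le_exp.2 this
        _ = e * exp 1 := exp_add _ _
        _ ≤ e * 3 := by gcongr; exact exp_one_lt_d9.le.trans (by norm_num)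
        _ = _ := mul_comm _ _
    have := deriv_bound (M := 2*C*(3*e)) (A := L0) hℓ hL0.le hL0.le (fun t ht => (hb n t (hI t ht)).2.2.1)
      (fun t ht => (hb n t (hI t ht)).2.2.2) (fun t ht => ?_) (fun t ht => ?_) hℓL z ⟨le_rfl, by linarith⟩
    · refine this.trans ?_
      have e2 : exp (2*|z|) = e^2 := by rw [he, ← exp_nat_mul]; norm_num
      rw [e2]
      have e3 : 4 * (2*C*(3*e)) / ℓ = 24*C*e*(6*K*e+1) := by
        rw [hℓd, div_div_eq_mul_div, div_one]; ring
      rw [e3]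
      have h5 : 24*C*e*(6*K*e+1) ≤ 24*C*e*(6*K*e+e) := by gcongr
      have h6 : 1 ≤ e^2 := one_le_pow₀ he1
      nlinarith
    · obtain ⟨hl, hu, -, -⟩ := hb n t (hI t ht)
      rw [abs_of_nonneg hl]
      rw [hΦ] at hu
      have h5 := one_add_exp_rpow_le p.ha1 t
      have h6 := het t ht
      calc φ n t ≤ C * (2 * (3 * e)) := hu.trans (by gcongr; linarith)
        _ = _ := by ring
    · obtain ⟨hl, hu, -, -⟩ := hb n t (hI t ht)
      rw [hΦ] at hu
      refine (hFK t _ _ hl hu).trans ?_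
      have h6 := het t ht
      calc K * exp |t| * (1 + |ψ n t|) ≤ K * (3 * e) * (1 + |ψ n t|) := by gcongr
        _ = L0 + L0 * |ψ n t| := by ring
  obtain ⟨U, f, g, hU, hf, hg, hfg⟩ := ode_limit p.F_cont φ ψ (by
    intro z
    set e := exp (|z|+1)
    have he1 : 1 ≤ e := one_le_exp (by positivity)
    refine ⟨2*C*e + K'*e^2 + K*e*(1+K'*e^2), by positivity, ?_⟩
    filter_upwards [eventually_ge_atTop ⌈|z|+1⌉₊] with n hn w hw
    have hn' : |z| + 1 ≤ n := Nat.ceil_le.1 hn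
    have hwz : |w| ≤ |z| + 1 := by
      have h4 : |w - z| ≤ 1 := by rw [abs_le]; constructor <;> linarith [hw.1, hw.2]
      have := abs_sub_abs_le_abs_sub w z
      linarith
    have hwn : |w| ≤ n := hwz.trans hn'
    have hwI : w ∈ Icc (-((n:ℝ)+1)) (n+1) := by
      rw [abs_le] at hwn; exact ⟨by linarith, by linarith⟩
    obtain ⟨hl, hu, hd1, hd2⟩ := hb n w hwI
    have hew : exp |w| ≤ e := exp_le_exp.2 hwz
    have hψ : |ψ n w| ≤ K'*e^2 := by
      refine (hder n w hwn).trans ?_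
      have e2 : exp (2*|w|) = (exp |w|)^2 := by rw [← exp_nat_mul]; norm_num
      rw [e2]; gcongr
    rw [hΦ] at hu
    have hF1 : |p.F w (φ n w) (ψ n w)| ≤ K*e*(1+K'*e^2) := by
      refine (hFK w _ _ hl hu).trans ?_
      gcongr
    have hφ : |φ n w| ≤ 2*C*e := by
      rw [abs_of_nonneg hl]
      refine hu.trans ?_
      have h5 := one_add_exp_rpow_le p.ha1 w
      nlinarith
    have t1 : 0 ≤ 2*C*e := by positivity
    have t2 : 0 ≤ K'*e^2 := by positivity
    have t3 : 0 ≤ K*e*(1+K'*e^2) := by positivity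
    exact ⟨by linarith, by linarith, by linarith, hd1, hd2⟩)
  have hev : ∀ z : ℝ, ∀ᶠ n : ℕ in (U : Filter ℕ), |z| ≤ n ∧ z ∈ Icc (-((n:ℝ)+1)) (n+1) := by
    intro z
    have : ∀ᶠ n : ℕ in (atTop : Filter ℕ), |z| ≤ n ∧ z ∈ Icc (-((n:ℝ)+1)) (n+1) := by
      filter_upwards [eventually_ge_atTop ⌈|z|⌉₊] with n hn
      have hn' : |z| ≤ n := Nat.ceil_le.1 hn
      have := abs_le.1 hn'
      exact ⟨hn', by linarith, by linarith⟩
    exact this.filter_mono hU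
  have hf0 : ∀ z, 0 ≤ f z := fun z =>
    ge_of_tendsto (hf z) ((hev z).mono fun n hn => (hb n z hn.2).1)
  have hfC : ∀ z, f z ≤ C * (1 + exp z) ^ p.a := fun z =>
    le_of_tendsto (hf z) ((hev z).mono fun n hn => (hb n z hn.2).2.1.trans_eq (hΦ z))
  have hgK : ∀ z, |g z| ≤ K' * exp (2*|z|) := fun z =>
    le_of_tendsto (hg z).abs ((hev z).mono fun n hn => hder n z hn.1)
  refine ⟨f, g, C + K' + K*(1+K'), by positivity, fun z => (hfg z).1, fun z => (hfg z).2, hf0, fun z => ?_,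
    fun z => ?_, fun z => ?_⟩
  · refine (hfC z).trans ?_
    gcongr
    have : 0 < K*(1+K') := by positivity
    linarith
  · refine (hgK z).trans ?_
    gcongr
    have : 0 < K*(1+K') := by positivity
    linarith
  · refine (hFK z _ _ (hf0 z) (hfC z)).trans ?_
    have he1 : 1 ≤ exp (2*|z|) := one_le_exp (by positivity)
    have e3 : exp (3*|z|) = exp |z| * exp (2*|z|) := by rw [← exp_add]; congr 1; ring
    calc K * exp |z| * (1 + |g z|) ≤ K * exp |z| * (exp (2*|z|) + K' * exp (2*|z|)) := by
          gcongr; exact hgK z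
      _ = K * (1+K') * exp (3*|z|) := by rw [e3]; ring
      _ ≤ _ := by gcongr; linarith

end OP
end HabitModel

namespace HabitModel
open Filter Topology

/-- families with uniformly bounded moments -/
structure MB {Ω : Type*} [MeasurableSpace Ω] (P : Measure Ω) {ι : Type*} (Z : ι → Ω → ℝ) : Prop where
  meas : ∀ i, AEStronglyMeasurable (Z i) P
  bd : ∀ p : ℕ, ∃ K : ℝ, ∀ i, Integrable (fun ω => |Z i ω| ^ p) P ∧ ∫ ω, |Z i ω| ^ p ∂P ≤ K

namespace MB
variable {Ω : Type*} [MeasurableSpace Ω] {P : Measure Ω} {ι κ : Type*} {Z Z' : ι → Ω → ℝ}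

lemma dom (h : MB P Z) (hm : ∀ i, AEStronglyMeasurable (Z' i) P)
    (hd : ∀ i, ∀ᵐ ω ∂P, |Z' i ω| ≤ |Z i ω|) : MB P Z' := by
  refine ⟨hm, fun p => ?_⟩
  obtain ⟨K, hK⟩ := h.bd p
  refine ⟨K, fun i => ?_⟩
  have hle : ∀ᵐ ω ∂P, |Z' i ω| ^ p ≤ |Z i ω| ^ p := (hd i).mono fun ω hω => by gcongr
  have hi : Integrable (fun ω => |Z' i ω| ^ p) P := by
    refine (hK i).1.mono' ((hm i).norm.pow p) (hle.mono fun ω hω => ?_)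
    rw [Real.norm_of_nonneg (by positivity)]
    exact hω
  exact ⟨hi, (integral_mono_ae hi (hK i).1 hle).trans (hK i).2⟩

lemma reindex (h : MB P Z) (f : κ → ι) : MB P (fun j => Z (f j)) :=
  ⟨fun _ => h.meas _, fun p => (h.bd p).imp fun _ hK _ => hK _⟩

lemma pow (h : MB P Z) (n : ℕ) : MB P (fun i ω => Z i ω ^ n) := by
  refine ⟨fun i => (h.meas i).pow n, fun p => ?_⟩
  obtain ⟨K, hK⟩ := h.bd (n*p)
  refine ⟨K, fun i => ?_⟩
  have : ∀ ω, |Z i ω ^ n| ^ p = |Z i ω| ^ (n*p) := fun ω => by rw [abs_pow, pow_mul]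
  simp only [this]
  exact hK i

lemma abs (h : MB P Z) : MB P (fun i ω => |Z i ω|) :=
  h.dom (fun i => (h.meas i).norm) (fun i => Eventually.of_forall fun ω => by rw [abs_abs])

lemma add (h : MB P Z) (h' : MB P Z') : MB P (fun i ω => Z i ω + Z' i ω) := by
  refine ⟨fun i => (h.meas i).add (h'.meas i), fun p => ?_⟩
  obtain ⟨K, hK⟩ := h.bd p
  obtain ⟨K', hK'⟩ := h'.bd p
  refine ⟨2^p * (K + K'), fun i => ?_⟩
  have hle : ∀ ω, |Z i ω + Z' i ω| ^ p ≤ 2^p * (|Z i ω| ^ p + |Z' i ω| ^ p) := by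
    intro ω
    have h1 : |Z i ω + Z' i ω| ≤ 2 * max |Z i ω| |Z' i ω| := by
      refine (abs_add_le _ _).trans ?_
      linarith [le_max_left |Z i ω| |Z' i ω|, le_max_right |Z i ω| |Z' i ω|]
    calc |Z i ω + Z' i ω| ^ p ≤ (2 * max |Z i ω| |Z' i ω|) ^ p := by gcongr
      _ = 2^p * (max |Z i ω| |Z' i ω|) ^ p := mul_pow _ _ _
      _ ≤ _ := by
        gcongr
        rcases max_choice |Z i ω| |Z' i ω| with h | h <;> rw [h]
        · exact le_add_of_nonneg_right (by positivity)
        · exact le_add_of_nonneg_left (by positivity)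
  have hs : Integrable (fun ω => 2^p * (|Z i ω| ^ p + |Z' i ω| ^ p)) P :=
    ((hK i).1.add (hK' i).1).const_mul _
  have hi : Integrable (fun ω => |Z i ω + Z' i ω| ^ p) P := by
    refine hs.mono' (((h.meas i).add (h'.meas i)).norm.pow p) (Eventually.of_forall fun ω => ?_)
    rw [Real.norm_of_nonneg (by positivity)]
    exact hle ω
  refine ⟨hi, (integral_mono hi hs hle).trans ?_⟩
  rw [integral_const_mul, integral_add (hK i).1 (hK' i).1]
  gcongr
  · exact (hK i).2
  · exact (hK' i).2

lemma mul (h : MB P Z) (h' : MB P Z') : MB P (fun i ω => Z i ω * Z' i ω) := by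
  refine ((h.pow 2).add (h'.pow 2)).dom (fun i => (h.meas i).mul (h'.meas i))
    (fun i => Eventually.of_forall fun ω => ?_)
  rw [abs_mul, abs_of_nonneg (by positivity : 0 ≤ Z i ω ^ 2 + Z' i ω ^ 2), ← sq_abs (Z i ω), ← sq_abs (Z' i ω)]
  nlinarith [sq_nonneg (|Z i ω| - |Z' i ω|), sq_nonneg (|Z i ω|), sq_nonneg (|Z' i ω|)]

lemma const [IsProbabilityMeasure P] (c : ℝ) : MB P (fun (_ : ι) (_ : Ω) => c) :=
  ⟨fun _ => aestronglyMeasurable_const, fun p => ⟨|c|^p, fun _ => ⟨integrable_const _, by simp⟩⟩⟩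

lemma const_mul [IsProbabilityMeasure P] (c : ℝ) (h : MB P Z) : MB P (fun i ω => c * Z i ω) :=
  (const c).mul h

lemma sub [IsProbabilityMeasure P] (h : MB P Z) (h' : MB P Z') : MB P (fun i ω => Z i ω - Z' i ω) :=
  (h.add (h'.const_mul (-1))).dom (fun i => (h.meas i).sub (h'.meas i))
    (fun i => Eventually.of_forall fun ω => by ring_nf; exact le_rfl)

lemma integrable (h : MB P Z) (i : ι) : Integrable (Z i) P := by
  obtain ⟨K, hK⟩ := h.bd 1
  have := (hK i).1
  simp only [pow_one] at this
  exact (integrable_norm_iff (h.meas i)).1 this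

lemma memLp2 (h : MB P Z) (i : ι) : MemLp (Z i) 2 P := by
  rw [memLp_two_iff_integrable_sq (h.meas i)]
  obtain ⟨K, hK⟩ := h.bd 2
  have := (hK i).1
  simpa only [sq_abs] using this

lemma bound (h : MB P Z) : ∃ K : ℝ, 0 ≤ K ∧ ∀ i, |∫ ω, Z i ω ∂P| ≤ K := by
  obtain ⟨K, hK⟩ := h.bd 1
  refine ⟨max K 0, le_max_right _ _, fun i => ?_⟩
  have := (hK i).2
  simp only [pow_one] at this
  exact (abs_integral_le_integral_abs).trans (this.trans (le_max_left _ _))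

end MB

/-! ### Brownian facts -/
section BM
variable {Ω : Type*} [mΩ : MeasurableSpace Ω] {P : Measure Ω} [IsProbabilityMeasure P]
  {F : Filtration ℝ mΩ} {W : ℝ → Ω → ℝ}

lemma IsStdBM.meas (hW : IsStdBM P F W) (t : ℝ) : Measurable (W t) :=
  (hW.adapted t).mono (F.le t) le_rfl

/-- index set: `0 ≤ s < t ≤ T` -/
def Ix (T : ℝ) : Type := {q : ℝ × ℝ // 0 ≤ q.1 ∧ q.1 < q.2 ∧ q.2 ≤ T}

def Ix.s {T : ℝ} (i : Ix T) : ℝ := i.1.1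
def Ix.t {T : ℝ} (i : Ix T) : ℝ := i.1.2
def Ix.d {T : ℝ} (i : Ix T) : ℝ := i.t - i.s
def Ix.q {T : ℝ} (i : Ix T) : ℝ := √(i.t - i.s)
lemma Ix.d_pos {T : ℝ} (i : Ix T) : 0 < i.d := sub_pos.2 i.2.2.1
lemma Ix.q_pos {T : ℝ} (i : Ix T) : 0 < i.q := sqrt_pos.2 i.d_pos
lemma Ix.q_sq {T : ℝ} (i : Ix T) : i.q ^ 2 = i.d := sq_sqrt i.d_pos.le
lemma Ix.s0 {T : ℝ} (i : Ix T) : 0 ≤ i.s := i.2.1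
lemma Ix.st {T : ℝ} (i : Ix T) : i.s < i.t := i.2.2.1
lemma Ix.tT {T : ℝ} (i : Ix T) : i.t ≤ T := i.2.2.2
lemma Ix.d_le {T : ℝ} (i : Ix T) : i.d ≤ T := by
  have := i.s0; have := i.tT; unfold Ix.d; linarith

lemma map_std (hW : IsStdBM P F W) {s t : ℝ} (hs : 0 ≤ s) (hst : s < t) :
    P.map (fun ω => (W t ω - W s ω) / √(t-s)) = gaussianReal 0 1 := by
  have hm : Measurable (fun ω => W t ω - W s ω) := (hW.meas t).sub (hW.meas s)
  have h1 : (fun ω => (W t ω - W s ω) / √(t-s)) = (fun x => x / √(t-s)) ∘ (fun ω => W t ω - W s ω) := rfl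
  rw [h1, ← Measure.map_map (by fun_prop) hm, hW.gauss_incr s t hs hst.le, gaussianReal_map_div_const]
  simp only [zero_div]
  congr 1
  have hd : 0 < t - s := sub_pos.2 hst
  rw [← NNReal.coe_inj]
  push_cast
  rw [Real.coe_toNNReal _ hd.le]
  simp [sq_sqrt hd.le, hd.ne']

lemma exp_std {G : Ω → ℝ} (hG : Measurable G) (hmap : P.map G = gaussianReal 0 1) (c : ℝ) :
    Integrable (fun ω => exp (c * |G ω|)) P ∧ ∫ ω, exp (c * |G ω|) ∂P ≤ 2 * exp (c^2/2) := by
  have hi : ∀ c : ℝ, Integrable (fun ω => exp (c * G ω)) P ∧ ∫ ω, exp (c * G ω) ∂P = exp (c^2/2) := by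
    intro c
    have h1 : Integrable (fun x => exp (c * x)) (P.map G) := by
      rw [hmap]; exact integrable_exp_mul_gaussianReal c
    refine ⟨h1.comp_measurable hG, ?_⟩
    have h2 := mgf_gaussianReal hmap c
    simp only [mgf] at h2
    rw [h2]; congr 1; simp
  have hle : ∀ ω, exp (c * |G ω|) ≤ exp (c * G ω) + exp (-c * G ω) := by
    intro ω
    rcases abs_choice (G ω) with h | h <;> rw [h]
    · linarith [exp_pos (-c * G ω)]
    · rw [mul_neg, ← neg_mul]; linarith [exp_pos (c * G ω)]
  have hs := (hi c).1.add (hi (-c)).1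
  have hI : Integrable (fun ω => exp (c * |G ω|)) P := by
    refine hs.mono (by fun_prop) (Eventually.of_forall fun ω => ?_)
    rw [Real.norm_eq_abs, abs_of_pos (exp_pos _)]
    exact (hle ω).trans (le_abs_self _)
  refine ⟨hI, (integral_mono hI hs hle).trans ?_⟩
  simp only [Pi.add_apply]
  rw [integral_add (hi c).1 (hi (-c)).1, (hi c).2, (hi (-c)).2, neg_sq]
  linarith

lemma MB_exp_incr (hW : IsStdBM P F W) (T c : ℝ) :
    MB P (fun (i : Ix T) ω => exp (c * |(W i.t ω - W i.s ω) / i.q|)) := by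
  have hm : ∀ i : Ix T, Measurable fun ω => (W i.t ω - W i.s ω) / i.q :=
    fun i => ((hW.meas _).sub (hW.meas _)).div_const _
  refine ⟨fun i => Measurable.aestronglyMeasurable (by have := hm i; fun_prop), fun p => ⟨2 * exp ((p*c)^2/2), fun i => ?_⟩⟩
  have := exp_std (hm i) (map_std hW i.s0 i.st) (p*c)
  have e : ∀ ω, |exp (c * |(W i.t ω - W i.s ω) / i.q|)| ^ p = exp (p * c * |(W i.t ω - W i.s ω) / i.q|) := by
    intro ω; rw [abs_of_pos (exp_pos _), ← exp_nat_mul, mul_assoc]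
  simp only [e]
  exact this

lemma MB_incr (hW : IsStdBM P F W) (T : ℝ) :
    MB P (fun (i : Ix T) ω => (W i.t ω - W i.s ω) / i.q) := by
  refine (MB_exp_incr hW T 1).dom (fun i => ?_) (fun i => Eventually.of_forall fun ω => ?_)
  · exact (((hW.meas _).sub (hW.meas _)).div_const _).aestronglyMeasurable
  · rw [abs_of_pos (exp_pos _), one_mul]
    linarith [add_one_le_exp |(W i.t ω - W i.s ω) / i.q|]

/-- index set `[0,T]` -/
lemma MB_exp_W (hW : IsStdBM P F W) (T c : ℝ) (hc : 0 ≤ c) :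
    MB P (fun (t : Icc (0:ℝ) T) ω => exp (c * |W t ω|)) := by
  refine ⟨fun i => ?_, fun p => ⟨max 1 (2 * exp ((p*(c*√T))^2/2)), fun t => ?_⟩⟩
  · have := hW.meas i; fun_prop
  have e : ∀ ω, |exp (c * |W t ω|)| ^ p = exp (p * c * |W t ω|) := by
    intro ω; rw [abs_of_pos (exp_pos _), ← exp_nat_mul, mul_assoc]
  simp only [e]
  rcases eq_or_lt_of_le t.2.1 with h | h
  · have hw : ∀ ω, W t ω = 0 := fun ω => by rw [← h]; exact hW.init ω
    simp [hw]
  · have hm : Measurable fun ω => (W t ω - W 0 ω) / √(t - 0) :=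
      ((hW.meas _).sub (hW.meas _)).div_const _
    have hq : 0 < √(t:ℝ) := sqrt_pos.2 h
    have := exp_std hm (map_std hW le_rfl h) (p*(c*√t))
    have e2 : ∀ ω, p*(c*√t) * |(W t ω - W 0 ω) / √(t - 0)| = p * c * |W t ω| := by
      intro ω; rw [hW.init, sub_zero, sub_zero, abs_div, abs_of_pos hq]; field_simp
    simp only [e2] at this
    refine ⟨this.1, this.2.trans (le_trans ?_ (le_max_right _ _))⟩
    have : √(t:ℝ) ≤ √T := sqrt_le_sqrt t.2.2
    gcongr

lemma incr_mean (hW : IsStdBM P F W) {s t : ℝ} (hs : 0 ≤ s) (hst : s ≤ t) :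
    ∫ ω, (W t ω - W s ω) ∂P = 0 := by
  have hm : Measurable (fun ω => W t ω - W s ω) := (hW.meas t).sub (hW.meas s)
  have : ∫ x, x ∂(P.map (fun ω => W t ω - W s ω)) = ∫ ω, (W t ω - W s ω) ∂P :=
    integral_map hm.aemeasurable (by fun_prop)
  rw [← this, hW.gauss_incr s t hs hst]
  exact integral_id_gaussianReal

lemma incr_var (hW : IsStdBM P F W) {s t : ℝ} (hs : 0 ≤ s) (hst : s ≤ t) :
    ∫ ω, (W t ω - W s ω)^2 ∂P = t - s := by
  have hm : Measurable (fun ω => W t ω - W s ω) := (hW.meas t).sub (hW.meas s)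
  have : ∫ x, x^2 ∂(P.map (fun ω => W t ω - W s ω)) = ∫ ω, (W t ω - W s ω)^2 ∂P :=
    integral_map hm.aemeasurable (by fun_prop)
  rw [← this, hW.gauss_incr s t hs hst]
  have h := variance_id_gaussianReal (μ := 0) (v := (t-s).toNNReal)
  rw [variance_eq_integral (by fun_prop)] at h
  simp only [id_eq, integral_id_gaussianReal, sub_zero] at h
  rw [h, Real.coe_toNNReal _ (sub_nonneg.2 hst)]

lemma indep_mul (hW : IsStdBM P F W) {s t : ℝ} (hs : 0 ≤ s) (hst : s ≤ t) {ξ : Ω → ℝ}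
    (hξ : Measurable[F s] ξ) {f : ℝ → ℝ} (hf : Measurable f) :
    ∫ ω, ξ ω * f (W t ω - W s ω) ∂P = (∫ ω, ξ ω ∂P) * ∫ ω, f (W t ω - W s ω) ∂P := by
  have hind : IndepFun ξ (fun ω => W t ω - W s ω) P := by
    rw [IndepFun_iff_Indep]
    exact indep_of_indep_of_le_left (hW.indep_incr s t hs hst).symm hξ.comap_le
  have h2 : IndepFun ξ (fun ω => f (W t ω - W s ω)) P := hind.comp measurable_id hf
  have hm : Measurable (fun ω => W t ω - W s ω) := (hW.meas t).sub (hW.meas s)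
  exact h2.integral_fun_mul_eq_mul_integral (hξ.mono (F.le s) le_rfl).aestronglyMeasurable
    (hf.comp hm).aestronglyMeasurable

lemma mul_incr (hW : IsStdBM P F W) {s t : ℝ} (hs : 0 ≤ s) (hst : s ≤ t) {ξ : Ω → ℝ}
    (hξ : Measurable[F s] ξ) : ∫ ω, ξ ω * (W t ω - W s ω) ∂P = 0 := by
  rw [indep_mul hW hs hst hξ (f := fun x => x) measurable_id]; simp [incr_mean hW hs hst]

lemma mul_incr_sq (hW : IsStdBM P F W) {s t : ℝ} (hs : 0 ≤ s) (hst : s ≤ t) {ξ : Ω → ℝ}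
    (hξ : Measurable[F s] ξ) : ∫ ω, ξ ω * (W t ω - W s ω)^2 ∂P = (t - s) * ∫ ω, ξ ω ∂P := by
  rw [indep_mul hW hs hst hξ (f := fun x => x^2) (by fun_prop), incr_var hW hs hst, mul_comm]

end BM
end HabitModel

namespace HabitModel
open Filter Topology

variable {Ω : Type*} [mΩ : MeasurableSpace Ω]

lemma MB1_incr {P : Measure Ω} [IsProbabilityMeasure P]
    {F : Filtration ℝ mΩ} {W : ℝ → Ω → ℝ} (hW : IsStdBM P F W) {s t : ℝ} (hs : 0 ≤ s) (hst : s ≤ t) :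
    MB P (fun (_ : Unit) ω => W t ω - W s ω) := by
  rcases eq_or_lt_of_le hst with rfl | h
  · simpa using MB.const (P := P) (ι := Unit) 0
  · have h1 := (MB_incr hW t).reindex (fun _ : Unit => (⟨(s,t), hs, h, le_rfl⟩ : Ix t))
    refine (h1.const_mul (√(t-s))).dom (fun _ => ((hW.meas t).sub (hW.meas s)).aestronglyMeasurable)
      (fun _ => Eventually.of_forall fun ω => le_of_eq ?_)
    have hq : √(t-s) ≠ 0 := (sqrt_pos.2 (sub_pos.2 h)).ne'
    congr 1
    simp only [Ix.t, Ix.s, Ix.q]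
    field_simp

lemma cross (S : Setting Ω) {s t : ℝ} (hs : 0 ≤ s) (hst : s ≤ t) {ξ : Ω → ℝ}
    (hξ : Measurable[S.F s] ξ) (hM : MB S.P (fun (_ : Unit) => ξ)) :
    ∫ ω, ξ ω * ((S.W1 t ω - S.W1 s ω) * (S.W2 t ω - S.W2 s ω)) ∂S.P = 0 := by
  haveI := S.isProb
  have key : ∀ N : ℕ, 0 < N → |∫ ω, ξ ω * ((S.W1 t ω - S.W1 s ω) * (S.W2 t ω - S.W2 s ω)) ∂S.P| ≤
      (∫ ω, ξ ω ^ 2 ∂S.P + (t-s)^2) / 2 * (1 / N) := by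
    intro N hN
    have hN' : (0:ℝ) < N := by exact_mod_cast hN
    set n : ℕ := N^2 with hn
    have hn' : (0:ℝ) < n := by rw [hn]; positivity
    set δ := (t-s)/n with hδ
    have hδ0 : 0 ≤ δ := div_nonneg (sub_nonneg.2 hst) hn'.le
    let τ : ℕ → ℝ := fun i => s + i * δ
    have hτ0 : τ 0 = s := by simp [τ]
    have hτn : τ n = t := by simp only [τ, hδ]; field_simp; ring
    have hτs : ∀ i, τ i ≤ τ (i+1) := fun i => by simp only [τ]; push_cast; nlinarith
    have hτm : Monotone τ := monotone_nat_of_le_succ hτs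
    have hτp : ∀ i, 0 ≤ τ i := fun i => hs.trans (hτ0 ▸ hτm (Nat.zero_le i))
    have hτle : ∀ i, s ≤ τ i := fun i => (hτ0 ▸ hτm (Nat.zero_le i))
    have hτd : ∀ i, τ (i+1) - τ i = δ := fun i => by simp only [τ]; push_cast; ring
    let d1 : ℕ → Ω → ℝ := fun i ω => S.W1 (τ (i+1)) ω - S.W1 (τ i) ω
    let d2 : ℕ → Ω → ℝ := fun i ω => S.W2 (τ (i+1)) ω - S.W2 (τ i) ω
    have hd1 : ∀ i, MB S.P (fun (_ : Unit) => d1 i) := fun i => MB1_incr S.bm1 (hτp i) (hτs i)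
    have hd2 : ∀ i, MB S.P (fun (_ : Unit) => d2 i) := fun i => MB1_incr S.bm2 (hτp i) (hτs i)
    let Q : ℕ → Ω → ℝ := fun k ω => ∑ i ∈ Finset.range k, d1 i ω * d2 i ω
    have hQs : ∀ k ω, Q (k+1) ω = Q k ω + d1 k ω * d2 k ω := fun k ω => Finset.sum_range_succ _ _
    have hQ : ∀ k, MB S.P (fun (_ : Unit) => Q k) := by
      intro k
      induction k with
      | zero => simpa [Q] using MB.const (P := S.P) (ι := Unit) 0
      | succ k ih =>
        have : Q (k+1) = fun ω => Q k ω + d1 k ω * d2 k ω := funext (hQs k)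
        rw [this]
        exact ih.add ((hd1 k).mul (hd2 k))
    have hWm : ∀ {W : ℝ → Ω → ℝ} (_ : IsStdBM S.P S.F W) {r r' : ℝ}, r ≤ r' → Measurable[S.F r'] (W r) :=
      fun hW _ _ h => (hW.adapted _).mono (S.F.mono h) le_rfl
    -- step A
    have hA : ∀ k, ∫ ω, ξ ω * ((S.W1 (τ k) ω - S.W1 s ω) * (S.W2 (τ k) ω - S.W2 s ω)) ∂S.P =
        ∫ ω, ξ ω * Q k ω ∂S.P := by
      intro k
      induction k with
      | zero => simp [hτ0, Q]
      | succ k ih =>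
        have hA1 := MB1_incr S.bm1 hs (hτle k)
        have hB1 := MB1_incr S.bm2 hs (hτle k)
        have hξk : Measurable[S.F (τ k)] ξ := hξ.mono (S.F.mono (hτle k)) le_rfl
        have i1 := (hM.mul (hA1.mul hB1)).integrable ()
        have i2 := ((hM.mul hA1).mul (hd2 k)).integrable ()
        have i3 := ((hM.mul hB1).mul (hd1 k)).integrable ()
        have i4 := (hM.mul ((hd1 k).mul (hd2 k))).integrable ()
        have i5 := (hM.mul (hQ k)).integrable ()
        have z2 : ∫ ω, ξ ω * (S.W1 (τ k) ω - S.W1 s ω) * d2 k ω ∂S.P = 0 :=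
          mul_incr S.bm2 (hτp k) (hτs k) (hξk.mul ((hWm S.bm1 le_rfl).sub (hWm S.bm1 (hτle k))))
        have z3 : ∫ ω, ξ ω * (S.W2 (τ k) ω - S.W2 s ω) * d1 k ω ∂S.P = 0 :=
          mul_incr S.bm1 (hτp k) (hτs k) (hξk.mul ((hWm S.bm2 le_rfl).sub (hWm S.bm2 (hτle k))))
        calc _ = ∫ ω, (ξ ω * ((S.W1 (τ k) ω - S.W1 s ω) * (S.W2 (τ k) ω - S.W2 s ω)) +
              ξ ω * (S.W1 (τ k) ω - S.W1 s ω) * d2 k ω + ξ ω * (S.W2 (τ k) ω - S.W2 s ω) * d1 k ω) +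
              ξ ω * (d1 k ω * d2 k ω) ∂S.P := by
                congr 1; ext ω; simp only [d1, d2]; ring
          _ = ∫ ω, ξ ω * Q k ω ∂S.P + ∫ ω, ξ ω * (d1 k ω * d2 k ω) ∂S.P := by
                rw [integral_add ((i1.fun_add i2).fun_add i3) i4, integral_add (i1.fun_add i2) i3, integral_add i1 i2,
                  z2, z3, ih]; ring
          _ = ∫ ω, ξ ω * Q (k+1) ω ∂S.P := by
                rw [← integral_add i5 i4]; congr 1; ext ω; rw [hQs]; ring
    -- step B
    have hW1m : ∀ r, Measurable[⨆ t : ℝ, MeasurableSpace.comap (S.W1 t) inferInstance] (S.W1 r) := fun r =>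
      Measurable.mono (comap_measurable (S.W1 r)) (le_iSup (fun t : ℝ => MeasurableSpace.comap (S.W1 t) inferInstance) r) le_rfl
    have hW2m : ∀ r, Measurable[⨆ t : ℝ, MeasurableSpace.comap (S.W2 t) inferInstance] (S.W2 r) := fun r =>
      Measurable.mono (comap_measurable (S.W2 r)) (le_iSup (fun t : ℝ => MeasurableSpace.comap (S.W2 t) inferInstance) r) le_rfl
    have hprod : ∀ {f g : Ω → ℝ}, Measurable[⨆ t : ℝ, MeasurableSpace.comap (S.W1 t) inferInstance] f →
        Measurable[⨆ t : ℝ, MeasurableSpace.comap (S.W2 t) inferInstance] g → Measurable f → Measurable g →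
        ∫ ω, f ω * g ω ∂S.P = (∫ ω, f ω ∂S.P) * ∫ ω, g ω ∂S.P := by
      intro f g hf hg hf' hg'
      have : IndepFun f g S.P := by
        rw [IndepFun_iff_Indep]
        exact indep_of_indep_of_le_left (indep_of_indep_of_le_right S.indepW hg.comap_le) hf.comap_le
      exact this.integral_fun_mul_eq_mul_integral hf'.aestronglyMeasurable hg'.aestronglyMeasurable
    have hd1m : ∀ i, Measurable (d1 i) := fun i => (S.bm1.meas _).sub (S.bm1.meas _)
    have hd2m : ∀ i, Measurable (d2 i) := fun i => (S.bm2.meas _).sub (S.bm2.meas _)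
    have hoff : ∀ k i, i < k → ∫ ω, (d1 i ω * d2 i ω) * (d1 k ω * d2 k ω) ∂S.P = 0 := by
      intro k i hik
      have h1 : ∫ ω, d1 i ω * d1 k ω ∂S.P = 0 :=
        mul_incr S.bm1 (hτp k) (hτs k) ((hWm S.bm1 (hτm hik)).sub (hWm S.bm1 (hτm hik.le)))
      calc _ = ∫ ω, (d1 i ω * d1 k ω) * (d2 i ω * d2 k ω) ∂S.P := by congr 1; ext ω; ring
        _ = (∫ ω, d1 i ω * d1 k ω ∂S.P) * ∫ ω, d2 i ω * d2 k ω ∂S.P :=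
          hprod (((hW1m _).sub (hW1m _)).mul ((hW1m _).sub (hW1m _)))
            (((hW2m _).sub (hW2m _)).mul ((hW2m _).sub (hW2m _)))
            ((hd1m i).mul (hd1m k)) ((hd2m i).mul (hd2m k))
        _ = 0 := by rw [h1, zero_mul]
    have hdiag : ∀ k, ∫ ω, (d1 k ω)^2 * (d2 k ω)^2 ∂S.P = δ^2 := by
      intro k
      rw [hprod (f := fun ω => (d1 k ω)^2) (g := fun ω => (d2 k ω)^2) (((hW1m _).sub (hW1m _)).pow_const 2) (((hW2m _).sub (hW2m _)).pow_const 2)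
        ((hd1m k).pow_const 2) ((hd2m k).pow_const 2)]
      have e1 : ∫ ω, (d1 k ω)^2 ∂S.P = δ := by rw [← hτd k]; exact incr_var S.bm1 (hτp k) (hτs k)
      have e2 : ∫ ω, (d2 k ω)^2 ∂S.P = δ := by rw [← hτd k]; exact incr_var S.bm2 (hτp k) (hτs k)
      rw [e1, e2]; ring
    have hQ2 : ∀ k, ∫ ω, (Q k ω)^2 ∂S.P = k * δ^2 := by
      intro k
      induction k with
      | zero => simp [Q]
      | succ k ih =>
        have i1 := ((hQ k).pow 2).integrable ()
        have i2 := ((hQ k).mul ((hd1 k).mul (hd2 k))).integrable ()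
        have i3 := (((hd1 k).pow 2).mul ((hd2 k).pow 2)).integrable ()
        have z : ∫ ω, Q k ω * (d1 k ω * d2 k ω) ∂S.P = 0 := by
          simp only [Q, Finset.sum_mul]
          rw [integral_finsetSum]
          · exact Finset.sum_eq_zero fun i hi => hoff k i (Finset.mem_range.1 hi)
          · intro i _
            exact (((hd1 i).mul (hd2 i)).mul ((hd1 k).mul (hd2 k))).integrable ()
        calc _ = ∫ ω, ((Q k ω)^2 + 2 * (Q k ω * (d1 k ω * d2 k ω))) + (d1 k ω)^2 * (d2 k ω)^2 ∂S.P := by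
                congr 1; ext ω; rw [hQs]; ring
          _ = _ := by
                rw [integral_add (i1.fun_add (i2.const_mul 2)) i3, integral_add i1 (i2.const_mul 2),
                  integral_const_mul, z, ih, hdiag]; push_cast; ring
    -- step C
    have h1 := hA n
    rw [hτn] at h1
    rw [h1]
    have hle : ∀ ω, |ξ ω * Q n ω| ≤ (1/(2*N)) * ξ ω ^ 2 + (N/2) * (Q n ω)^2 := by
      intro ω
      rw [abs_mul, ← sq_abs (ξ ω), ← sq_abs (Q n ω)]
      have h2 : (1/(2*N)) * |ξ ω| ^ 2 + ((N:ℝ)/2) * |Q n ω|^2 - |ξ ω| * |Q n ω| =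
        (1/(2*N)) * (|ξ ω| - N * |Q n ω|)^2 := by field_simp; ring
      have : 0 ≤ (1/(2*(N:ℝ))) * (|ξ ω| - N * |Q n ω|)^2 := by positivity
      linarith
    have i6 := (hM.pow 2).integrable ()
    have i7 := ((hQ n).pow 2).integrable ()
    refine (abs_integral_le_integral_abs).trans ((integral_mono ((hM.mul (hQ n)).integrable ()).abs
      ((i6.const_mul _).add (i7.const_mul _)) hle).trans (le_of_eq ?_))
    simp only [Pi.add_apply]
    rw [integral_add (i6.const_mul _) (i7.const_mul _), integral_const_mul, integral_const_mul, hQ2, hδ, hn]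
    push_cast
    field_simp
  have hlim : Tendsto (fun N : ℕ => (∫ ω, ξ ω ^ 2 ∂S.P + (t-s)^2) / 2 * (1 / (N:ℝ))) atTop (𝓝 0) := by
    simpa using (tendsto_one_div_atTop_nhds_zero_nat (𝕜 := ℝ)).const_mul ((∫ ω, ξ ω ^ 2 ∂S.P + (t-s)^2) / 2)
  have := ge_of_tendsto hlim (eventually_atTop.2 ⟨1, fun N hN => key N hN⟩)
  exact abs_nonpos_iff.1 this

end HabitModel

namespace HabitModel
open Filter Topology

/-! ### exponentially Lipschitz functions -/
def EL2 (f : ℝ → ℝ → ℝ) : Prop := ∃ C, 0 ≤ C ∧ ∀ x y x' y', |f x y - f x' y'| ≤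
  C * exp (C * (|x| + |y| + |x'| + |y'|)) * (|x - x'| + |y - y'|)

def EG (f : ℝ → ℝ → ℝ) : Prop := ∃ C, 0 ≤ C ∧ ∀ x y, |f x y| ≤ C * exp (C * (|x| + |y|))

lemma exp_raise {C C' N : ℝ} (h : 0 ≤ C) (h' : C ≤ C') (hN : 0 ≤ N) :
    C * exp (C * N) ≤ C' * exp (C' * N) := by
  have : 0 ≤ C' := h.trans h'
  gcongr

lemma EL2.growth {f} (h : EL2 f) : EG f := by
  obtain ⟨C, hC, h⟩ := h
  refine ⟨|f 0 0| + C + 1, by positivity, fun x y => ?_⟩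
  have h1 := h x y 0 0
  simp only [abs_zero, add_zero, sub_zero] at h1
  set n := |x| + |y| with hn
  have hn0 : 0 ≤ n := by positivity
  have h2 : n ≤ exp n := by linarith [add_one_le_exp n]
  have h3 : |f x y| ≤ |f 0 0| + |f x y - f 0 0| := by
    have := abs_add_le (f 0 0) (f x y - f 0 0); simpa using this
  have h4 : C * exp (C * n) * n ≤ C * exp ((C+1)*n) := by
    have : exp ((C+1)*n) = exp (C*n) * exp n := by rw [← exp_add]; ring_nf
    rw [this, mul_assoc]; gcongr
  have h5 : exp ((C+1)*n) ≤ exp ((|f 0 0| + C + 1)*n) := by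
    gcongr; linarith [abs_nonneg (f 0 0)]
  have h6 : 1 ≤ exp ((C+1)*n) := one_le_exp (by positivity)
  calc |f x y| ≤ |f 0 0| * 1 + C * exp ((C+1)*n) := by linarith
    _ ≤ |f 0 0| * exp ((C+1)*n) + C * exp ((C+1)*n) := by gcongr
    _ ≤ (|f 0 0| + C + 1) * exp ((C+1)*n) := by nlinarith
    _ ≤ _ := by gcongr

lemma EL2.cont {f} (h : EL2 f) : Continuous (fun q : ℝ × ℝ => f q.1 q.2) := by
  obtain ⟨C, hC, h⟩ := h
  rw [continuous_iff_continuousAt]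
  intro q
  rw [ContinuousAt, tendsto_iff_norm_sub_tendsto_zero]
  refine squeeze_zero (fun _ => norm_nonneg _) (fun e => h e.1 e.2 q.1 q.2) ?_
  have : Continuous fun e : ℝ × ℝ => C * exp (C * (|e.1| + |e.2| + |q.1| + |q.2|)) *
    (|e.1 - q.1| + |e.2 - q.2|) := by fun_prop
  have := this.tendsto q
  simpa using this

lemma EL2.const (c : ℝ) : EL2 (fun _ _ => c) := ⟨0, le_rfl, by simp⟩

lemma EL2.add {f g} (hf : EL2 f) (hg : EL2 g) : EL2 (fun x y => f x y + g x y) := by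
  obtain ⟨C, hC, h⟩ := hf
  obtain ⟨C', hC', h'⟩ := hg
  refine ⟨C + C', by positivity, fun x y x' y' => ?_⟩
  have h1 := h x y x' y'
  have h2 := h' x y x' y'
  set N := |x| + |y| + |x'| + |y'|
  have hN : 0 ≤ N := by positivity
  have e1 : exp (C * N) ≤ exp ((C + C') * N) := by gcongr; linarith
  have e2 : exp (C' * N) ≤ exp ((C + C') * N) := by gcongr; linarith
  calc _ = |(f x y - f x' y') + (g x y - g x' y')| := by ring_nf
    _ ≤ _ := abs_add_le _ _
    _ ≤ C * exp (C * N) * (|x - x'| + |y - y'|) + C' * exp (C' * N) * (|x - x'| + |y - y'|) := by gcongr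
    _ ≤ C * exp ((C + C') * N) * (|x - x'| + |y - y'|) + C' * exp ((C + C') * N) * (|x - x'| + |y - y'|) := by gcongr
    _ = _ := by ring

lemma EL2.mul {f g} (hf : EL2 f) (hg : EL2 g) : EL2 (fun x y => f x y * g x y) := by
  obtain ⟨G, hG, k⟩ := hf.growth
  obtain ⟨G', hG', k'⟩ := hg.growth
  obtain ⟨C, hC, h⟩ := hf
  obtain ⟨C', hC', h'⟩ := hg
  refine ⟨G * C' + G' * C + G + C' + G' + C, by positivity, fun x y x' y' => ?_⟩
  have h1 := h x y x' y'
  have h2 := h' x y x' y'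
  have k1 := k x y
  have k2 := k' x' y'
  set N := |x| + |y| + |x'| + |y'| with hN'
  have hN : 0 ≤ N := by positivity
  have k3 : |f x y| ≤ G * exp (G * N) := k1.trans (by gcongr; simp only [hN']; linarith [abs_nonneg x', abs_nonneg y'])
  have k4 : |g x' y'| ≤ G' * exp (G' * N) := k2.trans (by gcongr; simp only [hN']; linarith [abs_nonneg x, abs_nonneg y])
  have hd : 0 ≤ |x - x'| + |y - y'| := by positivity
  have hGC := mul_nonneg hG hC'
  have hGC' := mul_nonneg hG' hC
  set M := G * C' + G' * C + G + C' + G' + C with hM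
  have e1 : exp (G * N) * exp (C' * N) ≤ exp (M * N) := by
    rw [← exp_add, ← add_mul]; gcongr; linarith
  have e2 : exp (G' * N) * exp (C * N) ≤ exp (M * N) := by
    rw [← exp_add, ← add_mul]; gcongr; linarith
  calc _ = |f x y * (g x y - g x' y') + g x' y' * (f x y - f x' y')| := by ring_nf
    _ ≤ |f x y| * |g x y - g x' y'| + |g x' y'| * |f x y - f x' y'| := by
      rw [← abs_mul, ← abs_mul]; exact abs_add_le _ _
    _ ≤ (G * exp (G * N)) * (C' * exp (C' * N) * (|x - x'| + |y - y'|)) +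
        (G' * exp (G' * N)) * (C * exp (C * N) * (|x - x'| + |y - y'|)) := by gcongr
    _ = (G * C' * (exp (G * N) * exp (C' * N)) + G' * C * (exp (G' * N) * exp (C * N))) * (|x - x'| + |y - y'|) := by ring
    _ ≤ (G * C' * exp (M * N) + G' * C * exp (M * N)) * (|x - x'| + |y - y'|) := by gcongr
    _ ≤ M * exp (M * N) * (|x - x'| + |y - y'|) := by
      rw [← add_mul]; gcongr; linarith

lemma EL2.const_mul {f} (c : ℝ) (hf : EL2 f) : EL2 (fun x y => c * f x y) := (EL2.const c).mul hf

lemma EL2.congr {f g : ℝ → ℝ → ℝ} (h : EL2 f) (e : ∀ x y, g x y = f x y) : EL2 g := by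
  have : g = f := funext fun x => funext fun y => e x y
  rwa [this]

lemma EL2.of_deriv {f f' : ℝ → ℝ} (hf : ∀ z, HasDerivAt f (f' z) z) {C : ℝ} (hC : 0 ≤ C)
    (hb : ∀ z, |f' z| ≤ C * exp (C * |z|)) {p q : ℝ} (hp : |p| ≤ 1) (hq : |q| ≤ 1) :
    EL2 (fun x y => f (p * x + q * y)) := by
  refine ⟨C, hC, fun x y x' y' => ?_⟩
  set N := |x| + |y| + |x'| + |y'| with hN
  have hz : ∀ x y : ℝ, |p * x + q * y| ≤ |x| + |y| := fun x y => by
    refine (abs_add_le _ _).trans ?_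
    rw [abs_mul, abs_mul]
    nlinarith [abs_nonneg x, abs_nonneg y]
  have h1 : p * x + q * y ∈ Icc (-N) N := abs_le.1 ((hz x y).trans (by simp only [hN]; linarith [abs_nonneg x', abs_nonneg y']))
  have h2 : p * x' + q * y' ∈ Icc (-N) N := abs_le.1 ((hz x' y').trans (by simp only [hN]; linarith [abs_nonneg x, abs_nonneg y]))
  have := (convex_Icc (-N) N).norm_image_sub_le_of_norm_hasDerivWithin_le
    (f := f) (f' := f') (C := C * exp (C * N)) (fun z _ => (hf z).hasDerivWithinAt) (fun z hz => by
      rw [Real.norm_eq_abs]; refine (hb z).trans ?_; gcongr; exact abs_le.2 hz) h2 h1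
  simp only [Real.norm_eq_abs] at this
  refine this.trans ?_
  gcongr
  calc _ = |p * (x - x') + q * (y - y')| := by ring_nf
    _ ≤ _ := hz _ _

lemma EL2.exp (α : ℝ) {p q : ℝ} (hp : |p| ≤ 1) (hq : |q| ≤ 1) : EL2 (fun x y => Real.exp (α * (p * x + q * y))) := by
  refine EL2.of_deriv (f := fun z => Real.exp (α * z)) (f' := fun z => Real.exp (α * z) * α) (C := |α|)
    (fun z => ?_) (abs_nonneg _) (fun z => ?_) hp hq
  · simpa using ((hasDerivAt_id z).const_mul α).exp
  · rw [abs_mul, mul_comm, abs_of_pos (Real.exp_pos _)]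
    refine mul_le_mul_of_nonneg_left (Real.exp_le_exp.2 ?_) (abs_nonneg _)
    rw [← abs_mul]; exact le_abs_self _

/-- `C²` data with exponentially Lipschitz derivatives -/
structure G2 (g gx gy gxx gxy gyy : ℝ → ℝ → ℝ) : Prop where
  d0 : ∀ x y a b τ, HasDerivAt (fun τ => g (x + τ * a) (y + τ * b))
    (a * gx (x + τ * a) (y + τ * b) + b * gy (x + τ * a) (y + τ * b)) τ
  dx : ∀ x y a b τ, HasDerivAt (fun τ => gx (x + τ * a) (y + τ * b))
    (a * gxx (x + τ * a) (y + τ * b) + b * gxy (x + τ * a) (y + τ * b)) τ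
  dy : ∀ x y a b τ, HasDerivAt (fun τ => gy (x + τ * a) (y + τ * b))
    (a * gxy (x + τ * a) (y + τ * b) + b * gyy (x + τ * a) (y + τ * b)) τ
  e0 : EL2 g
  ex : EL2 gx
  ey : EL2 gy
  exx : EL2 gxx
  exy : EL2 gxy
  eyy : EL2 gyy

lemma taylor_line {h h1 h2 : ℝ → ℝ} (d0 : ∀ τ, HasDerivAt h (h1 τ) τ) (d1 : ∀ τ, HasDerivAt h1 (h2 τ) τ)
    {M : ℝ} (hM : ∀ τ ∈ Icc (0:ℝ) 1, |h2 τ - h2 0| ≤ M) : |h 1 - h 0 - h1 0 - h2 0 / 2| ≤ M := by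
  have hM0 : 0 ≤ M := (abs_nonneg _).trans (hM 0 (by simp))
  have e1 : ∀ τ ∈ Icc (0:ℝ) 1, |h1 τ - h1 0 - τ * h2 0| ≤ M := by
    intro τ hτ
    have := (convex_Icc (0:ℝ) 1).norm_image_sub_le_of_norm_hasDerivWithin_le
      (f := fun τ => h1 τ - τ * h2 0) (f' := fun τ => h2 τ - h2 0) (C := M)
      (fun z _ => (((d1 z).fun_sub ((hasDerivAt_id z).mul_const (h2 0))).congr_deriv (by simp)).hasDerivWithinAt)
      (fun z hz => hM z hz) (x := 0) (y := τ) (by simp) hτ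
    simp only [Real.norm_eq_abs, zero_mul, sub_zero] at this
    rw [show h1 τ - h1 0 - τ * h2 0 = h1 τ - τ * h2 0 - h1 0 by ring]
    refine this.trans ?_
    rw [abs_of_nonneg hτ.1]; nlinarith [hτ.2]
  have := (convex_Icc (0:ℝ) 1).norm_image_sub_le_of_norm_hasDerivWithin_le
      (f := fun τ => h τ - τ * h1 0 - τ^2/2 * h2 0) (f' := fun τ => h1 τ - h1 0 - τ * h2 0) (C := M)
      (fun z _ => (((((d0 z).fun_sub ((hasDerivAt_id z).mul_const (h1 0))).fun_sub
        (((hasDerivAt_pow 2 z).div_const 2).mul_const (h2 0)))).congr_deriv (by simp)).hasDerivWithinAt)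
      (fun z hz => e1 z hz) (x := 0) (y := 1) (by simp) (by simp)
  simp only [Real.norm_eq_abs] at this
  calc _ = |h 1 - 1 * h1 0 - 1^2/2 * h2 0 - (h 0 - 0 * h1 0 - 0^2/2 * h2 0)| := by ring_nf
    _ ≤ _ := by simpa using this

lemma G2.taylor {g gx gy gxx gxy gyy : ℝ → ℝ → ℝ} (G : G2 g gx gy gxx gxy gyy) :
    ∃ C, 0 ≤ C ∧ ∀ x y x' y', |g x' y' - g x y - ((x'-x) * gx x y + (y'-y) * gy x y) -
      ((x'-x)^2 * gxx x y + 2 * ((x'-x) * (y'-y)) * gxy x y + (y'-y)^2 * gyy x y) / 2| ≤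
      C * Real.exp (C * (|x| + |y| + |x'| + |y'|)) * (|x' - x| + |y' - y|)^3 := by
  obtain ⟨C1, h1, k1⟩ := G.exx
  obtain ⟨C2, h2, k2⟩ := G.exy
  obtain ⟨C3, h3, k3⟩ := G.eyy
  set C := C1 + C2 + C3
  have hC : 0 ≤ C := by positivity
  refine ⟨4 * C, by positivity, fun x y x' y' => ?_⟩
  set a := x' - x with ha
  set b := y' - y with hb
  set N := |x| + |y| + |x'| + |y'| with hN
  have hN0 : 0 ≤ N := by positivity
  have key := taylor_line (h := fun τ => g (x + τ * a) (y + τ * b))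
    (h1 := fun τ => a * gx (x + τ * a) (y + τ * b) + b * gy (x + τ * a) (y + τ * b))
    (h2 := fun τ => a * (a * gxx (x + τ * a) (y + τ * b) + b * gxy (x + τ * a) (y + τ * b)) +
      b * (a * gxy (x + τ * a) (y + τ * b) + b * gyy (x + τ * a) (y + τ * b)))
    (M := 4 * C * Real.exp (4 * C * N) * (|a| + |b|)^3)
    (fun τ => G.d0 x y a b τ) (fun τ => ((G.dx x y a b τ).const_mul a).add ((G.dy x y a b τ).const_mul b))
    (fun τ hτ => by
      have hX : |x + τ * a| ≤ |x| + |x'| := by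
        have : x + τ * a = (1-τ) * x + τ * x' := by rw [ha]; ring
        rw [this]
        refine (abs_add_le _ _).trans ?_
        rw [abs_mul, abs_mul, abs_of_nonneg hτ.1, abs_of_nonneg (sub_nonneg.2 hτ.2)]
        nlinarith [abs_nonneg x, abs_nonneg x', hτ.1, hτ.2]
      have hY : |y + τ * b| ≤ |y| + |y'| := by
        have : y + τ * b = (1-τ) * y + τ * y' := by rw [hb]; ring
        rw [this]
        refine (abs_add_le _ _).trans ?_
        rw [abs_mul, abs_mul, abs_of_nonneg hτ.1, abs_of_nonneg (sub_nonneg.2 hτ.2)]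
        nlinarith [abs_nonneg y, abs_nonneg y', hτ.1, hτ.2]
      have hE : ∀ {f : ℝ → ℝ → ℝ} {c : ℝ}, 0 ≤ c → c ≤ C → (∀ x y x' y', |f x y - f x' y'| ≤
          c * Real.exp (c * (|x| + |y| + |x'| + |y'|)) * (|x - x'| + |y - y'|)) →
          |f (x + τ * a) (y + τ * b) - f x y| ≤ C * Real.exp (4 * C * N) * (|a| + |b|) := by
        intro f c hc hcC k
        refine (k _ _ _ _).trans ?_
        rw [add_sub_cancel_left, add_sub_cancel_left, abs_mul, abs_mul, abs_of_nonneg hτ.1]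
        have e1 : c * (|x + τ * a| + |y + τ * b| + |x| + |y|) ≤ 4 * C * N := by
          have : |x + τ * a| + |y + τ * b| + |x| + |y| ≤ 2 * N := by
            simp only [hN]; linarith [abs_nonneg x', abs_nonneg y']
          calc _ ≤ C * (2 * N) := mul_le_mul hcC this (by positivity) hC
            _ ≤ _ := by nlinarith
        have e2 : τ * |a| + τ * |b| ≤ |a| + |b| := by nlinarith [abs_nonneg a, abs_nonneg b, hτ.2]
        have e3 : 0 ≤ τ * |a| + τ * |b| := by have := hτ.1; positivity
        gcongr
      have f1 := hE h1 (by simp only [C]; linarith) k1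
      have f2 := hE h2 (by simp only [C]; linarith) k2
      have f3 := hE h3 (by simp only [C]; linarith) k3
      simp only [zero_mul, add_zero]
      set Q := C * Real.exp (4 * C * N) * (|a| + |b|) with hQ
      calc _ = |a^2 * (gxx (x + τ * a) (y + τ * b) - gxx x y) + 2 * (a * b) * (gxy (x + τ * a) (y + τ * b) - gxy x y)
            + b^2 * (gyy (x + τ * a) (y + τ * b) - gyy x y)| := by ring_nf
        _ ≤ |a^2 * (gxx (x + τ * a) (y + τ * b) - gxx x y)| + |2 * (a * b) * (gxy (x + τ * a) (y + τ * b) - gxy x y)|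
            + |b^2 * (gyy (x + τ * a) (y + τ * b) - gyy x y)| :=
            (abs_add_le _ _).trans (by gcongr; exact abs_add_le _ _)
        _ ≤ |a|^2 * Q + 2 * (|a| * |b|) * Q + |b|^2 * Q := by
            rw [abs_mul, abs_mul, abs_mul, abs_mul, abs_mul, abs_pow, abs_pow, abs_two]
            gcongr
        _ = (C * Real.exp (4 * C * N)) * (|a| + |b|)^3 := by rw [hQ]; ring
        _ ≤ _ := by gcongr; linarith)
  simp only [zero_mul, add_zero, one_mul] at key
  have ex : x + a = x' := by rw [ha]; ring
  have ey : y + b = y' := by rw [hb]; ring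
  rw [ex, ey] at key
  refine le_trans (le_of_eq ?_) key
  ring_nf

end HabitModel

namespace HabitModel
open Filter Topology
variable {Ω : Type*} [mΩ : MeasurableSpace Ω]

/-- jointly measurable processes with bounded moments on `[0,T]` -/
structure PB (P : Measure Ω) (T : ℝ) (f : ℝ → Ω → ℝ) : Prop where
  meas : Measurable (fun q : ℝ × Ω => f q.1 q.2)
  mb : MB P (fun r : Icc (0:ℝ) T => f r)

namespace PB
variable {P : Measure Ω} [IsProbabilityMeasure P] {T : ℝ} {f g : ℝ → Ω → ℝ}

lemma add (hf : PB P T f) (hg : PB P T g) : PB P T (fun r ω => f r ω + g r ω) :=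
  ⟨hf.meas.add hg.meas, hf.mb.add hg.mb⟩
lemma mul (hf : PB P T f) (hg : PB P T g) : PB P T (fun r ω => f r ω * g r ω) :=
  ⟨hf.meas.mul hg.meas, hf.mb.mul hg.mb⟩
lemma const (c : ℝ) : PB P T (fun _ _ => c) := ⟨measurable_const, MB.const c⟩
lemma const_mul (c : ℝ) (hf : PB P T f) : PB P T (fun r ω => c * f r ω) := (const c).mul hf
lemma sub (hf : PB P T f) (hg : PB P T g) : PB P T (fun r ω => f r ω - g r ω) :=
  ⟨hf.meas.sub hg.meas, hf.mb.sub hg.mb⟩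
lemma abs (hf : PB P T f) : PB P T (fun r ω => |f r ω|) :=
  ⟨hf.meas.norm, hf.mb.abs⟩
lemma pow (n : ℕ) (hf : PB P T f) : PB P T (fun r ω => f r ω ^ n) :=
  ⟨hf.meas.pow_const n, hf.mb.pow n⟩
lemma dom (hg : PB P T g) (hm : Measurable (fun q : ℝ × Ω => f q.1 q.2))
    (hd : ∀ r ∈ Icc (0:ℝ) T, ∀ᵐ ω ∂P, |f r ω| ≤ |g r ω|) : PB P T f :=
  ⟨hm, hg.mb.dom (fun i => (hm.comp measurable_prodMk_left).aestronglyMeasurable) (fun i => hd i i.2)⟩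

lemma sec (hf : PB P T f) (r : ℝ) : Measurable (f r) := hf.meas.comp measurable_prodMk_left
lemma sec' (hf : PB P T f) (ω : Ω) : Measurable (fun r => f r ω) := hf.meas.comp measurable_prodMk_right

lemma bound (hf : PB P T f) : ∃ K, 0 ≤ K ∧ ∀ r ∈ Icc (0:ℝ) T, ∫ ω, |f r ω| ∂P ≤ K := by
  obtain ⟨K, hK, h⟩ := hf.mb.abs.bound
  exact ⟨K, hK, fun r hr => (le_abs_self _).trans (h ⟨r, hr⟩)⟩

lemma expMeas (hf : PB P T f) : Measurable (fun r => ∫ ω, f r ω ∂P) :=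
  (hf.meas.stronglyMeasurable.integral_prod_right').measurable

lemma integrable_prod (hf : PB P T f) {s t : ℝ} (hs : 0 ≤ s) (ht : t ≤ T) :
    Integrable (fun q : ℝ × Ω => f q.1 q.2) ((volume.restrict (Ioc s t)).prod P) := by
  rw [integrable_prod_iff hf.meas.aestronglyMeasurable]
  have hsub : Ioc s t ⊆ Icc 0 T := fun x hx => ⟨hs.trans hx.1.le, hx.2.trans ht⟩
  constructor
  · filter_upwards [ae_restrict_mem measurableSet_Ioc] with r hr
    exact hf.mb.integrable ⟨r, hsub hr⟩
  · obtain ⟨K, hK, hb⟩ := hf.bound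
    refine Integrable.mono' (integrable_const K) (hf.abs.expMeas.aestronglyMeasurable) ?_
    filter_upwards [ae_restrict_mem measurableSet_Ioc] with r hr
    rw [Real.norm_of_nonneg (integral_nonneg fun _ => norm_nonneg _)]
    exact hb r (hsub hr)

lemma ae_int (hf : PB P T f) {s t : ℝ} (hs : 0 ≤ s) (hst : s ≤ t) (ht : t ≤ T) :
    ∀ᵐ ω ∂P, IntervalIntegrable (fun r => f r ω) volume s t := by
  filter_upwards [(hf.integrable_prod hs ht).prod_left_ae] with ω hω
  rw [intervalIntegrable_iff_integrableOn_Ioc_of_le hst]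
  exact hω

lemma swap (hf : PB P T f) {s t : ℝ} (hs : 0 ≤ s) (hst : s ≤ t) (ht : t ≤ T) :
    ∫ ω, (∫ r in s..t, f r ω) ∂P = ∫ r in s..t, ∫ ω, f r ω ∂P := by
  simp only [intervalIntegral.integral_of_le hst]
  exact (integral_integral_swap (hf.integrable_prod hs ht)).symm

lemma intMeas (hf : PB P T f) {s t : ℝ} (hst : s ≤ t) : Measurable (fun ω => ∫ r in s..t, f r ω) := by
  simp only [intervalIntegral.integral_of_le hst]
  exact (hf.meas.stronglyMeasurable.integral_prod_left' (μ := volume.restrict (Ioc s t))).measurable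

lemma intervalIntegrable (hf : PB P T f) {s t : ℝ} (hs : 0 ≤ s) (hst : s ≤ t) (ht : t ≤ T) :
    IntervalIntegrable (fun r => ∫ ω, f r ω ∂P) volume s t := by
  rw [intervalIntegrable_iff_integrableOn_Ioc_of_le hst]
  exact (hf.integrable_prod hs ht).integral_prod_left

lemma avg (hf : PB P T f) : MB P (fun (i : Ix T) ω => (∫ r in i.s..i.t, f r ω) / i.d) := by
  refine ⟨fun i => ((hf.intMeas i.st.le).div_const _).aestronglyMeasurable, fun p => ?_⟩
  have hp := hf.abs.pow p
  obtain ⟨K, hK, hb⟩ := hp.bound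
  refine ⟨K, fun i => ?_⟩
  have hs := i.s0
  have hst := i.st.le
  have htT := i.tT
  have hd := i.d_pos
  have hvol : (volume.restrict (Ioc i.s i.t)).real univ = i.d := by
    simp [Measure.real, Ix.d, hst]
  have hle : ∀ᵐ ω ∂P, |(∫ r in i.s..i.t, f r ω) / i.d| ^ p ≤ (∫ r in i.s..i.t, |f r ω|^p) / i.d := by
    filter_upwards [hf.ae_int hs hst htT, hp.ae_int hs hst htT] with ω h1 h2
    rw [intervalIntegrable_iff_integrableOn_Ioc_of_le hst] at h1 h2
    have hne : NeZero (volume.restrict (Ioc i.s i.t)) := ⟨by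
      intro h; rw [h] at hvol; simp at hvol; linarith⟩
    have := (convexOn_pow p).map_average_le (μ := volume.restrict (Ioc i.s i.t)) (f := fun r => |f r ω|)
      (by fun_prop) isClosed_Ici (Eventually.of_forall fun r => Set.mem_Ici.2 (abs_nonneg _)) h1.abs h2
    rw [average_eq, average_eq, hvol, smul_eq_mul, smul_eq_mul, inv_mul_eq_div, inv_mul_eq_div] at this
    rw [intervalIntegral.integral_of_le hst, intervalIntegral.integral_of_le hst, abs_div, abs_of_pos hd]
    refine le_trans ?_ this
    gcongr
    exact abs_integral_le_integral_abs
  have hI : Integrable (fun ω => (∫ r in i.s..i.t, |f r ω|^p) / i.d) P := by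
    simp only [intervalIntegral.integral_of_le hst]
    exact ((hp.integrable_prod hs htT).integral_prod_right).div_const _
  have hI2 : Integrable (fun ω => |(∫ r in i.s..i.t, f r ω) / i.d| ^ p) P := by
    refine hI.mono' (((hf.intMeas hst).div_const _).norm.pow_const p).aestronglyMeasurable ?_
    filter_upwards [hle] with ω hω
    rw [Real.norm_of_nonneg (by positivity)]
    exact hω
  refine ⟨hI2, (integral_mono_ae hI2 hI hle).trans ?_⟩
  rw [integral_div, hp.swap hs hst htT, div_le_iff₀ hd]
  have : ∫ r in i.s..i.t, ∫ ω, |f r ω|^p ∂P ≤ ∫ r in i.s..i.t, K := by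
    refine intervalIntegral.integral_mono_on hst (hp.intervalIntegrable hs hst htT) intervalIntegrable_const ?_
    intro r hr
    have := hb r ⟨hs.trans hr.1, hr.2.trans htT⟩
    simpa using this
  refine this.trans (le_of_eq ?_)
  simp [Ix.d, mul_comm]

end PB

lemma const_of_holder {n : ℝ → ℝ} {T K : ℝ} (hT : 0 ≤ T)
    (h : ∀ s t, 0 ≤ s → s < t → t ≤ T → |n t - n s| ≤ K * ((t - s) * √(t-s))) : n T = n 0 := by
  rcases eq_or_lt_of_le hT with rfl | hT'
  · rfl
  have key : ∀ N : ℕ, 0 < N → |n T - n 0| ≤ K * T * √(T / N) := by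
    intro N hN
    have hN' : (0:ℝ) < N := by exact_mod_cast hN
    have tel : ∀ k : ℕ, k ≤ N → |n (k * (T/N)) - n 0| ≤ k * (K * ((T/N) * √(T/N))) := by
      intro k
      induction k with
      | zero => simp
      | succ k ih =>
        intro hk
        have h0 : (0:ℝ) < T/N := by positivity
        have h1 := h (k * (T/N)) ((k+1:ℕ) * (T/N)) (by positivity) (by push_cast; nlinarith) (by
          have : ((k+1:ℕ):ℝ) ≤ N := by exact_mod_cast hk
          calc _ ≤ (N:ℝ) * (T/N) := by gcongr
            _ = T := by field_simp)
        have e : ((k+1:ℕ):ℝ) * (T/N) - k * (T/N) = T/N := by push_cast; ring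
        rw [e] at h1
        calc _ = |(n ((k+1:ℕ) * (T/N)) - n (k * (T/N))) + (n (k * (T/N)) - n 0)| := by ring_nf
          _ ≤ _ := abs_add_le _ _
          _ ≤ K * ((T/N) * √(T/N)) + k * (K * ((T/N) * √(T/N))) := add_le_add h1 (ih (by omega))
          _ = _ := by push_cast; ring
    have := tel N le_rfl
    rw [show (N:ℝ) * (T/N) = T by field_simp] at this
    refine this.trans (le_of_eq ?_)
    field_simp
  have hlim : Tendsto (fun N : ℕ => K * T * √(T / N)) atTop (𝓝 0) := by
    have h1 := tendsto_const_div_atTop_nhds_zero_nat T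
    have := ((continuous_sqrt.tendsto 0).comp h1).const_mul (K*T)
    simpa using this
  have := ge_of_tendsto hlim (eventually_atTop.2 ⟨1, fun N hN => key N hN⟩)
  exact sub_eq_zero.1 (abs_nonpos_iff.1 this)

/-- discounting -/
lemma discount {m l : ℝ → ℝ} {T θ : ℝ} (hT : 0 ≤ T) (hl : IntervalIntegrable l volume 0 T)
    (h : ∀ t ∈ Icc 0 T, m t = m 0 + ∫ r in (0:ℝ)..t, l r) :
    exp (-θ*T) * m T = m 0 + ∫ r in (0:ℝ)..T, exp (-θ*r) * (-θ * m r + l r) := by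
  have h1 : AbsolutelyContinuousOnInterval (fun x => m 0 + ∫ v in (0:ℝ)..x, l v) 0 T := by
    refine AbsolutelyContinuousOnInterval.add ?_ (hl.absolutelyContinuousOnInterval_intervalIntegral (by simp))
    exact ((LipschitzWith.const (m 0)).lipschitzOnWith (s := uIcc 0 T)).absolutelyContinuousOnInterval
  have h2 : AbsolutelyContinuousOnInterval (fun x => exp (-θ*x)) 0 T := by
    refine ContDiffOn.absolutelyContinuousOnInterval ?_
    exact ContDiff.contDiffOn (by fun_prop)
  have hd2 : ∀ x, HasDerivAt (fun x => exp (-θ*x)) (exp (-θ*x) * (-θ)) x := fun x => by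
    simpa using ((hasDerivAt_id x).const_mul (-θ)).exp
  have := h2.integral_deriv_mul_eq_sub h1
  rw [intervalIntegral.integral_same, add_zero, mul_zero, exp_zero, one_mul, ← h T (by simp [hT])] at this
  rw [eq_add_of_sub_eq this.symm, add_comm]
  congr 1
  refine intervalIntegral.integral_congr_ae ?_
  filter_upwards [hl.ae_hasDerivAt_integral] with x hx hxm
  have hx' : x ∈ uIcc 0 T := uIoc_subset_uIcc hxm
  have := hx hx' 0 (by simp)
  rw [(hd2 x).deriv, (this.const_add (m 0)).deriv]
  rw [uIcc_of_le hT] at hx'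
  rw [← h x hx']
  ring

end HabitModel

namespace HabitModel
open Filter Topology
variable {Ω : Type*} [mΩ : MeasurableSpace Ω]

def muD (S : Setting Ω) (u : ℝ → Ω → ℝ) (r : ℝ) (ω : Ω) : ℝ := S.B - S.β₁^2/2 - u r ω
def nuD (S : Setting Ω) (X Y u : ℝ → Ω → ℝ) (r : ℝ) (ω : Ω) : ℝ :=
  -S.ρ - S.β₂^2/2 + S.ρ * (u r ω * exp (X r ω - Y r ω))
def hI (S : Setting Ω) (X u : ℝ → Ω → ℝ) (r : ℝ) (ω : Ω) : ℝ :=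
  u r ω * exp (X r ω + ((S.ρ + S.β₂^2/2) * r - S.β₂ * S.W2 r ω))

structure ItoD (S : Setting Ω) (x0 y0 : ℝ) (X Y u : ℝ → Ω → ℝ) : Prop where
  adX : ∀ t, 0 ≤ t → Measurable[S.F t] (X t)
  adY : ∀ t, 0 ≤ t → Measurable[S.F t] (Y t)
  mX : Measurable (fun q : ℝ × Ω => X q.1 q.2)
  mY : Measurable (fun q : ℝ × Ω => Y q.1 q.2)
  mu : Measurable (fun q : ℝ × Ω => u q.1 q.2)
  u0 : ∀ t ω, 0 ≤ u t ω
  uR : ∀ t ω, u t ω ≤ S.R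
  eqX : ∀ᵐ ω ∂S.P, ∀ t, 0 ≤ t → X t ω = x0 + (∫ r in (0:ℝ)..t, muD S u r ω) + S.β₁ * S.W1 t ω
  eqY : ∀ᵐ ω ∂S.P, ∀ t, 0 ≤ t → Y t ω = y0 + (∫ r in (0:ℝ)..t, nuD S X Y u r ω) + S.β₂ * S.W2 t ω
  eqH : ∀ᵐ ω ∂S.P, ∀ t, 0 ≤ t → exp (Y t ω) = exp ((-S.ρ - S.β₂^2/2) * t + S.β₂ * S.W2 t ω) *
    (exp y0 + S.ρ * ∫ r in (0:ℝ)..t, hI S X u r ω)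

lemma IsStdBM.measProd {P : Measure Ω} {F : Filtration ℝ mΩ} {W : ℝ → Ω → ℝ} (hW : IsStdBM P F W) :
    Measurable (fun q : ℝ × Ω => W q.1 q.2) := by
  have h2 : Measurable (Function.uncurry fun (t : ℝ) (ω : Ω) => W t ω) :=
    measurable_uncurry_of_continuous_of_measurable (fun ω => hW.cont ω) (fun t => (hW.adapted t).mono (F.le t) le_rfl)
  exact h2

lemma PB_exp_W {P : Measure Ω} [IsProbabilityMeasure P] {F : Filtration ℝ mΩ} {W : ℝ → Ω → ℝ}
    (hW : IsStdBM P F W) (T : ℝ) {c : ℝ} (hc : 0 ≤ c) : PB P T (fun t ω => exp (c * |W t ω|)) :=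
  ⟨by have := hW.measProd; fun_prop, MB_exp_W hW T c hc⟩

namespace ItoD
variable {S : Setting Ω} {x0 y0 : ℝ} {X Y u : ℝ → Ω → ℝ}

lemma pbU (I : ItoD S x0 y0 X Y u) (T : ℝ) : PB S.P T u := by
  have := S.isProb
  refine (PB.const S.R).dom I.mu fun r _ => Eventually.of_forall fun ω => ?_
  rw [abs_of_nonneg (I.u0 r ω)]
  exact (I.uR r ω).trans (le_abs_self _)

lemma X_bd (I : ItoD S x0 y0 X Y u) (T : ℝ) : ∀ᵐ ω ∂S.P, ∀ t ∈ Icc (0:ℝ) T,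
    |X t ω| ≤ (|x0| + (|S.B - S.β₁^2/2| + S.R) * T) + S.β₁ * |S.W1 t ω| := by
  filter_upwards [I.eqX] with ω h t ht
  rw [h t ht.1]
  refine (abs_add_le _ _).trans (add_le_add ((abs_add_le _ _).trans (add_le_add le_rfl ?_)) ?_)
  · have := intervalIntegral.norm_integral_le_of_norm_le_const (a := 0) (b := t) (f := fun r => muD S u r ω)
      (C := |S.B - S.β₁^2/2| + S.R) (fun r _ => by
        rw [Real.norm_eq_abs, muD]
        refine (abs_sub _ _).trans ?_
        rw [abs_of_nonneg (I.u0 r ω)]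
        gcongr
        exact I.uR r ω)
    rw [Real.norm_eq_abs, sub_zero, abs_of_nonneg ht.1] at this
    refine this.trans ?_
    have := S.hR
    gcongr
    exact ht.2
  · rw [abs_mul, abs_of_pos S.hβ₁]

lemma pbX (I : ItoD S x0 y0 X Y u) (T : ℝ) {c : ℝ} (hc : 0 ≤ c) : PB S.P T (fun t ω => exp (c * |X t ω|)) := by
  have := S.isProb
  have hβ := S.hβ₁
  refine ((PB_exp_W S.bm1 T (c := c * S.β₁) (by positivity)).const_mul
    (exp (c * (|x0| + (|S.B - S.β₁^2/2| + S.R) * T)))).dom (by have := I.mX; fun_prop) fun r hr => ?_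
  filter_upwards [I.X_bd T] with ω h
  refine le_trans ?_ (le_abs_self _)
  rw [abs_of_pos (exp_pos _), ← exp_add]
  refine exp_le_exp.2 ?_
  have := mul_le_mul_of_nonneg_left (h r hr) hc
  linarith

lemma pbH (I : ItoD S x0 y0 X Y u) (T : ℝ) : PB S.P T (hI S X u) := by
  have := S.isProb
  have hβ := S.hβ₂
  have hρ := S.hρ₀
  have hm := S.bm2.measProd
  have hx := I.mX
  have hu := I.mu
  refine (((I.pbX T zero_le_one).mul (PB_exp_W S.bm2 T hβ.le)).const_mul
    (S.R * exp ((S.ρ + S.β₂^2/2) * T))).dom ?_ fun r hr => Eventually.of_forall fun ω => ?_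
  · unfold hI; fun_prop
  · have hR := S.hR
    rw [hI, abs_of_nonneg (mul_nonneg (I.u0 r ω) (exp_pos _).le), abs_of_pos (by positivity), mul_assoc]
    refine mul_le_mul (I.uR r ω) ?_ (exp_pos _).le hR.le
    rw [← exp_add, ← exp_add]
    refine exp_le_exp.2 ?_
    have h1 := le_abs_self (X r ω)
    have h2 : -(S.β₂ * S.W2 r ω) ≤ S.β₂ * |S.W2 r ω| := by
      have := mul_le_mul_of_nonneg_left (neg_abs_le (S.W2 r ω)) hβ.le
      linarith
    have h3 : (S.ρ + S.β₂^2/2) * r ≤ (S.ρ + S.β₂^2/2) * T := by gcongr; exact hr.2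
    linarith

lemma hI_nonneg (I : ItoD S x0 y0 X Y u) (r : ℝ) (ω : Ω) : 0 ≤ hI S X u r ω :=
  mul_nonneg (I.u0 r ω) (exp_pos _).le

lemma Y_lower (I : ItoD S x0 y0 X Y u) : ∀ᵐ ω ∂S.P, ∀ t, 0 ≤ t →
    y0 + ((-S.ρ - S.β₂^2/2) * t + S.β₂ * S.W2 t ω) ≤ Y t ω := by
  filter_upwards [I.eqH] with ω h t ht
  rw [← exp_le_exp, h t ht, add_comm, exp_add]
  gcongr
  have : 0 ≤ ∫ r in (0:ℝ)..t, hI S X u r ω :=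
    intervalIntegral.integral_nonneg ht fun r _ => I.hI_nonneg r ω
  have := mul_nonneg S.hρ₀.le this
  linarith

lemma pbYn (I : ItoD S x0 y0 X Y u) {T : ℝ} (hT : 0 ≤ T) (n : ℕ) :
    PB S.P T (fun t ω => exp (n * |Y t ω|)) := by
  have := S.isProb
  have hβ := S.hβ₂
  have hρ := S.hρ₀
  have hmY := I.mY
  set κ := S.ρ + S.β₂^2/2 with hκ
  have hκ0 : 0 < κ := by positivity
  have hW := PB_exp_W S.bm2 T (c := n * S.β₂) (by positivity)
  -- lower part
  have p1 : PB S.P T (fun t ω => exp (-n * Y t ω)) := by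
    refine (hW.const_mul (exp (n * (|y0| + κ * T)))).dom (by fun_prop) fun r hr => ?_
    filter_upwards [I.Y_lower] with ω h
    refine le_trans ?_ (le_abs_self _)
    rw [abs_of_pos (exp_pos _), ← exp_add]
    refine exp_le_exp.2 ?_
    have h1 := h r hr.1
    have h2 := mul_le_mul_of_nonneg_left (neg_abs_le (S.W2 r ω)) hβ.le
    have h3 : κ * r ≤ κ * T := by gcongr; exact hr.2
    have h4 := neg_abs_le y0
    have h6 : (-S.ρ - S.β₂^2/2) * r = -(κ * r) := by rw [hκ]; ring
    have h5 : -Y r ω ≤ |y0| + κ * T + S.β₂ * |S.W2 r ω| := by linarith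
    have := mul_le_mul_of_nonneg_left h5 (Nat.cast_nonneg (α := ℝ) n)
    linarith
  -- upper part
  have hfix : MB S.P (fun (_ : Icc (0:ℝ) T) ω => ∫ r in (0:ℝ)..(T+1), hI S X u r ω) := by
    have := ((I.pbH (T+1)).avg.reindex (fun _ : Icc (0:ℝ) T => (⟨(0,T+1), le_rfl, by simp; linarith, le_rfl⟩ : Ix (T+1)))).const_mul (T+1)
    refine this.dom (fun _ => ((I.pbH (T+1)).intMeas (by linarith)).aestronglyMeasurable) fun _ =>
      Eventually.of_forall fun ω => le_of_eq ?_
    simp only [Ix.s, Ix.t, Ix.d, sub_zero]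
    congr 1
    field_simp
  have p2 : PB S.P T (fun t ω => exp (n * Y t ω)) := by
    refine ⟨by fun_prop, ?_⟩
    refine (hW.mb.mul ((((MB.const (exp y0)).add (hfix.const_mul S.ρ))).pow n)).dom
      (fun i => Measurable.aestronglyMeasurable (by
        have : Measurable (Y i) := hmY.comp measurable_prodMk_left
        fun_prop)) fun t => ?_
    filter_upwards [I.eqH, (I.pbH (T+1)).ae_int le_rfl (by linarith : (0:ℝ) ≤ T+1) le_rfl] with ω h hint
    have h0 := t.2.1
    have hm : ∫ r in (0:ℝ)..t, hI S X u r ω ≤ ∫ r in (0:ℝ)..(T+1), hI S X u r ω :=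
      intervalIntegral.integral_mono_interval le_rfl h0 (by linarith [t.2.2])
        (Eventually.of_forall fun r => I.hI_nonneg r ω) hint
    have hp : 0 ≤ ∫ r in (0:ℝ)..t, hI S X u r ω :=
      intervalIntegral.integral_nonneg h0 fun r _ => I.hI_nonneg r ω
    have hp2 := hp.trans hm
    rw [abs_of_pos (exp_pos _), abs_of_nonneg (by positivity), exp_nat_mul, h t h0, mul_pow, ← exp_nat_mul]
    refine mul_le_mul (exp_le_exp.2 ?_) (pow_le_pow_left₀ (by positivity) (by gcongr) n) (by positivity) (exp_pos _).le
    have h2 := mul_le_mul_of_nonneg_left (le_abs_self (S.W2 t ω)) hβ.le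
    have h3 : 0 ≤ κ * t := by positivity
    have h6 : (-S.ρ - S.β₂^2/2) * t = -(κ * t) := by rw [hκ]; ring
    have h4 : (-S.ρ - S.β₂^2/2) * t + S.β₂ * S.W2 t ω ≤ S.β₂ * |S.W2 t ω| := by linarith
    have := mul_le_mul_of_nonneg_left h4 (Nat.cast_nonneg (α := ℝ) n)
    linarith
  refine (p1.add p2).dom (by fun_prop) fun r _ => Eventually.of_forall fun ω => ?_
  refine le_trans ?_ (le_abs_self _)
  rw [abs_of_pos (exp_pos _)]
  rcases abs_cases (Y r ω) with ⟨e, _⟩ | ⟨e, _⟩ <;> rw [e]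
  · linarith [exp_pos (-n * Y r ω)]
  · rw [show (n:ℝ) * -Y r ω = -n * Y r ω by ring]
    linarith [exp_pos (n * Y r ω)]

lemma pbE (I : ItoD S x0 y0 X Y u) {T : ℝ} (hT : 0 ≤ T) {c : ℝ} (hc : 0 ≤ c) :
    PB S.P T (fun t ω => exp (c * (|X t ω| + |Y t ω|))) := by
  have := S.isProb
  obtain ⟨n, hn⟩ := exists_nat_ge c
  have h1 := I.mX
  have h2 := I.mY
  refine ((I.pbX T hc).mul (I.pbYn hT n)).dom (by fun_prop) fun r _ => Eventually.of_forall fun ω => ?_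
  refine le_trans ?_ (le_abs_self _)
  rw [abs_of_pos (exp_pos _), ← exp_add, mul_add]
  gcongr

lemma pbF (I : ItoD S x0 y0 X Y u) {T : ℝ} (hT : 0 ≤ T) {f : ℝ → ℝ → ℝ} (hf : EG f)
    (hm : Measurable (fun q : ℝ × ℝ => f q.1 q.2)) : PB S.P T (fun t ω => f (X t ω) (Y t ω)) := by
  have := S.isProb
  obtain ⟨C, hC, h⟩ := hf
  refine ((I.pbE hT hC).const_mul C).dom (hm.comp (I.mX.prodMk I.mY)) fun r _ => Eventually.of_forall fun ω => ?_
  rw [abs_of_nonneg (by positivity : 0 ≤ C * exp _)]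
  exact h _ _

lemma pbL (I : ItoD S x0 y0 X Y u) {T : ℝ} (hT : 0 ≤ T) {f : ℝ → ℝ → ℝ} (hf : EL2 f) :
    PB S.P T (fun t ω => f (X t ω) (Y t ω)) := I.pbF hT hf.growth hf.cont.measurable

lemma pbMu (I : ItoD S x0 y0 X Y u) (T : ℝ) : PB S.P T (muD S u) := by
  have := S.isProb
  exact (PB.const _).sub (I.pbU T)

lemma pbNu (I : ItoD S x0 y0 X Y u) {T : ℝ} (hT : 0 ≤ T) : PB S.P T (nuD S X Y u) := by
  have := S.isProb
  have h := I.pbL hT (((EL2.exp 1 (p := 1) (q := -1) (by simp) (by simp))).congr (g := fun x y => Real.exp (x - y))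
    (fun x y => by ring_nf))
  exact (PB.const _).add (((I.pbU T).mul h).const_mul S.ρ)

/-- increments -/
lemma incX (I : ItoD S x0 y0 X Y u) {T : ℝ} (i : Ix T) : ∀ᵐ ω ∂S.P,
    X i.t ω - X i.s ω = (∫ r in i.s..i.t, muD S u r ω) + S.β₁ * (S.W1 i.t ω - S.W1 i.s ω) := by
  have := S.isProb
  filter_upwards [I.eqX, (I.pbMu T).ae_int le_rfl i.s0 (i.st.le.trans i.tT),
    (I.pbMu T).ae_int i.s0 i.st.le i.tT] with ω h h1 h2
  rw [h _ i.s0, h _ (i.s0.trans i.st.le), ← intervalIntegral.integral_add_adjacent_intervals h1 h2]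
  ring

lemma incY (I : ItoD S x0 y0 X Y u) {T : ℝ} (hT : 0 ≤ T) (i : Ix T) : ∀ᵐ ω ∂S.P,
    Y i.t ω - Y i.s ω = (∫ r in i.s..i.t, nuD S X Y u r ω) + S.β₂ * (S.W2 i.t ω - S.W2 i.s ω) := by
  have := S.isProb
  filter_upwards [I.eqY, (I.pbNu hT).ae_int le_rfl i.s0 (i.st.le.trans i.tT),
    (I.pbNu hT).ae_int i.s0 i.st.le i.tT] with ω h h1 h2
  rw [h _ i.s0, h _ (i.s0.trans i.st.le), ← intervalIntegral.integral_add_adjacent_intervals h1 h2]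
  ring

end ItoD
end HabitModel

namespace HabitModel
open Filter Topology
variable {Ω : Type*} [mΩ : MeasurableSpace Ω]

namespace ItoD
variable {S : Setting Ω} {x0 y0 : ℝ} {X Y u : ℝ → Ω → ℝ}

lemma Ixq_le {T : ℝ} (i : Ix T) : i.q ≤ √T := sqrt_le_sqrt i.d_le

lemma mbIncX (I : ItoD S x0 y0 X Y u) (T : ℝ) :
    MB S.P (fun (i : Ix T) ω => (X i.t ω - X i.s ω) / i.q) := by
  have := S.isProb
  refine (((I.pbMu T).avg.abs.const_mul √T).add ((MB_incr S.bm1 T).abs.const_mul S.β₁)).dom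
    (fun i => Measurable.aestronglyMeasurable ?_) fun i => ?_
  · exact ((I.mX.comp measurable_prodMk_left).sub (I.mX.comp measurable_prodMk_left)).div_const _
  · filter_upwards [I.incX i] with ω h
    rw [h]
    have hq := i.q_pos
    have hqq := i.q_sq
    have hd := i.d_pos
    have e : ((∫ r in i.s..i.t, muD S u r ω) + S.β₁ * (S.W1 i.t ω - S.W1 i.s ω)) / i.q =
      i.q * ((∫ r in i.s..i.t, muD S u r ω) / i.d) + S.β₁ * ((S.W1 i.t ω - S.W1 i.s ω) / i.q) := by
      rw [← hqq]; field_simp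
    rw [e]
    refine (abs_add_le _ _).trans (le_trans ?_ (le_abs_self _))
    rw [abs_mul, abs_mul, abs_of_pos hq, abs_of_pos S.hβ₁]
    gcongr
    exact Ixq_le i

lemma mbIncY (I : ItoD S x0 y0 X Y u) {T : ℝ} (hT : 0 ≤ T) :
    MB S.P (fun (i : Ix T) ω => (Y i.t ω - Y i.s ω) / i.q) := by
  have := S.isProb
  refine (((I.pbNu hT).avg.abs.const_mul √T).add ((MB_incr S.bm2 T).abs.const_mul S.β₂)).dom
    (fun i => Measurable.aestronglyMeasurable ?_) fun i => ?_
  · exact ((I.mY.comp measurable_prodMk_left).sub (I.mY.comp measurable_prodMk_left)).div_const _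
  · filter_upwards [I.incY hT i] with ω h
    rw [h]
    have hq := i.q_pos
    have hqq := i.q_sq
    have hd := i.d_pos
    have e : ((∫ r in i.s..i.t, nuD S X Y u r ω) + S.β₂ * (S.W2 i.t ω - S.W2 i.s ω)) / i.q =
      i.q * ((∫ r in i.s..i.t, nuD S X Y u r ω) / i.d) + S.β₂ * ((S.W2 i.t ω - S.W2 i.s ω) / i.q) := by
      rw [← hqq]; field_simp
    rw [e]
    refine (abs_add_le _ _).trans (le_trans ?_ (le_abs_self _))
    rw [abs_mul, abs_mul, abs_of_pos hq, abs_of_pos S.hβ₂]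
    gcongr
    exact Ixq_le i

/-- `[0,T]` indices from `Ix` -/
def _root_.HabitModel.Ix.js {T : ℝ} (i : Ix T) : Icc (0:ℝ) T := ⟨i.s, i.s0, i.st.le.trans i.tT⟩
def _root_.HabitModel.Ix.jt {T : ℝ} (i : Ix T) : Icc (0:ℝ) T := ⟨i.t, i.s0.trans i.st.le, i.tT⟩

lemma mbE4 (I : ItoD S x0 y0 X Y u) {T : ℝ} (hT : 0 ≤ T) {c : ℝ} (hc : 0 ≤ c) :
    MB S.P (fun (i : Ix T) ω => exp (c * (|X i.s ω| + |Y i.s ω| + |X i.t ω| + |Y i.t ω|))) := by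
  have h := ((I.pbE hT hc).mb.reindex Ix.js).mul ((I.pbE hT hc).mb.reindex Ix.jt)
  refine h.dom (fun i => Measurable.aestronglyMeasurable ?_) fun i => Eventually.of_forall fun ω => le_of_eq ?_
  · have h1 : ∀ r, Measurable (X r) := fun r => I.mX.comp measurable_prodMk_left
    have h2 : ∀ r, Measurable (Y r) := fun r => I.mY.comp measurable_prodMk_left
    have := h1 i.s; have := h1 i.t; have := h2 i.s; have := h2 i.t
    fun_prop
  · simp only [Ix.js, Ix.jt]
    rw [← exp_add]; congr 2; ring

lemma mbIncF (I : ItoD S x0 y0 X Y u) {T : ℝ} (hT : 0 ≤ T) {f : ℝ → ℝ → ℝ} (hf : EL2 f) :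
    MB S.P (fun (i : Ix T) ω => (f (X i.t ω) (Y i.t ω) - f (X i.s ω) (Y i.s ω)) / i.q) := by
  have := S.isProb
  have hm := (I.pbL hT hf)
  obtain ⟨C, hC, h⟩ := hf
  refine (((I.mbE4 hT hC).const_mul C).mul ((I.mbIncX T).abs.add (I.mbIncY hT).abs)).dom
    (fun i => (((hm.sec _).sub (hm.sec _)).div_const _).aestronglyMeasurable) fun i => Eventually.of_forall fun ω => ?_
  refine le_trans ?_ (le_abs_self _)
  rw [abs_div, abs_div, abs_div, abs_of_pos i.q_pos, ← add_div, ← mul_div_assoc]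
  have hq := i.q_pos
  gcongr
  refine (h _ _ _ _).trans (le_of_eq ?_)
  congr 3; ring

/-- generator along the path -/
def gen (S : Setting Ω) (X Y u : ℝ → Ω → ℝ) (gx gy gxx gyy : ℝ → ℝ → ℝ) (r : ℝ) (ω : Ω) : ℝ :=
  muD S u r ω * gx (X r ω) (Y r ω) + nuD S X Y u r ω * gy (X r ω) (Y r ω) +
  S.β₁^2/2 * gxx (X r ω) (Y r ω) + S.β₂^2/2 * gyy (X r ω) (Y r ω)

variable {g gx gy gxx gxy gyy : ℝ → ℝ → ℝ}

lemma pbGen (I : ItoD S x0 y0 X Y u) (G : G2 g gx gy gxx gxy gyy) {T : ℝ} (hT : 0 ≤ T) :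
    PB S.P T (gen S X Y u gx gy gxx gyy) := by
  have := S.isProb
  exact ((((I.pbMu T).mul (I.pbL hT G.ex)).add ((I.pbNu hT).mul (I.pbL hT G.ey))).add
    ((I.pbL hT G.exx).const_mul _)).add ((I.pbL hT G.eyy).const_mul _)

/-- generator difference with coefficients frozen at `s` -/
def genD (S : Setting Ω) (X Y u : ℝ → Ω → ℝ) (gx gy gxx gyy : ℝ → ℝ → ℝ) (s r : ℝ) (ω : Ω) : ℝ :=
  muD S u r ω * (gx (X r ω) (Y r ω) - gx (X s ω) (Y s ω)) +
  nuD S X Y u r ω * (gy (X r ω) (Y r ω) - gy (X s ω) (Y s ω)) +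
  S.β₁^2/2 * (gxx (X r ω) (Y r ω) - gxx (X s ω) (Y s ω)) +
  S.β₂^2/2 * (gyy (X r ω) (Y r ω) - gyy (X s ω) (Y s ω))

lemma pbFix (I : ItoD S x0 y0 X Y u) {T : ℝ} (hT : 0 ≤ T) {f : ℝ → ℝ → ℝ} (hf : EL2 f) {s : ℝ}
    (hs : s ∈ Icc (0:ℝ) T) : PB S.P T (fun _ ω => f (X s ω) (Y s ω)) := by
  have := S.isProb
  exact ⟨((I.pbL hT hf).sec s).comp measurable_snd, (I.pbL hT hf).mb.reindex (fun _ => (⟨s, hs⟩ : Icc (0:ℝ) T))⟩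

lemma pbGenD (I : ItoD S x0 y0 X Y u) (G : G2 g gx gy gxx gxy gyy) {T : ℝ} (hT : 0 ≤ T) {s : ℝ}
    (hs : s ∈ Icc (0:ℝ) T) : PB S.P T (genD S X Y u gx gy gxx gyy s) := by
  have := S.isProb
  exact ((((I.pbMu T).mul ((I.pbL hT G.ex).sub (I.pbFix hT G.ex hs))).add
    ((I.pbNu hT).mul ((I.pbL hT G.ey).sub (I.pbFix hT G.ey hs)))).add
    (((I.pbL hT G.exx).sub (I.pbFix hT G.exx hs)).const_mul _)).add
    (((I.pbL hT G.eyy).sub (I.pbFix hT G.eyy hs)).const_mul _)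

lemma genD_bound (I : ItoD S x0 y0 X Y u) (G : G2 g gx gy gxx gxy gyy) {T : ℝ} (hT : 0 ≤ T) :
    ∃ K, 0 ≤ K ∧ ∀ s t, 0 ≤ s → s < t → t ≤ T →
      |∫ r in s..t, ∫ ω, genD S X Y u gx gy gxx gyy s r ω ∂S.P| ≤ K * ((t-s) * √(t-s)) := by
  have := S.isProb
  have hm : MB S.P (fun (i : Ix T) ω => genD S X Y u gx gy gxx gyy i.s i.t ω / i.q) := by
    refine ((((((I.pbMu T).mb.reindex Ix.jt).mul (I.mbIncF hT G.ex)).add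
      (((I.pbNu hT).mb.reindex Ix.jt).mul (I.mbIncF hT G.ey))).add
      ((I.mbIncF hT G.exx).const_mul (S.β₁^2/2))).add
      ((I.mbIncF hT G.eyy).const_mul (S.β₂^2/2))).dom
      (fun i => (((I.pbGenD G hT i.js.2).sec i.t).div_const _).aestronglyMeasurable)
      fun i => Eventually.of_forall fun ω => le_of_eq ?_
    simp only [Ix.jt, genD]
    congr 1
    ring
  obtain ⟨K, hK, hb⟩ := hm.bound
  refine ⟨K, hK, fun s t hs hst ht => ?_⟩
  have := intervalIntegral.norm_integral_le_of_norm_le_const (a := s) (b := t)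
    (f := fun r => ∫ ω, genD S X Y u gx gy gxx gyy s r ω ∂S.P) (C := K * √(t-s)) (fun r hr => by
      rw [uIoc_of_le hst.le] at hr
      have h1 := hb ⟨(s, r), hs, hr.1, hr.2.trans ht⟩
      simp only [Ix.s, Ix.t, Ix.q] at h1
      rw [integral_div, abs_div, abs_of_nonneg (sqrt_nonneg _), div_le_iff₀ (sqrt_pos.2 (sub_pos.2 hr.1))] at h1
      refine h1.trans ?_
      gcongr
      exact hr.2)
  rw [Real.norm_eq_abs, abs_of_pos (sub_pos.2 hst)] at this
  refine this.trans (le_of_eq ?_)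
  ring

end ItoD
end HabitModel

namespace HabitModel
open Filter Topology
variable {Ω : Type*} [mΩ : MeasurableSpace Ω]

lemma MB.q_mul {P : Measure Ω} [IsProbabilityMeasure P] {T : ℝ} {Z : Ix T → Ω → ℝ} (h : MB P Z) :
    MB P (fun i ω => i.q * Z i ω) := by
  refine (h.const_mul √T).dom (fun i => ((h.integrable i).const_mul i.q).aestronglyMeasurable)
    fun i => Eventually.of_forall fun ω => ?_
  rw [abs_mul, abs_mul, abs_of_pos i.q_pos, abs_of_nonneg (sqrt_nonneg _)]
  gcongr
  exact ItoD.Ixq_le i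

namespace ItoD
variable {S : Setting Ω} {x0 y0 : ℝ} {X Y u : ℝ → Ω → ℝ}
variable {g gx gy gxx gxy gyy : ℝ → ℝ → ℝ}

lemma mbT2 (I : ItoD S x0 y0 X Y u) (G : G2 g gx gy gxx gxy gyy) {T : ℝ} (hT : 0 ≤ T) :
    MB S.P (fun (i : Ix T) ω => (g (X i.t ω) (Y i.t ω) - g (X i.s ω) (Y i.s ω)
      - ((X i.t ω - X i.s ω) * gx (X i.s ω) (Y i.s ω) + (Y i.t ω - Y i.s ω) * gy (X i.s ω) (Y i.s ω))
      - ((X i.t ω - X i.s ω)^2 * gxx (X i.s ω) (Y i.s ω)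
        + 2 * ((X i.t ω - X i.s ω) * (Y i.t ω - Y i.s ω)) * gxy (X i.s ω) (Y i.s ω)
        + (Y i.t ω - Y i.s ω)^2 * gyy (X i.s ω) (Y i.s ω)) / 2) / i.q^3) := by
  have := S.isProb
  obtain ⟨C, hC, h⟩ := G.taylor
  refine (((I.mbE4 hT hC).const_mul C).mul (((I.mbIncX T).abs.add (I.mbIncY hT).abs).pow 3)).dom
    (fun i => Measurable.aestronglyMeasurable ?_) fun i => Eventually.of_forall fun ω => ?_
  · have h1 : ∀ r, Measurable (X r) := fun r => I.mX.comp measurable_prodMk_left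
    have h2 : ∀ r, Measurable (Y r) := fun r => I.mY.comp measurable_prodMk_left
    have aux : ∀ A B a b c d e f k : Ω → ℝ, Measurable A → Measurable B → Measurable a → Measurable b →
      Measurable c → Measurable d → Measurable e → Measurable f → Measurable k →
      Measurable (fun ω => (A ω - B ω - (a ω * c ω + b ω * d ω) - (a ω ^ 2 * e ω +
        2 * (a ω * b ω) * f ω + b ω ^ 2 * k ω) / 2) / i.q ^ 3) := by
      intros; fun_prop
    exact aux _ _ (fun ω => X i.t ω - X i.s ω) (fun ω => Y i.t ω - Y i.s ω) _ _ _ _ _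
      ((I.pbL hT G.e0).sec i.t) ((I.pbL hT G.e0).sec i.s) ((h1 _).sub (h1 _)) ((h2 _).sub (h2 _))
      ((I.pbL hT G.ex).sec i.s) ((I.pbL hT G.ey).sec i.s) ((I.pbL hT G.exx).sec i.s)
      ((I.pbL hT G.exy).sec i.s) ((I.pbL hT G.eyy).sec i.s)
  · refine le_trans ?_ (le_abs_self _)
    have hq := i.q_pos
    rw [abs_div, abs_div, abs_div, abs_of_pos (pow_pos hq 3), abs_of_pos hq, ← add_div, div_pow,
      ← mul_div_assoc]
    gcongr
    exact h _ _ _ _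

/-- martingale part -/
def mart (S : Setting Ω) (X Y : ℝ → Ω → ℝ) (gx gy gxx gxy gyy : ℝ → ℝ → ℝ) (s t : ℝ) (ω : Ω) : ℝ :=
  gx (X s ω) (Y s ω) * (S.W1 t ω - S.W1 s ω) * S.β₁ + gy (X s ω) (Y s ω) * (S.W2 t ω - S.W2 s ω) * S.β₂
  + (gxx (X s ω) (Y s ω) * (S.W1 t ω - S.W1 s ω)^2 - (t - s) * gxx (X s ω) (Y s ω)) * (S.β₁^2/2)
  + gxy (X s ω) (Y s ω) * ((S.W1 t ω - S.W1 s ω) * (S.W2 t ω - S.W2 s ω)) * (S.β₁ * S.β₂)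
  + (gyy (X s ω) (Y s ω) * (S.W2 t ω - S.W2 s ω)^2 - (t - s) * gyy (X s ω) (Y s ω)) * (S.β₂^2/2)

lemma mart_int (I : ItoD S x0 y0 X Y u) (G : G2 g gx gy gxx gxy gyy) {s t : ℝ} (hs : 0 ≤ s) (hst : s ≤ t) :
    Integrable (mart S X Y gx gy gxx gxy gyy s t) S.P ∧ ∫ ω, mart S X Y gx gy gxx gxy gyy s t ω ∂S.P = 0 := by
  have := S.isProb
  have mbf : ∀ {f : ℝ → ℝ → ℝ}, EL2 f → MB S.P (fun (_:Unit) ω => f (X s ω) (Y s ω)) := fun hf =>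
    (I.pbL hs hf).mb.reindex (fun _ => (⟨s, hs, le_rfl⟩ : Icc (0:ℝ) s))
  have adf : ∀ {f : ℝ → ℝ → ℝ}, EL2 f → Measurable[S.F s] (fun ω => f (X s ω) (Y s ω)) := fun hf =>
    hf.cont.measurable.comp ((I.adX s hs).prodMk (I.adY s hs))
  have w1 := MB1_incr S.bm1 hs hst
  have w2 := MB1_incr S.bm2 hs hst
  have i1 : Integrable (fun ω => gx (X s ω) (Y s ω) * (S.W1 t ω - S.W1 s ω) * S.β₁) S.P :=
    (((mbf G.ex).mul w1).integrable ()).mul_const _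
  have i2 : Integrable (fun ω => gy (X s ω) (Y s ω) * (S.W2 t ω - S.W2 s ω) * S.β₂) S.P :=
    (((mbf G.ey).mul w2).integrable ()).mul_const _
  have j3 : Integrable (fun ω => gxx (X s ω) (Y s ω) * (S.W1 t ω - S.W1 s ω)^2) S.P :=
    (((mbf G.exx).mul (w1.pow 2)).integrable ())
  have j3' : Integrable (fun ω => (t - s) * gxx (X s ω) (Y s ω)) S.P :=
    (((mbf G.exx)).integrable ()).const_mul _
  have j5 : Integrable (fun ω => gyy (X s ω) (Y s ω) * (S.W2 t ω - S.W2 s ω)^2) S.P :=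
    (((mbf G.eyy).mul (w2.pow 2)).integrable ())
  have j5' : Integrable (fun ω => (t - s) * gyy (X s ω) (Y s ω)) S.P :=
    (((mbf G.eyy)).integrable ()).const_mul _
  have i3 : Integrable (fun ω => (gxx (X s ω) (Y s ω) * (S.W1 t ω - S.W1 s ω)^2 - (t - s) * gxx (X s ω) (Y s ω)) * (S.β₁^2/2)) S.P :=
    (Integrable.sub (f := fun ω => gxx (X s ω) (Y s ω) * (S.W1 t ω - S.W1 s ω)^2) j3 j3').mul_const _
  have i4 : Integrable (fun ω => gxy (X s ω) (Y s ω) * ((S.W1 t ω - S.W1 s ω) * (S.W2 t ω - S.W2 s ω)) * (S.β₁ * S.β₂)) S.P :=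
    (((mbf G.exy).mul (w1.mul w2)).integrable ()).mul_const _
  have i5 : Integrable (fun ω => (gyy (X s ω) (Y s ω) * (S.W2 t ω - S.W2 s ω)^2 - (t - s) * gyy (X s ω) (Y s ω)) * (S.β₂^2/2)) S.P :=
    (Integrable.sub (f := fun ω => gyy (X s ω) (Y s ω) * (S.W2 t ω - S.W2 s ω)^2) j5 j5').mul_const _
  refine ⟨(((i1.fun_add i2).fun_add i3).fun_add i4).fun_add i5, ?_⟩
  unfold mart
  rw [integral_add (((i1.fun_add i2).fun_add i3).fun_add i4) i5,
    integral_add ((i1.fun_add i2).fun_add i3) i4, integral_add (i1.fun_add i2) i3, integral_add i1 i2,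
    integral_mul_const, integral_mul_const, integral_mul_const, integral_mul_const, integral_mul_const,
    integral_sub j3 j3', integral_sub j5 j5', mul_incr S.bm1 hs hst (adf G.ex), mul_incr S.bm2 hs hst (adf G.ey),
    mul_incr_sq S.bm1 hs hst (adf G.exx), mul_incr_sq S.bm2 hs hst (adf G.eyy),
    cross S hs hst (adf G.exy) (mbf G.exy), integral_const_mul, integral_const_mul]
  ring

/-- quadratic remainder -/
def quad (S : Setting Ω) (X Y u : ℝ → Ω → ℝ) (gxx gxy gyy : ℝ → ℝ → ℝ) (s t : ℝ) (ω : Ω) : ℝ :=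
  ((∫ r in s..t, muD S u r ω)^2 + 2 * (∫ r in s..t, muD S u r ω) * (S.β₁ * (S.W1 t ω - S.W1 s ω)))
    * gxx (X s ω) (Y s ω) / 2 +
  ((∫ r in s..t, muD S u r ω) * (∫ r in s..t, nuD S X Y u r ω)
    + (∫ r in s..t, muD S u r ω) * (S.β₂ * (S.W2 t ω - S.W2 s ω))
    + (∫ r in s..t, nuD S X Y u r ω) * (S.β₁ * (S.W1 t ω - S.W1 s ω))) * gxy (X s ω) (Y s ω) +
  ((∫ r in s..t, nuD S X Y u r ω)^2 + 2 * (∫ r in s..t, nuD S X Y u r ω) * (S.β₂ * (S.W2 t ω - S.W2 s ω)))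
    * gyy (X s ω) (Y s ω) / 2

lemma mbQuad (I : ItoD S x0 y0 X Y u) (G : G2 g gx gy gxx gxy gyy) {T : ℝ} (hT : 0 ≤ T) :
    MB S.P (fun (i : Ix T) ω => quad S X Y u gxx gxy gyy i.s i.t ω / i.q^3) := by
  have := S.isProb
  have a1 := (I.pbMu T).avg
  have a2 := (I.pbNu hT).avg
  have z1 := (MB_incr S.bm1 T).const_mul S.β₁
  have z2 := (MB_incr S.bm2 T).const_mul S.β₂
  have hxx := ((I.pbL hT G.exx).mb.reindex (Ix.js (T := T))).const_mul (1/2)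
  have hxy := ((I.pbL hT G.exy).mb.reindex (Ix.js (T := T)))
  have hyy := ((I.pbL hT G.eyy).mb.reindex (Ix.js (T := T))).const_mul (1/2)
  have H := (((((a1.pow 2).q_mul).add ((a1.mul z1).const_mul 2)).mul hxx).add
    (((((a1.mul a2).q_mul).add (a1.mul z2)).add (a2.mul z1)).mul hxy)).add
    ((((a2.pow 2).q_mul).add ((a2.mul z2).const_mul 2)).mul hyy)
  have e : ∀ (i : Ix T) ω, quad S X Y u gxx gxy gyy i.s i.t ω / i.q^3 = _ := fun i ω => by
    have hq := i.q_pos.ne'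
    show _ = (i.q * ((∫ r in i.s..i.t, muD S u r ω) / i.d)^2 + 2 * (((∫ r in i.s..i.t, muD S u r ω) / i.d) *
      (S.β₁ * ((S.W1 i.t ω - S.W1 i.s ω) / i.q)))) * ((1/2) * gxx (X i.s ω) (Y i.s ω)) +
      (i.q * (((∫ r in i.s..i.t, muD S u r ω) / i.d) * ((∫ r in i.s..i.t, nuD S X Y u r ω) / i.d)) +
      ((∫ r in i.s..i.t, muD S u r ω) / i.d) * (S.β₂ * ((S.W2 i.t ω - S.W2 i.s ω) / i.q)) +
      ((∫ r in i.s..i.t, nuD S X Y u r ω) / i.d) * (S.β₁ * ((S.W1 i.t ω - S.W1 i.s ω) / i.q))) * gxy (X i.s ω) (Y i.s ω) +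
      (i.q * ((∫ r in i.s..i.t, nuD S X Y u r ω) / i.d)^2 + 2 * (((∫ r in i.s..i.t, nuD S X Y u r ω) / i.d) *
      (S.β₂ * ((S.W2 i.t ω - S.W2 i.s ω) / i.q)))) * ((1/2) * gyy (X i.s ω) (Y i.s ω))
    rw [← i.q_sq, quad]
    field_simp
  have e2 : (fun (i : Ix T) ω => quad S X Y u gxx gxy gyy i.s i.t ω / i.q^3) = _ := funext fun i => funext fun ω => e i ω
  rw [e2]
  exact H

lemma dyn_step (I : ItoD S x0 y0 X Y u) (G : G2 g gx gy gxx gxy gyy) {T : ℝ} (hT : 0 ≤ T) :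
    ∃ K, ∀ s t, 0 ≤ s → s < t → t ≤ T →
      |(∫ ω, g (X t ω) (Y t ω) ∂S.P) - (∫ ω, g (X s ω) (Y s ω) ∂S.P) -
        ∫ r in s..t, ∫ ω, gen S X Y u gx gy gxx gyy r ω ∂S.P| ≤ K * ((t-s) * √(t-s)) := by
  have := S.isProb
  have HR := (I.mbT2 G hT).add (I.mbQuad G hT)
  obtain ⟨K1, hK1, hb⟩ := HR.bound
  obtain ⟨K2, hK2, hD⟩ := I.genD_bound G hT
  refine ⟨K1 + K2, fun s t hs hst ht => ?_⟩
  have hsT : s ∈ Icc (0:ℝ) T := ⟨hs, hst.le.trans ht⟩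
  have htT : t ∈ Icc (0:ℝ) T := ⟨hs.trans hst.le, ht⟩
  let i : Ix T := ⟨(s, t), hs, hst, ht⟩
  have hR := HR.integrable i
  have hbi := hb i
  set Z : Ω → ℝ := fun ω => (fun i ω => (g (X i.t ω) (Y i.t ω) - g (X i.s ω) (Y i.s ω)
      - ((X i.t ω - X i.s ω) * gx (X i.s ω) (Y i.s ω) + (Y i.t ω - Y i.s ω) * gy (X i.s ω) (Y i.s ω))
      - ((X i.t ω - X i.s ω)^2 * gxx (X i.s ω) (Y i.s ω)
        + 2 * ((X i.t ω - X i.s ω) * (Y i.t ω - Y i.s ω)) * gxy (X i.s ω) (Y i.s ω)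
        + (Y i.t ω - Y i.s ω)^2 * gyy (X i.s ω) (Y i.s ω)) / 2) / i.q^3 + quad S X Y u gxx gxy gyy i.s i.t ω / i.q^3) i ω with hZ
  obtain ⟨hMi, hM0⟩ := I.mart_int G hs hst.le
  have pg := I.pbGen G hT
  have pd := I.pbGenD G hT hsT
  have p0 := I.pbL hT G.e0
  have sp : ∀ {f : ℝ → Ω → ℝ}, PB S.P T f → Integrable (fun ω => ∫ r in s..t, f r ω) S.P := fun hf => by
    have h := (hf.avg.integrable i).mul_const i.d
    refine h.congr (Eventually.of_forall fun ω => ?_)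
    show (∫ r in i.s..i.t, _) / i.d * i.d = _
    rw [div_mul_cancel₀ _ i.d_pos.ne']; rfl
  have g0t : Integrable (fun ω => g (X t ω) (Y t ω)) S.P := p0.mb.integrable ⟨t, htT⟩
  have g0s : Integrable (fun ω => g (X s ω) (Y s ω)) S.P := p0.mb.integrable ⟨s, hsT⟩
  have key : ∀ᵐ ω ∂S.P, g (X t ω) (Y t ω) - g (X s ω) (Y s ω) - (∫ r in s..t, gen S X Y u gx gy gxx gyy r ω)
      = mart S X Y gx gy gxx gxy gyy s t ω + i.q^3 * Z ω - ∫ r in s..t, genD S X Y u gx gy gxx gyy s r ω := by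
    filter_upwards [I.incX i, I.incY hT i, (I.pbMu T).ae_int hs hst.le ht, (I.pbNu hT).ae_int hs hst.le ht,
      pd.ae_int hs hst.le ht] with ω ha hb hm hn hd
    have e : ∀ r, gen S X Y u gx gy gxx gyy r ω = genD S X Y u gx gy gxx gyy s r ω + (
      muD S u r ω * gx (X s ω) (Y s ω) + nuD S X Y u r ω * gy (X s ω) (Y s ω) +
      (S.β₁^2/2 * gxx (X s ω) (Y s ω) + S.β₂^2/2 * gyy (X s ω) (Y s ω))) := fun r => by
        unfold gen genD; ring
    have e2 : (∫ r in s..t, gen S X Y u gx gy gxx gyy r ω) = (∫ r in s..t, genD S X Y u gx gy gxx gyy s r ω) +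
      ((∫ r in s..t, muD S u r ω) * gx (X s ω) (Y s ω) + (∫ r in s..t, nuD S X Y u r ω) * gy (X s ω) (Y s ω) +
      (t - s) * (S.β₁^2/2 * gxx (X s ω) (Y s ω) + S.β₂^2/2 * gyy (X s ω) (Y s ω))) := by
      simp_rw [e]
      rw [intervalIntegral.integral_add hd (((hm.mul_const _).add (hn.mul_const _)).add intervalIntegrable_const),
        intervalIntegral.integral_add ((hm.mul_const _).add (hn.mul_const _)) intervalIntegrable_const,
        intervalIntegral.integral_add (hm.mul_const _) (hn.mul_const _), intervalIntegral.integral_mul_const,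
        intervalIntegral.integral_mul_const, intervalIntegral.integral_const, smul_eq_mul]
    rw [e2, hZ]
    change X t ω - X s ω = (∫ r in s..t, muD S u r ω) + S.β₁ * (S.W1 t ω - S.W1 s ω) at ha
    change Y t ω - Y s ω = (∫ r in s..t, nuD S X Y u r ω) + S.β₂ * (S.W2 t ω - S.W2 s ω) at hb
    have hq : i.q^3 ≠ 0 := (pow_pos i.q_pos 3).ne'
    simp only []
    rw [← add_div, mul_div_cancel₀ _ hq]
    change _ = _ + ((g (X t ω) (Y t ω) - g (X s ω) (Y s ω)
      - ((X t ω - X s ω) * gx (X s ω) (Y s ω) + (Y t ω - Y s ω) * gy (X s ω) (Y s ω))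
      - ((X t ω - X s ω)^2 * gxx (X s ω) (Y s ω)
        + 2 * ((X t ω - X s ω) * (Y t ω - Y s ω)) * gxy (X s ω) (Y s ω)
        + (Y t ω - Y s ω)^2 * gyy (X s ω) (Y s ω)) / 2) + quad S X Y u gxx gxy gyy s t ω) - _
    rw [ha, hb, mart, quad]
    ring
  have e3 := integral_congr_ae key
  rw [integral_sub (f := fun ω => g (X t ω) (Y t ω) - g (X s ω) (Y s ω)) (g0t.sub g0s) (sp pg), integral_sub g0t g0s,
    integral_sub (f := fun ω => mart S X Y gx gy gxx gxy gyy s t ω + i.q^3 * Z ω) (hMi.add (hR.const_mul _)) (sp pd), integral_add hMi (hR.const_mul _), hM0,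
    integral_const_mul, pg.swap hs hst.le ht, pd.swap hs hst.le ht] at e3
  rw [e3, zero_add]
  refine (abs_sub _ _).trans ?_
  rw [add_mul]
  refine add_le_add ?_ (hD s t hs hst ht)
  rw [abs_mul, abs_of_pos (pow_pos i.q_pos 3), mul_comm]
  have : i.q^3 = (t-s) * √(t-s) := by
    rw [pow_succ, i.q_sq]; rfl
  rw [this]
  gcongr

/-- Dynkin formula -/
lemma dynkin (I : ItoD S x0 y0 X Y u) (G : G2 g gx gy gxx gxy gyy) {T : ℝ} (hT : 0 ≤ T) :
    exp (-S.θ*T) * ∫ ω, g (X T ω) (Y T ω) ∂S.P = g x0 y0 + ∫ r in (0:ℝ)..T, exp (-S.θ*r) *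
      (-S.θ * (∫ ω, g (X r ω) (Y r ω) ∂S.P) + ∫ ω, gen S X Y u gx gy gxx gyy r ω ∂S.P) := by
  have := S.isProb
  have h0 : ∫ ω, g (X 0 ω) (Y 0 ω) ∂S.P = g x0 y0 := by
    have : ∀ᵐ ω ∂S.P, g (X 0 ω) (Y 0 ω) = g x0 y0 := by
      filter_upwards [I.eqX, I.eqY] with ω h1 h2
      rw [h1 0 le_rfl, h2 0 le_rfl]
      simp [S.bm1.init ω, S.bm2.init ω]
    rw [integral_congr_ae this]; simp
  have pg := I.pbGen G hT
  have hl := pg.intervalIntegrable le_rfl hT le_rfl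
  have := discount (θ := S.θ) (m := fun r => ∫ ω, g (X r ω) (Y r ω) ∂S.P)
    (l := fun r => ∫ ω, gen S X Y u gx gy gxx gyy r ω ∂S.P) hT hl (fun t ht => ?_)
  · simp only [h0] at this
    exact this
  · obtain ⟨K, hK⟩ := I.dyn_step G ht.1
    have := const_of_holder (n := fun t => (∫ ω, g (X t ω) (Y t ω) ∂S.P) -
      ∫ r in (0:ℝ)..t, ∫ ω, gen S X Y u gx gy gxx gyy r ω ∂S.P) (K := K) ht.1 (fun s r hs hr hrt => by
        have h := hK s r hs hr hrt
        refine le_trans (le_of_eq ?_) h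
        congr 1
        have a1 := (I.pbGen G ht.1).intervalIntegrable le_rfl hs (hr.le.trans hrt)
        have a2 := (I.pbGen G ht.1).intervalIntegrable hs hr.le hrt
        rw [← intervalIntegral.integral_add_adjacent_intervals a1 a2]
        ring)
    simp only [intervalIntegral.integral_same, sub_zero] at this
    linarith

end ItoD
end HabitModel

namespace HabitModel
open Filter Topology

lemma G2.ofz (m : ℝ) {ψ ψ1 ψ2 : ℝ → ℝ} (h0 : ∀ z, HasDerivAt ψ (ψ1 z) z) (h1 : ∀ z, HasDerivAt ψ1 (ψ2 z) z)
    (e0 : EL2 fun x y => ψ (y - x)) (e1 : EL2 fun x y => ψ1 (y - x)) (e2 : EL2 fun x y => ψ2 (y - x)) :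
    G2 (fun x y => exp (-m*x) * ψ (y-x))
      (fun x y => exp (-m*x) * (-m * ψ (y-x) - ψ1 (y-x)))
      (fun x y => exp (-m*x) * ψ1 (y-x))
      (fun x y => exp (-m*x) * (m^2 * ψ (y-x) + 2 * m * ψ1 (y-x) + ψ2 (y-x)))
      (fun x y => exp (-m*x) * (-m * ψ1 (y-x) - ψ2 (y-x)))
      (fun x y => exp (-m*x) * ψ2 (y-x)) := by
  have dz : ∀ x y a b τ : ℝ, HasDerivAt (fun τ : ℝ => y + τ * b - (x + τ * a)) (b - a) τ := fun x y a b τ => by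
    have := (((hasDerivAt_id τ).mul_const b).const_add y).fun_sub (((hasDerivAt_id τ).mul_const a).const_add x)
    exact this.congr_deriv (by simp)
  have de : ∀ x a τ : ℝ, HasDerivAt (fun τ : ℝ => exp (-m*(x + τ*a))) (exp (-m*(x+τ*a)) * (-m*a)) τ := fun x a τ => by
    have := ((((hasDerivAt_id τ).mul_const a).const_add x).const_mul (-m)).exp
    exact this.congr_deriv (by simp)
  have c0 := fun x y a b τ => (h0 (y + τ * b - (x + τ * a))).comp τ (dz x y a b τ)
  have c1 := fun x y a b τ => (h1 (y + τ * b - (x + τ * a))).comp τ (dz x y a b τ)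
  have ee : EL2 (fun x _ => exp (-m*x)) := (EL2.exp (-m) (p := 1) (q := 0) (by simp) (by simp)).congr fun x y => by ring_nf
  refine ⟨fun x y a b τ => ?_, fun x y a b τ => ?_, fun x y a b τ => ?_, ee.mul e0, ?_, ee.mul e1, ?_, ?_, ee.mul e2⟩
  · exact ((de x a τ).mul (c0 x y a b τ)).congr_deriv (by simp only [Function.comp]; ring)
  · exact ((de x a τ).mul (((c0 x y a b τ).const_mul (-m)).sub (c1 x y a b τ))).congr_deriv
      (by simp [Function.comp]; ring)
  · exact ((de x a τ).mul (c1 x y a b τ)).congr_deriv (by simp only [Function.comp]; ring)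
  · exact (ee.mul ((e0.const_mul (-m)).add (e1.const_mul (-1)))).congr fun x y => by ring
  · exact (ee.mul (((e0.const_mul (m^2)).add (e1.const_mul (2*m))).add e2)).congr fun x y => by ring
  · exact (ee.mul ((e1.const_mul (-m)).add (e2.const_mul (-1)))).congr fun x y => by ring

namespace OP
variable (p : OP)

lemma uO_negb (z q : ℝ) : (p.uO z q) ^ (-p.b) ≤ 1 + p.R ^ (-(p.b+1)) + |q| * exp (-p.a*z) := by
  have hu := p.uO_pos z q
  have h1 : (p.uO z q) ^ (-p.b) ≤ 1 + (p.uO z q) ^ (-(p.b+1)) := by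
    rcases le_total 1 (p.uO z q) with h | h
    · have := rpow_le_one_of_one_le_of_nonpos h (by linarith [p.hb] : -p.b ≤ 0)
      have := rpow_pos_of_pos hu (-(p.b+1))
      linarith
    · have := rpow_le_rpow_of_exponent_ge hu h (by linarith : -(p.b+1) ≤ -p.b)
      linarith
  rw [p.uO_rpow] at h1
  have h2 : max (p.R ^ (-(p.b+1))) (q * exp (-p.a*z)) ≤ p.R ^ (-(p.b+1)) + |q| * exp (-p.a*z) := by
    have := rpow_pos_of_pos p.hR (-(p.b+1))
    have h3 : q * exp (-p.a*z) ≤ |q| * exp (-p.a*z) := by gcongr; exact le_abs_self q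
    have h4 : 0 ≤ |q| * exp (-p.a*z) := by positivity
    exact max_le (by linarith) (by linarith)
  linarith

lemma Hm_env (z z' q : ℝ) : p.Hm z q - p.Hm z' q ≤ p.b⁻¹ * |exp (p.a*z) - exp (p.a*z')| *
    (1 + p.R ^ (-(p.b+1)) + |q| * exp (-p.a*z')) := by
  have h := p.Hm_le z q (p.uO z' q) (p.uO_pos _ _) (p.uO_le _ _)
  have hb := inv_pos.2 p.hb
  have e : p.Hm z' q = p.uO z' q * q + p.b⁻¹ * exp (p.a*z') * p.uO z' q ^ (-p.b) := rfl
  have hp := rpow_pos_of_pos (p.uO_pos z' q) (-p.b)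
  calc p.Hm z q - p.Hm z' q ≤ p.b⁻¹ * (exp (p.a*z) - exp (p.a*z')) * p.uO z' q ^ (-p.b) := by
        rw [e]; linarith
    _ ≤ p.b⁻¹ * |exp (p.a*z) - exp (p.a*z')| * p.uO z' q ^ (-p.b) := by gcongr; exact le_abs_self _
    _ ≤ _ := by gcongr; exact p.uO_negb z' q

lemma Hm_EL {Q : ℝ → ℝ → ℝ} (hQ : EL2 Q) : EL2 (fun x y => p.Hm (y - x) (Q x y)) := by
  have hE : EL2 (fun x y => exp (p.a * (y - x))) :=
    (EL2.exp p.a (p := -1) (q := 1) (by simp) (by simp)).congr fun x y => by ring_nf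
  have hE' : EL2 (fun x y => exp (-p.a * (y - x))) :=
    (EL2.exp (-p.a) (p := -1) (q := 1) (by simp) (by simp)).congr fun x y => by ring_nf
  obtain ⟨C1, hC1, h1⟩ := hQ
  obtain ⟨C2, hC2, h2⟩ := hE
  obtain ⟨C3, hC3, h3⟩ := EL2.growth ⟨C1, hC1, h1⟩
  obtain ⟨C4, hC4, h4⟩ := hE'.growth
  have hR := p.hR
  have hR2 := rpow_pos_of_pos p.hR (-(p.b+1))
  have hb := inv_pos.2 p.hb
  set r2 := p.R ^ (-(p.b+1))
  set K := p.R * C1 + p.b⁻¹ * C2 * (1 + r2 + C3 * C4) + (C1 + C2 + C3 + C4) with hK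
  have hK0 : 0 ≤ K := by positivity
  refine ⟨K, hK0, fun x y x' y' => ?_⟩
  have hN : 0 ≤ |x| + |y| + |x'| + |y'| := by positivity
  have hN1 : |x| + |y| ≤ |x| + |y| + |x'| + |y'| := by linarith [abs_nonneg x', abs_nonneg y']
  have hN2 : |x'| + |y'| ≤ |x| + |y| + |x'| + |y'| := by linarith [abs_nonneg x, abs_nonneg y]
  set N := |x| + |y| + |x'| + |y'|
  set δ := |x - x'| + |y - y'|
  have hδ : 0 ≤ δ := by positivity
  have a1 := p.Hm_lip (y - x) (Q x y) (Q x' y')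
  have g : ∀ z : ℝ, ∀ s t : ℝ, |s| + |t| ≤ N → z = t - s →
      1 + r2 + |Q x' y'| * exp (-p.a * z) ≤ (1 + r2 + C3 * C4) * exp ((C3 + C4) * N) := by
    intro z s t hst hz
    have b1 : |Q x' y'| ≤ C3 * exp (C3 * N) := (h3 x' y').trans (by gcongr)
    have b2 : exp (-p.a * z) ≤ C4 * exp (C4 * N) := by
      have := (le_abs_self _).trans (h4 s t)
      rw [hz]; exact this.trans (by gcongr)
    have b3 : |Q x' y'| * exp (-p.a * z) ≤ (C3 * exp (C3 * N)) * (C4 * exp (C4 * N)) := by gcongr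
    have b4 : (C3 * exp (C3 * N)) * (C4 * exp (C4 * N)) = C3 * C4 * exp ((C3 + C4) * N) := by
      rw [add_mul, exp_add]; ring
    have b5 : 1 ≤ exp ((C3 + C4) * N) := one_le_exp (by positivity)
    nlinarith
  have a2 : |p.Hm (y - x) (Q x' y') - p.Hm (y' - x') (Q x' y')| ≤
      p.b⁻¹ * (C2 * exp (C2 * N) * δ) * ((1 + r2 + C3 * C4) * exp ((C3 + C4) * N)) := by
    have hd := h2 x y x' y'
    rw [abs_sub_le_iff]
    constructor
    · refine (p.Hm_env _ _ _).trans ?_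
      exact mul_le_mul (by gcongr) (g _ x' y' hN2 rfl) (by positivity) (by positivity)
    · refine (p.Hm_env _ _ _).trans ?_
      rw [abs_sub_comm]
      exact mul_le_mul (by gcongr) (g _ x y hN1 rfl) (by positivity) (by positivity)
  have a3 := h1 x y x' y'
  have t := abs_sub_le (p.Hm (y-x) (Q x y)) (p.Hm (y-x) (Q x' y')) (p.Hm (y'-x') (Q x' y'))
  have c1 : exp (C1 * N) ≤ exp (K * N) := exp_le_exp.2 (by
    refine mul_le_mul_of_nonneg_right ?_ hN
    have : 0 ≤ p.R * C1 + p.b⁻¹ * C2 * (1 + r2 + C3 * C4) := by positivity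
    linarith)
  have c2 : exp (C2 * N) * exp ((C3 + C4) * N) ≤ exp (K * N) := by
    rw [← exp_add, ← add_mul]
    refine exp_le_exp.2 (mul_le_mul_of_nonneg_right ?_ hN)
    have : 0 ≤ p.R * C1 + p.b⁻¹ * C2 * (1 + r2 + C3 * C4) := by positivity
    linarith
  calc _ ≤ _ := t
    _ ≤ p.R * (C1 * exp (C1 * N) * δ) +
      p.b⁻¹ * (C2 * exp (C2 * N) * δ) * ((1 + r2 + C3 * C4) * exp ((C3 + C4) * N)) :=
        add_le_add (a1.trans (by gcongr)) a2
    _ = (p.R * C1) * exp (C1 * N) * δ + (p.b⁻¹ * C2 * (1 + r2 + C3 * C4)) * (exp (C2 * N) * exp ((C3 + C4) * N)) * δ := by ring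
    _ ≤ (p.R * C1) * exp (K * N) * δ + (p.b⁻¹ * C2 * (1 + r2 + C3 * C4)) * exp (K * N) * δ := by gcongr
    _ = (p.R * C1 + p.b⁻¹ * C2 * (1 + r2 + C3 * C4)) * (exp (K * N) * δ) := by ring
    _ ≤ K * (exp (K * N) * δ) := by
        refine mul_le_mul_of_nonneg_right ?_ (by positivity)
        linarith
    _ = _ := by ring

/-- A solution of the ODE with growth bounds. -/
structure Sol (φ φ1 : ℝ → ℝ) (C : ℝ) : Prop where
  hC : 0 < C
  d0 : ∀ z, HasDerivAt φ (φ1 z) z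
  d1 : ∀ z, HasDerivAt φ1 (p.F z (φ z) (φ1 z)) z
  nn : ∀ z, 0 ≤ φ z
  up : ∀ z, φ z ≤ C * (1 + exp z) ^ p.a
  b1 : ∀ z, |φ1 z| ≤ C * exp (2 * |z|)
  b2 : ∀ z, |p.F z (φ z) (φ1 z)| ≤ C * exp (3 * |z|)

variable {p}

lemma Sol.EL {φ φ1 : ℝ → ℝ} {C : ℝ} (s : p.Sol φ φ1 C) : (EL2 fun x y => φ (y - x)) ∧
    (EL2 fun x y => φ1 (y - x)) ∧ EL2 fun x y => p.F (y - x) (φ (y-x)) (φ1 (y-x)) := by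
  have hC := s.hC
  have e0 : EL2 fun x y => φ (y - x) := by
    refine (EL2.of_deriv s.d0 (C := C + 3) (by linarith) (fun z => (s.b1 z).trans ?_) (p := -1) (q := 1)
      (by simp) (by simp)).congr fun x y => by ring_nf
    gcongr <;> linarith
  have e1 : EL2 fun x y => φ1 (y - x) := by
    refine (EL2.of_deriv s.d1 (C := C + 3) (by linarith) (fun z => (s.b2 z).trans ?_) (p := -1) (q := 1)
      (by simp) (by simp)).congr fun x y => by ring_nf
    gcongr <;> linarith
  refine ⟨e0, e1, ?_⟩
  have hE : EL2 (fun x y => exp (-(y - x))) :=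
    (EL2.exp (-1) (p := -1) (q := 1) (by simp) (by simp)).congr fun x y => by ring_nf
  have hQ : EL2 (fun x y => p.m * φ (y-x) + (1 + p.r * exp (-(y-x))) * φ1 (y-x)) :=
    (e0.const_mul _).add (((EL2.const 1).add (hE.const_mul _)).mul e1)
  exact ((((e0.const_mul p.L).add (e1.const_mul (-p.E))).add ((p.Hm_EL hQ).const_mul (-1))).const_mul p.D⁻¹).congr
    fun x y => by rw [OP.F]; ring

lemma Sol.ode {φ φ1 : ℝ → ℝ} {C : ℝ} (s : p.Sol φ φ1 C) (z : ℝ) :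
    p.D * p.F z (φ z) (φ1 z) + p.E * φ1 z - p.L * φ z + p.Hm z (p.m * φ z + (1 + p.r * exp (-z)) * φ1 z) = 0 := by
  have := p.hD
  rw [OP.F]
  field_simp
  ring

end OP
end HabitModel

namespace HabitModel
open Filter Topology
variable {Ω : Type*} [mΩ : MeasurableSpace Ω]

lemma ac_log {K : ℝ → ℝ} {T : ℝ} (hT : 0 ≤ T) (hK : AbsolutelyContinuousOnInterval K 0 T)
    (hp : ∀ t ∈ Icc 0 T, 0 < K t) : AbsolutelyContinuousOnInterval (fun t => log (K t)) 0 T := by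
  have hc := hK.continuousOn
  rw [uIcc_of_le hT] at hc
  obtain ⟨t0, ht0, hmin⟩ := isCompact_Icc.exists_isMinOn (nonempty_Icc.2 hT) hc
  set c := K t0
  have hc0 : 0 < c := hp t0 ht0
  have hl : ∀ s ∈ Icc 0 T, ∀ t ∈ Icc 0 T, log (K s) - log (K t) ≤ c⁻¹ * |K s - K t| := by
    intro s hs t ht
    rw [← log_div (hp s hs).ne' (hp t ht).ne']
    refine (log_le_sub_one_of_pos (div_pos (hp s hs) (hp t ht))).trans ?_
    have : K s / K t - 1 = (K t)⁻¹ * (K s - K t) := by have := (hp t ht).ne'; field_simp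
    rw [this]
    have h1 := inv_anti₀ hc0 (hmin ht)
    have h2 := inv_pos.2 (hp t ht)
    exact (mul_le_mul_of_nonneg_left (le_abs_self _) h2.le).trans (mul_le_mul_of_nonneg_right h1 (abs_nonneg _))
  rw [absolutelyContinuousOnInterval_iff] at hK ⊢
  intro ε hε
  obtain ⟨δ, hδ, h⟩ := hK (ε * c) (by positivity)
  refine ⟨δ, hδ, fun E hE hs => ?_⟩
  have h1 := h E hE hs
  have h2 : ∑ i ∈ Finset.range E.1, dist (log (K (E.2 i).1)) (log (K (E.2 i).2)) ≤
      ∑ i ∈ Finset.range E.1, c⁻¹ * dist (K (E.2 i).1) (K (E.2 i).2) := by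
    refine Finset.sum_le_sum fun i hi => ?_
    have hm := hE.1 i hi
    rw [uIcc_of_le hT] at hm
    rw [Real.dist_eq, Real.dist_eq, abs_sub_le_iff]
    refine ⟨hl _ hm.1 _ hm.2, ?_⟩
    rw [abs_sub_comm]; exact hl _ hm.2 _ hm.1
  refine h2.trans_lt ?_
  rw [← Finset.mul_sum, inv_mul_lt_iff₀ hc0, mul_comm]
  exact h1

lemma log_formula {K κ v : ℝ → ℝ} {k0 T : ℝ} (hT : 0 ≤ T) (hκ : IntervalIntegrable κ volume 0 T)
    (hK : ∀ t ∈ Icc 0 T, K t = k0 + ∫ s in (0:ℝ)..t, κ s) (hp : ∀ t ∈ Icc 0 T, 0 < K t)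
    (hv : IntervalIntegrable v volume 0 T) (hkv : ∀ᵐ s, s ∈ Icc 0 T → κ s = v s * K s) :
    log (K T) = log k0 + ∫ s in (0:ℝ)..T, v s := by
  set K' : ℝ → ℝ := fun t => k0 + ∫ s in (0:ℝ)..t, κ s with hK'
  have hu : uIcc 0 T = Icc 0 T := uIcc_of_le hT
  have hp' : ∀ t ∈ Icc 0 T, 0 < K' t := fun t ht => by have := hp t ht; rw [hK t ht] at this; exact this
  have ac1 : AbsolutelyContinuousOnInterval K' 0 T :=
    ((show LipschitzOnWith 0 (fun _ : ℝ => k0) (uIcc 0 T) from (LipschitzWith.const k0).lipschitzOnWith).absolutelyContinuousOnInterval).add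
      (hκ.absolutelyContinuousOnInterval_intervalIntegral (left_mem_uIcc))
  have ac2 := (ac_log hT ac1 hp').sub (hv.absolutelyContinuousOnInterval_intervalIntegral (left_mem_uIcc))
  have hd : ∀ᵐ x, x ∈ uIcc 0 T → HasDerivAt ((fun t => log (K' t)) - fun x => ∫ s in (0:ℝ)..x, v s) 0 x := by
    filter_upwards [hκ.ae_hasDerivAt_integral, hv.ae_hasDerivAt_integral, hkv] with x h1 h2 h3 hx
    have d1 := (((h1 hx 0 left_mem_uIcc).const_add k0).log (hp' x (hu ▸ hx)).ne').sub (h2 hx 0 left_mem_uIcc)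
    refine d1.congr_deriv ?_
    rw [h3 (hu ▸ hx), hK x (hu ▸ hx), sub_eq_zero]
    exact mul_div_cancel_right₀ _ (hp' x (hu ▸ hx)).ne'
  obtain ⟨C, hC⟩ := ac2.const_of_ae_hasDerivAt_zero hd
  have e0 := hC 0 left_mem_uIcc
  have eT := hC T right_mem_uIcc
  simp only [Pi.sub_apply, intervalIntegral.integral_same, hK', add_zero, sub_zero] at e0 eT
  rw [hK T (right_mem_Icc.2 hT)]
  linarith

/-- measurability of parametrised integrals -/
lemma meas_int {Ω' : Type*} [MeasurableSpace Ω'] {f : ℝ → Ω' → ℝ} (hf : Measurable (fun q : ℝ × Ω' => f q.1 q.2)) :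
    Measurable (fun q : ℝ × Ω' => ∫ s in (0:ℝ)..q.1, f s q.2) := by
  have h : ∀ s : Set (ℝ × ℝ), MeasurableSet s →
      Measurable (fun q : ℝ × Ω' => ∫ r, s.indicator (fun w => f w.2 q.2) (q.1, r)) := by
    intro s hs
    refine (StronglyMeasurable.integral_prod_right
      (f := fun (q : ℝ × Ω') (r : ℝ) => s.indicator (fun w => f w.2 q.2) (q.1, r)) ?_).measurable
    refine Measurable.stronglyMeasurable ?_
    have e : (Function.uncurry fun (q : ℝ × Ω') (r : ℝ) => s.indicator (fun w => f w.2 q.2) (q.1, r)) =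
      ((fun p : (ℝ × Ω') × ℝ => (p.1.1, p.2)) ⁻¹' s).indicator (fun p => f p.2 p.1.2) := by
      ext p; rfl
    rw [e]
    refine Measurable.indicator ?_ (hs.preimage (by fun_prop))
    exact hf.comp (measurable_snd.prodMk (measurable_snd.comp measurable_fst))
  have h1 := h {w | 0 < w.2 ∧ w.2 ≤ w.1} ((measurableSet_lt measurable_const measurable_snd).inter
    (measurableSet_le measurable_snd measurable_fst))
  have h2 := h {w | w.1 < w.2 ∧ w.2 ≤ 0} ((measurableSet_lt measurable_fst measurable_snd).inter
    (measurableSet_le measurable_snd measurable_const))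
  have e : (fun q : ℝ × Ω' => ∫ s in (0:ℝ)..q.1, f s q.2) = fun q =>
      (∫ r, {w : ℝ × ℝ | 0 < w.2 ∧ w.2 ≤ w.1}.indicator (fun w => f w.2 q.2) (q.1, r)) -
      ∫ r, {w : ℝ × ℝ | w.1 < w.2 ∧ w.2 ≤ 0}.indicator (fun w => f w.2 q.2) (q.1, r) := by
    ext q
    rw [intervalIntegral, ← integral_indicator measurableSet_Ioc, ← integral_indicator measurableSet_Ioc]
    rfl
  rw [e]
  exact h1.sub h2

lemma prog_min {Ω' : Type*} [MeasurableSpace Ω'] {f : ℝ → Ω' → ℝ} {t : ℝ}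
    (hf : Measurable (fun q : Iic t × Ω' => f q.1 q.2)) : Measurable (fun q : ℝ × Ω' => f (min q.1 t) q.2) := by
  have : Measurable (fun q : ℝ × Ω' => ((⟨min q.1 t, mem_Iic.2 (min_le_right _ _)⟩ : Iic t), q.2)) :=
    ((measurable_fst.min measurable_const).subtype_mk).prodMk measurable_snd
  exact hf.comp this

lemma adapt_int {Ω' : Type*} [MeasurableSpace Ω'] {f : ℝ → Ω' → ℝ} {t : ℝ} (ht : 0 ≤ t)
    (hf : Measurable (fun q : Iic t × Ω' => f q.1 q.2)) : Measurable (fun ω => ∫ s in (0:ℝ)..t, f s ω) := by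
  have h := (meas_int (f := fun s ω => f (min s t) ω) (prog_min hf)).comp (measurable_prodMk_left (x := t))
  have e : (fun ω => ∫ s in (0:ℝ)..t, f s ω) = fun ω => ∫ s in (0:ℝ)..t, f (min s t) ω := by
    ext ω
    refine intervalIntegral.integral_congr fun s hs => ?_
    rw [uIcc_of_le ht] at hs
    simp only [min_eq_left hs.2]
  rw [e]; exact h

lemma prog_joint {F : Filtration ℝ mΩ} {f : ℝ → Ω → ℝ} (hf : IsStronglyProgressive F f) :
    Measurable (fun q : ℝ × Ω => f q.1 q.2) := by
  have h : ∀ n : ℕ, Measurable (fun q : ℝ × Ω => f (min q.1 n) q.2) := fun n => by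
    refine prog_min (t := (n:ℝ)) ?_
    have h1 : @Measurable _ _ (@Prod.instMeasurableSpace _ _ _ (F n)) _ (fun q : Iic (n:ℝ) × Ω => f q.1 q.2) := (hf n).measurable
    refine h1.mono ?_ le_rfl
    exact sup_le_sup le_rfl (MeasurableSpace.comap_mono (F.le n))
  refine measurable_of_tendsto_metrizable h (tendsto_pi_nhds.2 fun q => ?_)
  obtain ⟨N, hN⟩ := exists_nat_ge q.1
  refine tendsto_const_nhds.congr' ?_
  filter_upwards [eventually_ge_atTop N] with n hn
  rw [min_eq_left (hN.trans (by exact_mod_cast hn))]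

lemma prog_adapt {F : Filtration ℝ mΩ} {f : ℝ → Ω → ℝ} (hf : IsStronglyProgressive F f) {t : ℝ} (ht : 0 ≤ t) :
    Measurable[F t] (fun ω => ∫ s in (0:ℝ)..t, f s ω) :=
  @adapt_int Ω (F t) f t ht (hf t).measurable

section adm
variable {S : Setting Ω} {k₀ h₀ : ℝ} {c : ℝ → Ω → ℝ}

def uC (S : Setting Ω) (k₀ : ℝ) (c : ℝ → Ω → ℝ) (t : ℝ) (ω : Ω) : ℝ :=
  max 0 (min S.R (c t ω / kProc S k₀ c t ω))
def XC (S : Setting Ω) (k₀ : ℝ) (c : ℝ → Ω → ℝ) (t : ℝ) (ω : Ω) : ℝ := log (kProc S k₀ c t ω)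
def YC (S : Setting Ω) (h₀ : ℝ) (c : ℝ → Ω → ℝ) (t : ℝ) (ω : Ω) : ℝ := log (hProc S h₀ c t ω)

lemma progA1 (S : Setting Ω) : IsStronglyProgressive S.F
    (fun s ω => Real.exp (-((S.B - S.β₁ ^ 2 / 2) * s) - S.β₁ * S.W1 s ω)) := by
  refine StronglyAdapted.isStronglyProgressive_of_continuous (fun t => Measurable.stronglyMeasurable ?_) fun ω => ?_
  · exact (((S.bm1.adapted t).const_mul S.β₁).const_sub _).exp
  · have := S.bm1.cont ω
    fun_prop

lemma progA2 (S : Setting Ω) : IsStronglyProgressive S.F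
    (fun s ω => Real.exp ((S.ρ + S.β₂ ^ 2 / 2) * s - S.β₂ * S.W2 s ω)) := by
  refine StronglyAdapted.isStronglyProgressive_of_continuous (fun t => Measurable.stronglyMeasurable ?_) fun ω => ?_
  · exact (((S.bm2.adapted t).const_mul S.β₂).const_sub _).exp
  · have := S.bm2.cont ω
    fun_prop

lemma kProc_meas (hc : IsStronglyProgressive S.F c) : Measurable (fun q : ℝ × Ω => kProc S k₀ c q.1 q.2) := by
  have h := meas_int (prog_joint (hc.mul (progA1 S)))
  have := S.bm1.measProd
  unfold kProc
  fun_prop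

lemma hProc_meas (hc : IsStronglyProgressive S.F c) : Measurable (fun q : ℝ × Ω => hProc S h₀ c q.1 q.2) := by
  have h := meas_int (prog_joint (hc.mul (progA2 S)))
  have := S.bm2.measProd
  unfold hProc
  fun_prop

lemma kProc_ad (hc : IsStronglyProgressive S.F c) {t : ℝ} (ht : 0 ≤ t) : Measurable[S.F t] (kProc S k₀ c t) := by
  have h := prog_adapt (hc.mul (progA1 S)) ht
  exact (((S.bm1.adapted t).const_mul S.β₁).const_add _).exp.mul (h.const_sub k₀)

lemma hProc_ad (hc : IsStronglyProgressive S.F c) {t : ℝ} (ht : 0 ≤ t) : Measurable[S.F t] (hProc S h₀ c t) := by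
  have h := prog_adapt (hc.mul (progA2 S)) ht
  exact (((S.bm2.adapted t).const_mul S.β₂).const_add _).exp.mul ((h.const_mul S.ρ).const_add h₀)

lemma uC_meas (hc : IsStronglyProgressive S.F c) : Measurable (fun q : ℝ × Ω => uC S k₀ c q.1 q.2) := by
  have h1 := kProc_meas (k₀ := k₀) hc
  have h2 := prog_joint hc
  unfold uC
  exact measurable_const.max (measurable_const.min (h2.div h1))

lemma uC_nonneg (t : ℝ) (ω : Ω) : 0 ≤ uC S k₀ c t ω := le_max_left _ _
lemma uC_le (t : ℝ) (ω : Ω) : uC S k₀ c t ω ≤ S.R := max_le S.hR.le (min_le_left _ _)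

/-- pathwise good set -/
structure Good (S : Setting Ω) (k₀ h₀ : ℝ) (c : ℝ → Ω → ℝ) (ω : Ω) : Prop where
  li : ∀ t : ℝ, 0 ≤ t → IntervalIntegrable (fun s => c s ω) volume 0 t
  kp : ∀ t : ℝ, 0 ≤ t → 0 < kProc S k₀ c t ω
  hp : ∀ t : ℝ, 0 ≤ t → 0 < hProc S h₀ c t ω
  up : ∀ᵐ t : ℝ, 0 ≤ t → 0 < uC S k₀ c t ω ∧ c t ω = uC S k₀ c t ω * kProc S k₀ c t ω
  eX : ∀ t, 0 ≤ t → exp (XC S k₀ c t ω) = kProc S k₀ c t ω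
  eY : ∀ t, 0 ≤ t → exp (YC S h₀ c t ω) = hProc S h₀ c t ω

lemma good (hc : IsAdmissible S k₀ h₀ c) : ∀ᵐ ω ∂S.P, Good S k₀ h₀ c ω := by
  filter_upwards [hc.locInt, hc.cpos, hc.kpos, hc.hpos, hc.cbdd] with ω h1 h2 h3 h4 h5
  refine ⟨h1, h3, h4, ?_, fun t ht => exp_log (h3 t ht), fun t ht => exp_log (h4 t ht)⟩
  rw [ae_restrict_iff' measurableSet_Ici] at h2 h5
  filter_upwards [h2, h5] with t a b ht
  have hk := h3 t ht
  have e : uC S k₀ c t ω = c t ω / kProc S k₀ c t ω := by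
    rw [uC, min_eq_right, max_eq_right]
    · exact (div_pos (a ht) hk).le
    · rw [div_le_iff₀ hk]; exact b ht
  rw [e]
  exact ⟨div_pos (a ht) hk, (div_mul_cancel₀ _ hk.ne').symm⟩

lemma Good.eqX (hc : IsStronglyProgressive S.F c) {ω : Ω} (g : Good S k₀ h₀ c ω) (T : ℝ) (hT : 0 ≤ T) :
    XC S k₀ c T ω = log k₀ + (∫ r in (0:ℝ)..T, muD S (uC S k₀ c) r ω) + S.β₁ * S.W1 T ω := by
  have hw := S.bm1.cont ω
  set A : ℝ → ℝ := fun s => Real.exp (-((S.B - S.β₁ ^ 2 / 2) * s) - S.β₁ * S.W1 s ω) with hA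
  have hAc : Continuous A := by fun_prop
  set K : ℝ → ℝ := fun t => k₀ + ∫ s in (0:ℝ)..t, -(c s ω * A s) with hK
  have ek : ∀ t, kProc S k₀ c t ω = (A t)⁻¹ * K t := fun t => by
    rw [hK, hA, kProc, ← Real.exp_neg]
    simp only [intervalIntegral.integral_neg]
    rw [sub_eq_add_neg]; congr 2; ring
  have hu : IntervalIntegrable (fun s => uC S k₀ c s ω) volume 0 T := by
    refine (intervalIntegrable_const (c := S.R)).mono_fun
      ((uC_meas hc).comp measurable_prodMk_right).aestronglyMeasurable (Eventually.of_forall fun s => ?_)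
    show ‖uC S k₀ c s ω‖ ≤ ‖S.R‖
    rw [Real.norm_eq_abs, Real.norm_eq_abs, abs_of_nonneg (uC_nonneg _ _)]
    exact (uC_le _ _).trans (le_abs_self _)
  have hl := log_formula (K := K) (κ := fun s => -(c s ω * A s)) (v := fun s => - uC S k₀ c s ω) (k0 := k₀) hT
    ((g.li T hT).mul_continuousOn hAc.continuousOn).neg (fun t _ => rfl) (fun t ht => ?_) hu.neg ?_
  · have hKT : 0 < K T := by
      have := g.kp T hT
      rw [ek] at this
      exact pos_of_mul_pos_right this (inv_pos.2 (exp_pos _)).le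
    rw [XC, ek, log_mul (inv_pos.2 (exp_pos _)).ne' hKT.ne', hl, ← Real.exp_neg, log_exp]
    unfold muD
    rw [intervalIntegral.integral_sub intervalIntegrable_const hu, intervalIntegral.integral_neg]
    simp only [intervalIntegral.integral_const, smul_eq_mul, sub_zero]
    ring
  · have := g.kp t ht.1
    rw [ek] at this
    exact pos_of_mul_pos_right this (inv_pos.2 (exp_pos _)).le
  · filter_upwards [g.up] with s hs h0
    have h1 := (hs h0.1).2
    rw [ek] at h1
    have hA0 : A s ≠ 0 := (exp_pos _).ne'
    rw [h1]; field_simp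

lemma Good.eqY {ω : Ω} (g : Good S k₀ h₀ c ω) (T : ℝ) (hT : 0 ≤ T) :
    YC S h₀ c T ω = log h₀ + (∫ r in (0:ℝ)..T, nuD S (XC S k₀ c) (YC S h₀ c) (uC S k₀ c) r ω) + S.β₂ * S.W2 T ω := by
  have hw := S.bm2.cont ω
  set A : ℝ → ℝ := fun s => Real.exp ((S.ρ + S.β₂ ^ 2 / 2) * s - S.β₂ * S.W2 s ω) with hA
  have hAc : Continuous A := by fun_prop
  set K : ℝ → ℝ := fun t => h₀ + ∫ s in (0:ℝ)..t, S.ρ * (c s ω * A s) with hK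
  have ek : ∀ t, hProc S h₀ c t ω = (A t)⁻¹ * K t := fun t => by
    rw [hK, hA, hProc, ← Real.exp_neg]
    simp only [intervalIntegral.integral_const_mul]
    congr 2; ring
  have hκ : IntervalIntegrable (fun s => S.ρ * (c s ω * A s)) volume 0 T :=
    ((g.li T hT).mul_continuousOn hAc.continuousOn).const_mul _
  have hKp : ∀ t, 0 ≤ t → 0 < K t := fun t ht => by
    have := g.hp t ht
    rw [ek] at this
    exact pos_of_mul_pos_right this (inv_pos.2 (exp_pos _)).le
  have hKc : ContinuousOn K (uIcc 0 T) := continuousOn_const.add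
    (hκ.absolutelyContinuousOnInterval_intervalIntegral left_mem_uIcc).continuousOn
  have hKi : ContinuousOn (fun t => (K t)⁻¹) (uIcc 0 T) := hKc.inv₀ fun t ht => by
    rw [uIcc_of_le hT] at ht; exact (hKp t ht.1).ne'
  have hkv : ∀ᵐ s, s ∈ Icc 0 T → S.ρ * (c s ω * A s) =
      (S.ρ * (uC S k₀ c s ω * exp (XC S k₀ c s ω - YC S h₀ c s ω))) * K s := by
    filter_upwards [g.up] with s hs h0
    have h1 := (hs h0.1).2
    have hA0 : A s ≠ 0 := (exp_pos _).ne'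
    have hK0 := (hKp s h0.1).ne'
    rw [h1, exp_sub, g.eX s h0.1, g.eY s h0.1, ek]
    field_simp
  have hv : IntervalIntegrable (fun s => S.ρ * (uC S k₀ c s ω * exp (XC S k₀ c s ω - YC S h₀ c s ω))) volume 0 T := by
    refine (hκ.mul_continuousOn hKi).congr_ae ?_
    rw [Filter.EventuallyEq, ae_restrict_iff' measurableSet_uIoc]
    filter_upwards [hkv] with s hs h0
    rw [uIoc_of_le hT] at h0
    rw [hs ⟨h0.1.le, h0.2⟩, mul_assoc, mul_inv_cancel₀ (hKp s h0.1.le).ne', mul_one]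
  have hl := log_formula (K := K) (k0 := h₀) hT hκ (fun t _ => rfl) (fun t ht => hKp t ht.1) hv hkv
  rw [YC, ek, log_mul (inv_pos.2 (exp_pos _)).ne' (hKp T hT).ne', hl, ← Real.exp_neg, log_exp]
  unfold nuD
  rw [intervalIntegral.integral_add intervalIntegrable_const hv]
  simp only [intervalIntegral.integral_const, smul_eq_mul, sub_zero]
  ring

lemma Good.eqH (hh : 0 < h₀) {ω : Ω} (g : Good S k₀ h₀ c ω) (T : ℝ) (hT : 0 ≤ T) :
    exp (YC S h₀ c T ω) = exp ((-S.ρ - S.β₂^2/2) * T + S.β₂ * S.W2 T ω) *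
    (exp (log h₀) + S.ρ * ∫ r in (0:ℝ)..T, hI S (XC S k₀ c) (uC S k₀ c) r ω) := by
  rw [g.eY T hT, hProc, exp_log hh]
  congr 3
  refine intervalIntegral.integral_congr_ae ?_
  filter_upwards [g.up] with s hs h0
  rw [uIoc_of_le hT] at h0
  rw [hI, exp_add, g.eX s h0.1.le, (hs h0.1.le).2]
  ring

lemma itoD (hc : IsAdmissible S k₀ h₀ c) (hh : 0 < h₀) :
    ItoD S (log k₀) (log h₀) (XC S k₀ c) (YC S h₀ c) (uC S k₀ c) where
  adX t ht := (kProc_ad hc.prog ht).log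
  adY t ht := (hProc_ad hc.prog ht).log
  mX := (kProc_meas hc.prog).log
  mY := (hProc_meas hc.prog).log
  mu := uC_meas hc.prog
  u0 := uC_nonneg
  uR := uC_le
  eqX := by filter_upwards [good hc] with ω g t ht using g.eqX hc.prog t ht
  eqY := by filter_upwards [good hc] with ω g t ht using g.eqY t ht
  eqH := by filter_upwards [good hc] with ω g t ht using g.eqH hh t ht

end adm
end HabitModel

namespace HabitModel
open Filter Topology
variable {Ω : Type*} [mΩ : MeasurableSpace Ω]

structure Par (S : Setting Ω) (p : OP) : Prop where
  hD : p.D = (S.β₁^2 + S.β₂^2)/2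
  hE : p.E = -S.B - S.ρ + S.β₁^2/2*(2*p.m+1) - S.β₂^2/2
  hL : p.L = S.θ + S.B*p.m - S.β₁^2/2*(p.m*(p.m+1))
  hr : p.r = S.ρ
  hR : p.R = S.R
  hb : p.b = S.σ - 1
  ha : p.a = S.γ * (S.σ - 1)
  hm : p.m = p.b - p.a

def OP.LG (p : OP) (ψ ψ1 ψ2 : ℝ → ℝ) (z u : ℝ) : ℝ :=
  p.D * ψ2 z + p.E * ψ1 z - p.L * ψ z + u * (p.m * ψ z + (1 + p.r * exp (-z)) * ψ1 z)

lemma int_mono_ae {f g : ℝ → ℝ} {T : ℝ} (hT : 0 ≤ T) (hf : IntervalIntegrable f volume 0 T)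
    (hg : IntervalIntegrable g volume 0 T) (h : ∀ᵐ r, r ∈ Ioo 0 T → f r ≤ g r) :
    ∫ r in (0:ℝ)..T, f r ≤ ∫ r in (0:ℝ)..T, g r := by
  rw [intervalIntegrable_iff_integrableOn_Ioo_of_le hT] at hf hg
  simp only [intervalIntegral.integral_of_le hT, integral_Ioc_eq_integral_Ioo]
  exact setIntegral_mono_on_ae hf hg measurableSet_Ioo h

section dz
variable {S : Setting Ω} {x0 y0 : ℝ} {X Y u : ℝ → Ω → ℝ} {p : OP}

lemma ItoD.dynz (I : ItoD S x0 y0 X Y u) (hp : Par S p) {ψ ψ1 ψ2 : ℝ → ℝ}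
    (h0 : ∀ z, HasDerivAt ψ (ψ1 z) z) (h1 : ∀ z, HasDerivAt ψ1 (ψ2 z) z)
    (e0 : EL2 fun x y => ψ (y - x)) (e1 : EL2 fun x y => ψ1 (y - x)) (e2 : EL2 fun x y => ψ2 (y - x))
    {T : ℝ} (hT : 0 ≤ T) :
    PB S.P T (fun r ω => exp (-p.m * X r ω) * ψ (Y r ω - X r ω)) ∧
    PB S.P T (fun r ω => exp (-p.m * X r ω) * p.LG ψ ψ1 ψ2 (Y r ω - X r ω) (u r ω)) ∧
    exp (-S.θ*T) * ∫ ω, exp (-p.m * X T ω) * ψ (Y T ω - X T ω) ∂S.P = exp (-p.m*x0) * ψ (y0 - x0) +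
      ∫ r in (0:ℝ)..T, exp (-S.θ*r) * ∫ ω, exp (-p.m * X r ω) * p.LG ψ ψ1 ψ2 (Y r ω - X r ω) (u r ω) ∂S.P := by
  have := S.isProb
  have G := G2.ofz p.m h0 h1 e0 e1 e2
  have P1 := I.pbL hT G.e0
  have P2 := I.pbGen G hT
  have key : ∀ r ω, exp (-p.m * X r ω) * p.LG ψ ψ1 ψ2 (Y r ω - X r ω) (u r ω) =
    -S.θ * (exp (-p.m * X r ω) * ψ (Y r ω - X r ω)) + ItoD.gen S X Y u
      (fun x y => exp (-p.m*x) * (-p.m * ψ (y-x) - ψ1 (y-x)))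
      (fun x y => exp (-p.m*x) * ψ1 (y-x))
      (fun x y => exp (-p.m*x) * (p.m^2 * ψ (y-x) + 2 * p.m * ψ1 (y-x) + ψ2 (y-x)))
      (fun x y => exp (-p.m*x) * ψ2 (y-x)) r ω := fun r ω => by
    rw [ItoD.gen, OP.LG, hp.hD, hp.hE, hp.hL, hp.hr, muD, nuD, neg_sub]
    ring
  have P3 : PB S.P T (fun r ω => exp (-p.m * X r ω) * p.LG ψ ψ1 ψ2 (Y r ω - X r ω) (u r ω)) := by
    simp only [key]
    exact (P1.const_mul _).add P2
  refine ⟨P1, P3, ?_⟩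
  rw [I.dynkin G hT]
  congr 1
  refine intervalIntegral.integral_congr fun r hr => ?_
  rw [uIcc_of_le hT] at hr
  simp only [key]
  rw [integral_add ((P1.mb.integrable ⟨r, hr⟩).const_mul _) (P2.mb.integrable ⟨r, hr⟩), integral_const_mul]

lemma expz_EL (s : ℝ) : EL2 (fun x y => exp (s * (y - x))) :=
  (EL2.exp s (p := -1) (q := 1) (by norm_num) (by norm_num)).congr fun x y => by congr 1; ring

/-- Lyapunov function -/
lemma lyap (p : OP) : ∃ N, 0 ≤ N ∧ ∀ z u, 0 ≤ u → u ≤ p.R →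
    p.L / 2 - N * exp (p.a * z) ≤ p.LG (fun z => -1 + exp (p.a/2 * z)) (fun z => p.a/2 * exp (p.a/2 * z))
      (fun z => (p.a/2)^2 * exp (p.a/2 * z)) z u := by
  have ha := p.ha; have ha1 := p.ha1; have hL := p.hL; have hm := p.hm; have hr := p.hr; have hR := p.hR
  set s := p.a/2 with hs
  have s0 : 0 < s := by positivity
  have s1 : s < 1 := by rw [hs]; linarith
  set c := p.D * s^2 + p.E * s - p.L with hc
  have t1 : Tendsto (fun z : ℝ => |c| * exp (s * z)) atBot (𝓝 (|c| * 0)) :=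
    (tendsto_exp_atBot.comp (tendsto_id.const_mul_atBot s0)).const_mul _
  have t2 : Tendsto (fun z : ℝ => (s * p.r) * exp ((s-1) * z)) atBot atTop :=
    (tendsto_exp_atTop.comp (tendsto_id.const_mul_atBot_of_neg (by linarith))).const_mul_atTop (by positivity)
  rw [mul_zero] at t1
  obtain ⟨K, hK⟩ := eventually_atBot.1 ((t1.eventually (ge_mem_nhds (show (0:ℝ) < p.L/2 by positivity))).and
    (t2.eventually (eventually_ge_atTop p.m)))
  have id : ∀ z u, p.LG (fun z => -1 + exp (s * z)) (fun z => s * exp (s * z)) (fun z => s^2 * exp (s * z)) z u =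
      p.L + c * exp (s*z) + u * (-p.m + (p.m + s) * exp (s*z) + s * p.r * exp ((s-1)*z)) := fun z u => by
    have : exp ((s-1)*z) = exp (-z) * exp (s*z) := by rw [← exp_add]; congr 1; ring
    rw [OP.LG, this, hc]; ring
  refine ⟨(|c| + p.R * p.m) * exp (-(s*K)) * (1 + exp (-(s*K))), by positivity, fun z u hu huR => ?_⟩
  rw [id]
  have e1 := exp_pos (s*z); have e2 := exp_pos ((s-1)*z)
  have hce : -(|c| * exp (s*z)) ≤ c * exp (s*z) := by nlinarith [neg_abs_le c]
  have az : exp (p.a * z) = exp (s*z) * exp (s*z) := by rw [← exp_add]; congr 1; rw [hs]; ring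
  have hms : 0 ≤ u * ((p.m + s) * exp (s*z)) := by positivity
  have hsr : 0 ≤ u * (s * p.r * exp ((s-1)*z)) := by positivity
  rcases le_or_gt z K with h | h
  · obtain ⟨q1, q2⟩ := hK z h
    have : 0 ≤ u * (s * p.r * exp ((s-1)*z) - p.m) := mul_nonneg hu (by linarith)
    have : 0 ≤ (|c| + p.R * p.m) * exp (-(s*K)) * (1 + exp (-(s*K))) * exp (p.a * z) := by positivity
    linarith
  · have g1 : 1 ≤ exp (-(s*K)) * exp (s*z) := by
      rw [← exp_add]; exact one_le_exp (by nlinarith)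
    have um : u * p.m ≤ p.R * p.m := by gcongr
    rw [az]
    have w1 : exp (s*z) ≤ exp (-(s*K)) * (1 + exp (-(s*K))) * (exp (s*z) * exp (s*z)) := by
      have a1 := exp_pos (-(s*K))
      have : exp (s*z) * 1 ≤ exp (s*z) * (exp (-(s*K)) * exp (s*z)) := by gcongr
      have : 0 ≤ exp (-(s*K)) * exp (-(s*K)) * (exp (s*z) * exp (s*z)) := by positivity
      linarith
    have w2 : 1 ≤ exp (-(s*K)) * (1 + exp (-(s*K))) * (exp (s*z) * exp (s*z)) := by
      have a1 := exp_pos (-(s*K))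
      have : 1 * 1 ≤ (exp (-(s*K)) * exp (s*z)) * (exp (-(s*K)) * exp (s*z)) := by gcongr
      have : 0 ≤ exp (-(s*K)) * (exp (s*z) * exp (s*z)) := by positivity
      linarith
    have v1 := mul_le_mul_of_nonneg_left w1 (abs_nonneg c)
    have v2 := mul_le_mul_of_nonneg_left w2 (show 0 ≤ p.R * p.m by positivity)
    linarith

lemma lower_arith {α M C'' : ℝ} (hα : 0 < α) (h : ∀ T, 0 ≤ T → α * T^2/2 - C'' * T ≤ M) : False := by
  have h1 := h ((2*|C''| + 2)/α + (|M| + 1)) (by positivity)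
  set T := (2*|C''| + 2)/α + (|M| + 1) with hT
  have hT1 : (2*|C''| + 2) ≤ α * T := by
    rw [hT, mul_add, mul_div_cancel₀ _ hα.ne']
    have : 0 ≤ α * (|M| + 1) := by positivity
    linarith
  have hM : |M| + 1 ≤ T := by
    have : 0 ≤ (2*|C''| + 2)/α := by positivity
    linarith
  have hT0 : 0 < T := by rw [hT]; positivity
  have := le_abs_self M
  have h3 := mul_le_mul_of_nonneg_right (le_abs_self C'') hT0.le
  have h2 := mul_le_mul_of_nonneg_right hT1 hT0.le
  nlinarith

/-- verification, lower bound -/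
lemma ItoD.lower (I : ItoD S x0 y0 X Y u) (hp : Par S p) {φ φ1 : ℝ → ℝ} {C : ℝ} (s : p.Sol φ φ1 C) {q : ℝ → ℝ} {J : ℝ}
    (hq : ∀ T, 0 ≤ T → IntervalIntegrable q volume 0 T) (hJ : ∀ T, 0 ≤ T → ∫ r in (0:ℝ)..T, q r ≤ J)
    (hae : ∀ᵐ r, 0 < r → (∀ᵐ ω ∂S.P, 0 < u r ω) ∧
      Integrable (fun ω => exp (-p.m * X r ω) * (p.b⁻¹ * exp (p.a * (Y r ω - X r ω)) * u r ω ^ (-p.b))) S.P ∧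
      q r = exp (-S.θ * r) * ∫ ω, exp (-p.m * X r ω) * (p.b⁻¹ * exp (p.a * (Y r ω - X r ω)) * u r ω ^ (-p.b)) ∂S.P) :
    exp (-p.m*x0) * φ (y0 - x0) ≤ J := by
  have := S.isProb
  have hC := s.hC; have hb := p.hb; have hR := p.hR; have hL := p.hL
  obtain ⟨l0, l1, l2⟩ := s.EL
  by_contra! hd
  set d := exp (-p.m*x0) * φ (y0 - x0) - J with hdd
  have hd0 : 0 < d := by linarith
  -- the two expectations
  have PA : ∀ T : ℝ, 0 ≤ T → PB S.P T (fun r ω => exp (-p.m * X r ω)) := fun T hT =>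
    I.pbL hT (f := fun x _ => exp (-p.m * x)) ((EL2.exp (-p.m) (p := 1) (q := 0) (by norm_num) (by norm_num)).congr fun x y => by simp)
  have PE : ∀ T : ℝ, 0 ≤ T → ∀ c, PB S.P T (fun r ω => exp (c * (Y r ω - X r ω))) := fun T hT c => I.pbL hT (expz_EL c)
  have PI : ∀ T : ℝ, 0 ≤ T → PB S.P T (fun r ω => exp (-p.m * X r ω) * exp (p.a * (Y r ω - X r ω))) := fun T hT =>
    (PA T hT).mul (PE T hT _)
  set A : ℝ → ℝ := fun r => exp (-S.θ*r) * ∫ ω, exp (-p.m * X r ω) ∂S.P with hA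
  set K : ℝ → ℝ := fun r => exp (-S.θ*r) * ∫ ω, exp (-p.m * X r ω) * exp (p.a * (Y r ω - X r ω)) ∂S.P with hK
  have ce : Continuous (fun r : ℝ => exp (-S.θ*r)) := by fun_prop
  have Aint : ∀ T, 0 ≤ T → IntervalIntegrable A volume 0 T := fun T hT =>
    ((PA T hT).intervalIntegrable le_rfl hT le_rfl).continuousOn_mul ce.continuousOn
  have Kint : ∀ T, 0 ≤ T → IntervalIntegrable K volume 0 T := fun T hT =>
    ((PI T hT).intervalIntegrable le_rfl hT le_rfl).continuousOn_mul ce.continuousOn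
  -- 1: K controlled by q
  have hKq : ∀ T, 0 ≤ T → ∫ r in (0:ℝ)..T, K r ≤ (p.b * p.R ^ p.b) * J := fun T hT => by
    refine le_trans ?_ (mul_le_mul_of_nonneg_left (hJ T hT) (by positivity))
    rw [← intervalIntegral.integral_const_mul]
    refine int_mono_ae hT (Kint T hT) ((hq T hT).const_mul _) ?_
    filter_upwards [hae] with r hr h0
    obtain ⟨r1, r2, r3⟩ := hr h0.1
    rw [r3, hK]; dsimp only
    rw [mul_left_comm, ← integral_const_mul (p.b * p.R ^ p.b)]
    refine mul_le_mul_of_nonneg_left ?_ (exp_pos _).le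
    refine integral_mono_ae ((PI T hT).mb.integrable ⟨r, h0.1.le, h0.2.le⟩) (r2.const_mul _) ?_
    filter_upwards [r1] with ω hω
    have e1 : p.R ^ (-p.b) ≤ u r ω ^ (-p.b) :=
      rpow_le_rpow_of_nonpos hω (hp.hR ▸ I.uR r ω) (by linarith)
    have e2 : p.R ^ p.b * p.R ^ (-p.b) = 1 := by rw [← rpow_add hR]; simp
    have e3 : 1 ≤ p.R ^ p.b * u r ω ^ (-p.b) := by rw [← e2]; gcongr
    have := mul_le_mul_of_nonneg_left e3 (show 0 ≤ exp (-p.m * X r ω) * exp (p.a * (Y r ω - X r ω)) by positivity)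
    calc _ ≤ _ := by simpa using this
      _ = _ := by field_simp
  -- 2: verification
  have hW : ∀ T, 0 ≤ T → d / C ≤ A T + K T := fun T hT => by
    obtain ⟨P1, P2, e⟩ := I.dynz hp s.d0 s.d1 l0 l1 l2 hT
    have h1 : -∫ r in (0:ℝ)..T, q r ≤ ∫ r in (0:ℝ)..T, exp (-S.θ*r) * ∫ ω, exp (-p.m * X r ω) *
        p.LG φ φ1 (fun z => p.F z (φ z) (φ1 z)) (Y r ω - X r ω) (u r ω) ∂S.P := by
      rw [← intervalIntegral.integral_neg]
      refine int_mono_ae hT (hq T hT).neg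
        ((P2.intervalIntegrable le_rfl hT le_rfl).continuousOn_mul ce.continuousOn) ?_
      filter_upwards [hae] with r hr h0
      obtain ⟨r1, r2, r3⟩ := hr h0.1
      rw [r3, ← mul_neg, ← integral_neg]
      refine mul_le_mul_of_nonneg_left ?_ (exp_pos _).le
      refine integral_mono_ae r2.neg (P2.mb.integrable ⟨r, h0.1.le, h0.2.le⟩) ?_
      filter_upwards [r1] with ω hω
      have := p.Hm_le (Y r ω - X r ω) (p.m * φ (Y r ω - X r ω) + (1 + p.r * exp (-(Y r ω - X r ω))) * φ1 (Y r ω - X r ω))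
        (u r ω) hω (hp.hR ▸ I.uR r ω)
      have o := s.ode (Y r ω - X r ω)
      rw [← mul_neg]
      refine mul_le_mul_of_nonneg_left ?_ (exp_pos _).le
      rw [OP.LG]
      linarith
    have h2 : exp (-S.θ*T) * ∫ ω, exp (-p.m * X T ω) * φ (Y T ω - X T ω) ∂S.P ≤ C * (A T + K T) := by
      rw [hA, hK]; dsimp only
      rw [← mul_add, mul_left_comm, ← integral_add ((PA T hT).mb.integrable ⟨T, hT, le_rfl⟩)
        ((PI T hT).mb.integrable ⟨T, hT, le_rfl⟩), ← integral_const_mul C]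
      refine mul_le_mul_of_nonneg_left ?_ (exp_pos _).le
      refine integral_mono (P1.mb.integrable ⟨T, hT, le_rfl⟩) ((((PA T hT).mb.integrable ⟨T, hT, le_rfl⟩).add
        ((PI T hT).mb.integrable ⟨T, hT, le_rfl⟩)).const_mul _) fun ω => ?_
      dsimp only
      have e1 := s.up (Y T ω - X T ω)
      have e2 := Real.rpow_add_le_add_rpow (show (0:ℝ) ≤ 1 by norm_num) (exp_pos (Y T ω - X T ω)).le p.ha.le p.ha1
      rw [one_rpow, ← exp_mul, mul_comm _ p.a] at e2
      have e3 := mul_le_mul_of_nonneg_left (e1.trans (mul_le_mul_of_nonneg_left e2 hC.le)) (exp_pos (-p.m * X T ω)).le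
      linarith
    have h3 := hJ T hT
    rw [div_le_iff₀ hC]
    linarith
  -- 3: Lyapunov
  obtain ⟨N, hN, ly⟩ := lyap p
  set g0 := exp (-p.m*x0) * (-1 + exp (p.a/2 * (y0 - x0))) with hg0
  have hLy : ∀ T, 0 ≤ T → p.L/2 * (∫ r in (0:ℝ)..T, A r) - N * (∫ r in (0:ℝ)..T, K r) ≤ K T - g0 := fun T hT => by
    have dd : ∀ (c : ℝ) (z : ℝ), HasDerivAt (fun z => exp (c * z)) (c * exp (c * z)) z := fun c z => by
      have := ((hasDerivAt_id z).const_mul c).exp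
      exact this.congr_deriv (by simp [mul_comm])
    obtain ⟨P1, P2, e⟩ := I.dynz hp (ψ := fun z => -1 + exp (p.a/2 * z)) (ψ1 := fun z => p.a/2 * exp (p.a/2 * z))
      (ψ2 := fun z => (p.a/2)^2 * exp (p.a/2 * z)) (fun z => (dd _ z).const_add _)
      (fun z => ((dd _ z).const_mul _).congr_deriv (by ring)) ((EL2.const _).add (expz_EL _))
      ((expz_EL _).const_mul _) ((expz_EL _).const_mul _) hT
    have h1 : p.L/2 * (∫ r in (0:ℝ)..T, A r) - N * (∫ r in (0:ℝ)..T, K r) ≤ ∫ r in (0:ℝ)..T, exp (-S.θ*r) * ∫ ω, exp (-p.m * X r ω) *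
        p.LG (fun z => -1 + exp (p.a/2 * z)) (fun z => p.a/2 * exp (p.a/2 * z))
        (fun z => (p.a/2)^2 * exp (p.a/2 * z)) (Y r ω - X r ω) (u r ω) ∂S.P := by
      rw [← intervalIntegral.integral_const_mul, ← intervalIntegral.integral_const_mul,
        ← intervalIntegral.integral_sub ((Aint T hT).const_mul _) ((Kint T hT).const_mul _)]
      refine intervalIntegral.integral_mono_on hT (((Aint T hT).const_mul _).sub ((Kint T hT).const_mul _))
        ((P2.intervalIntegrable le_rfl hT le_rfl).continuousOn_mul ce.continuousOn) fun r hr => ?_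
      have i1 := (PA T hT).mb.integrable ⟨r, hr⟩
      have i2 := (PI T hT).mb.integrable ⟨r, hr⟩
      have e1 : p.L/2 * A r - N * K r = exp (-S.θ*r) * ∫ ω, (p.L/2 * exp (-p.m * X r ω) -
          N * (exp (-p.m * X r ω) * exp (p.a * (Y r ω - X r ω)))) ∂S.P := by
        rw [integral_sub (i1.const_mul _) (i2.const_mul _), integral_const_mul, integral_const_mul, hA, hK]
        ring
      rw [e1]
      refine mul_le_mul_of_nonneg_left ?_ (exp_pos _).le
      refine integral_mono ((i1.const_mul _).sub (i2.const_mul _)) (P2.mb.integrable ⟨r, hr⟩) fun ω => ?_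
      have := mul_le_mul_of_nonneg_left (ly (Y r ω - X r ω) (u r ω) (I.u0 r ω) (hp.hR ▸ I.uR r ω)) (exp_pos (-p.m * X r ω)).le
      dsimp only
      linarith
    have h2 : exp (-S.θ*T) * ∫ ω, exp (-p.m * X T ω) * (-1 + exp (p.a/2 * (Y T ω - X T ω))) ∂S.P ≤ K T := by
      refine mul_le_mul_of_nonneg_left ?_ (exp_pos _).le
      refine integral_mono (P1.mb.integrable ⟨T, hT, le_rfl⟩) ((PI T hT).mb.integrable ⟨T, hT, le_rfl⟩) fun ω => ?_
      refine mul_le_mul_of_nonneg_left ?_ (exp_pos _).le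
      have : exp (p.a * (Y T ω - X T ω)) = exp (p.a/2 * (Y T ω - X T ω)) ^ 2 := by
        rw [sq, ← exp_add]; congr 1; ring
      rw [this]
      nlinarith [sq_nonneg (exp (p.a/2 * (Y T ω - X T ω)) - 1)]
    linarith
  -- 4: contradiction
  have hKl : ∀ T, 0 ≤ T → (p.L/2 * (d/C)) * T - ((p.L/2 + N) * ((p.b * p.R ^ p.b) * J) - g0) ≤ K T := fun T hT => by
    have h1 : (d/C) * T ≤ (∫ r in (0:ℝ)..T, A r) + ∫ r in (0:ℝ)..T, K r := by
      rw [← intervalIntegral.integral_add (Aint T hT) (Kint T hT)]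
      have := intervalIntegral.integral_mono_on hT (intervalIntegrable_const (c := d/C)) ((Aint T hT).add (Kint T hT))
        fun r hr => hW r hr.1
      simpa [mul_comm, mul_div_assoc] using this
    have h2 := mul_le_mul_of_nonneg_left h1 (show 0 ≤ p.L/2 by positivity)
    have h3 := mul_le_mul_of_nonneg_left (hKq T hT) (show 0 ≤ p.L/2 + N by positivity)
    have h4 := hLy T hT
    linarith
  refine lower_arith (α := p.L/2 * (d/C)) (M := (p.b * p.R ^ p.b) * J)
    (C'' := (p.L/2 + N) * ((p.b * p.R ^ p.b) * J) - g0) (by positivity) fun T hT => ?_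
  refine le_trans ?_ (hKq T hT)
  have := intervalIntegral.integral_mono_on hT (f := fun r => (p.L/2 * (d/C)) * r - ((p.L/2 + N) * ((p.b * p.R ^ p.b) * J) - g0))
    (Continuous.intervalIntegrable (by fun_prop) _ _) (Kint T hT) fun r hr => hKl r hr.1
  rw [intervalIntegral.integral_sub (Continuous.intervalIntegrable (by fun_prop) _ _) (Continuous.intervalIntegrable (by fun_prop) _ _),
    intervalIntegral.integral_const_mul, integral_id, intervalIntegral.integral_const, smul_eq_mul] at this
  linarith

end dz
end HabitModel

namespace HabitModel
open Filter Topology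
variable {Ω : Type*} [mΩ : MeasurableSpace Ω]

section cost
variable {S : Setting Ω} {p : OP} {k₀ h₀ : ℝ} {c : ℝ → Ω → ℝ}

def fC (S : Setting Ω) (p : OP) (k₀ h₀ : ℝ) (c : ℝ → Ω → ℝ) (t : ℝ) (ω : Ω) : ℝ :=
  exp (-S.θ * t) * (exp (-p.m * XC S k₀ c t ω) * (p.b⁻¹ * exp (p.a * (YC S h₀ c t ω - XC S k₀ c t ω)) * uC S k₀ c t ω ^ (-p.b)))

lemma fC_nonneg (t : ℝ) (ω : Ω) : 0 ≤ fC S p k₀ h₀ c t ω := by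
  have := p.hb
  have := rpow_nonneg (uC_nonneg (S := S) (k₀ := k₀) (c := c) t ω) (-p.b)
  unfold fC; positivity

lemma fC_meas (hc : IsAdmissible S k₀ h₀ c) (hh : 0 < h₀) : Measurable (fun q : ℝ × Ω => fC S p k₀ h₀ c q.1 q.2) := by
  have I := itoD hc hh
  have := I.mX; have := I.mY; have := I.mu
  unfold fC
  fun_prop

lemma Jcost_eq (hc : IsAdmissible S k₀ h₀ c) (hp : Par S p) (hh : 0 < h₀) :
    Jcost S k₀ h₀ c = ∫⁻ t in Ioi (0:ℝ), ∫⁻ ω, ENNReal.ofReal (fC S p k₀ h₀ c t ω) ∂S.P := by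
  have := S.isProb
  rw [lintegral_lintegral_swap (f := fun t ω => ENNReal.ofReal (fC S p k₀ h₀ c t ω))
    (fC_meas hc hh).ennreal_ofReal.aemeasurable]
  refine lintegral_congr_ae ?_
  filter_upwards [good hc] with ω g
  refine setLIntegral_congr_fun_ae measurableSet_Ioi ?_
  filter_upwards [g.up] with t ht h0
  obtain ⟨u0, eu⟩ := ht h0.le
  congr 1
  have hb := p.hb
  rw [eu, fC, ← g.eX t h0.le, ← g.eY t h0.le, ← hp.hb]
  have e : (exp (YC S h₀ c t ω) ^ S.γ / (uC S k₀ c t ω * exp (XC S k₀ c t ω))) ^ p.b =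
      exp (-p.m * XC S k₀ c t ω) * exp (p.a * (YC S h₀ c t ω - XC S k₀ c t ω)) * uC S k₀ c t ω ^ (-p.b) := by
    rw [← exp_mul, div_rpow (exp_pos _).le (by positivity), mul_rpow u0.le (exp_pos _).le, ← exp_mul, ← exp_mul,
      ← exp_add, rpow_neg u0.le, div_eq_mul_inv, mul_inv, ← Real.exp_neg, mul_left_comm, mul_comm _ ((uC S k₀ c t ω ^ p.b)⁻¹),
      ← exp_add, hp.hm, hp.ha, ← hp.hb]
    congr 2; ring
  rw [e]; ring

lemma lower_adm (hc : IsAdmissible S k₀ h₀ c) (hp : Par S p) (hh : 0 < h₀) {φ φ1 : ℝ → ℝ} {C : ℝ}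
    (s : p.Sol φ φ1 C) :
    ENNReal.ofReal (exp (-p.m * log k₀) * φ (log h₀ - log k₀)) ≤ Jcost S k₀ h₀ c := by
  have := S.isProb
  by_cases hJ : Jcost S k₀ h₀ c = ⊤
  · rw [hJ]; exact le_top
  have fm := fC_meas (p := p) hc hh
  have hJ' := hJ
  rw [Jcost_eq hc hp hh, ← lintegral_prod (fun q : ℝ × Ω => ENNReal.ofReal (fC S p k₀ h₀ c q.1 q.2)) fm.ennreal_ofReal.aemeasurable,
    ← ne_eq, lintegral_ofReal_ne_top_iff_integrable fm.aestronglyMeasurable (Eventually.of_forall fun q => fC_nonneg _ _)] at hJ'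
  have hqi := hJ'.integral_prod_left
  have hJr : Jcost S k₀ h₀ c = ENNReal.ofReal (∫ t in Ioi (0:ℝ), ∫ ω, fC S p k₀ h₀ c t ω ∂S.P) := by
    rw [integral_integral hJ', ofReal_integral_eq_lintegral_ofReal hJ' (Eventually.of_forall fun q => fC_nonneg _ _),
      lintegral_prod _ fm.ennreal_ofReal.aemeasurable, Jcost_eq hc hp hh]
  rw [hJr]
  refine ENNReal.ofReal_le_ofReal ?_
  refine (itoD hc hh).lower hp s (q := fun t => ∫ ω, fC S p k₀ h₀ c t ω ∂S.P) (fun T hT => ?_) (fun T hT => ?_) ?_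
  · rw [intervalIntegrable_iff_integrableOn_Ioc_of_le hT]
    exact IntegrableOn.mono_set hqi Ioc_subset_Ioi_self
  · rw [intervalIntegral.integral_of_le hT]
    exact setIntegral_mono_set hqi (Eventually.of_forall fun t => integral_nonneg fun ω => fC_nonneg _ _)
      (Eventually.of_forall Ioc_subset_Ioi_self)
  · have hu : ∀ᵐ t : ℝ, ∀ᵐ ω ∂S.P, 0 ≤ t → 0 < uC S k₀ c t ω := by
      rw [Measure.ae_ae_comm]
      · filter_upwards [good hc] with ω g
        filter_upwards [g.up] with t ht h0 using (ht h0).1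
      · have := (itoD hc hh).mu
        exact (measurableSet_le measurable_const measurable_fst).imp (measurableSet_lt measurable_const this)
    have hi := hJ'.prod_right_ae
    rw [ae_restrict_iff' measurableSet_Ioi] at hi
    filter_upwards [hu, hi] with t h1 h2 h0
    refine ⟨by filter_upwards [h1] with ω hω using hω h0.le, ?_, ?_⟩
    · exact (integrable_const_mul_iff (Ne.isUnit (exp_pos (-S.θ * t)).ne') _).1 (h2 h0)
    · rw [← integral_const_mul]; rfl

lemma upper_adm (hc : IsAdmissible S k₀ h₀ c) (hp : Par S p) (hh : 0 < h₀) {φ φ1 : ℝ → ℝ} {C : ℝ}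
    (s : p.Sol φ φ1 C) (hfb : ∀ t, 0 ≤ t → ∀ ω, uC S k₀ c t ω = p.uO (YC S h₀ c t ω - XC S k₀ c t ω)
      (p.m * φ (YC S h₀ c t ω - XC S k₀ c t ω) + (1 + p.r * exp (-(YC S h₀ c t ω - XC S k₀ c t ω))) *
        φ1 (YC S h₀ c t ω - XC S k₀ c t ω))) :
    Jcost S k₀ h₀ c ≤ ENNReal.ofReal (exp (-p.m * log k₀) * φ (log h₀ - log k₀)) := by
  have := S.isProb
  have fm := fC_meas (p := p) hc hh
  rw [Jcost_eq hc hp hh]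
  refine le_of_tendsto' (((aecover_Iic tendsto_natCast_atTop_atTop).restrict
    (s := Ioi (0:ℝ))).lintegral_tendsto_of_countably_generated
    (fm.ennreal_ofReal.lintegral_prod_right').aemeasurable) fun n => ?_
  have hn : (0:ℝ) ≤ (n:ℝ) := n.cast_nonneg
  rw [Measure.restrict_restrict measurableSet_Iic, show Iic (n:ℝ) ∩ Ioi 0 = Ioc 0 (n:ℝ) by rw [inter_comm]; rfl]
  obtain ⟨l0, l1, l2⟩ := s.EL
  obtain ⟨P1, P2, e⟩ := (itoD hc hh).dynz hp s.d0 s.d1 l0 l1 l2 hn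
  set LL := fun r ω => exp (-p.m * XC S k₀ c r ω) *
      p.LG φ φ1 (fun z => p.F z (φ z) (φ1 z)) (YC S h₀ c r ω - XC S k₀ c r ω) (uC S k₀ c r ω) with hLL
  have key : ∀ t, 0 ≤ t → ∀ ω, fC S p k₀ h₀ c t ω = -(exp (-S.θ * t) * LL t ω) := fun t ht ω => by
    have o := s.ode (YC S h₀ c t ω - XC S k₀ c t ω)
    rw [OP.Hm, ← hfb t ht ω] at o
    simp only [hLL, fC, OP.LG]
    linear_combination (exp (-S.θ * t) * exp (-p.m * XC S k₀ c t ω)) * o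
  have hT : ∀ t ∈ Ioc (0:ℝ) n, ∫⁻ ω, ENNReal.ofReal (fC S p k₀ h₀ c t ω) ∂S.P =
      ENNReal.ofReal (-(exp (-S.θ*t) * ∫ ω, LL t ω ∂S.P)) := fun t ht => by
    rw [← ofReal_integral_eq_lintegral_ofReal _ (Eventually.of_forall fun ω => fC_nonneg _ _)]
    · congr 1
      simp only [key t ht.1.le]
      rw [integral_neg, integral_const_mul]
    · have := ((P2.mb.integrable ⟨t, ht.1.le, ht.2⟩).const_mul (exp (-S.θ*t))).neg
      exact this.congr (Eventually.of_forall fun ω => (key t ht.1.le ω).symm)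
  rw [setLIntegral_congr_fun measurableSet_Ioc hT]
  have ce : Continuous (fun r : ℝ => exp (-S.θ*r)) := by fun_prop
  have ii : IntegrableOn (fun t => -(exp (-S.θ*t) * ∫ ω, LL t ω ∂S.P)) (Ioc 0 (n:ℝ)) :=
    (intervalIntegrable_iff_integrableOn_Ioc_of_le hn).1
      ((P2.intervalIntegrable le_rfl hn le_rfl).continuousOn_mul ce.continuousOn).neg
  rw [← ofReal_integral_eq_lintegral_ofReal ii]
  · refine ENNReal.ofReal_le_ofReal ?_
    rw [integral_neg, ← intervalIntegral.integral_of_le hn]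
    have : 0 ≤ exp (-S.θ*n) * ∫ ω, exp (-p.m * XC S k₀ c n ω) * φ (YC S h₀ c n ω - XC S k₀ c n ω) ∂S.P :=
      mul_nonneg (exp_pos _).le (integral_nonneg fun ω => mul_nonneg (exp_pos _).le (s.nn _))
    rw [e] at this
    linarith
  · filter_upwards [ae_restrict_mem measurableSet_Ioc] with t ht
    simp only [Pi.zero_apply]
    rw [← integral_const_mul, ← integral_neg]
    exact integral_nonneg fun ω => by simp only [Pi.zero_apply, ← key t ht.1.le]; exact fC_nonneg _ _

end cost
end HabitModel

namespace HabitModel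
open Filter Topology
variable {Ω : Type*} [mΩ : MeasurableSpace Ω]

section feedback

def vn (v : ℝ → ℝ) (n : ℕ) (z : ℝ) : ℝ := v (max (-(n:ℝ)) (min z n))

lemma vn_eq {v : ℝ → ℝ} {n : ℕ} {z : ℝ} (h : |z| ≤ n) : vn v n z = v z := by
  rw [abs_le] at h
  rw [vn, min_eq_left h.2, max_eq_right h.1]

lemma clamp_mem (n : ℕ) (z : ℝ) : max (-(n:ℝ)) (min z n) ∈ Icc (-(n:ℝ)) n :=
  ⟨le_max_left _ _, max_le (by have := n.cast_nonneg (α := ℝ); linarith) (min_le_right _ _)⟩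

lemma vn_lip {v : ℝ → ℝ} {n : ℕ} {K : ℝ≥0} (hK : LipschitzOnWith K v (Icc (-(n:ℝ)) n)) : LipschitzWith K (vn v n) := by
  refine LipschitzWith.of_dist_le_mul fun x y => ?_
  refine (hK.dist_le_mul _ (clamp_mem n x) _ (clamp_mem n y)).trans ?_
  refine mul_le_mul_of_nonneg_left ?_ K.2
  rw [Real.dist_eq, Real.dist_eq]
  have h1 := abs_max_sub_max_le_max (-(n:ℝ)) (min x n) (-(n:ℝ)) (min y n)
  have h2 := abs_min_sub_min_le_max x (n:ℝ) y (n:ℝ)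
  simp only [sub_self, abs_zero, abs_nonneg, max_eq_left, max_eq_right] at h1 h2
  exact h1.trans h2

lemma fb_path {v : ℝ → ℝ} {A : ℝ} (hv : ∀ n : ℕ, ∃ K : ℝ≥0, LipschitzOnWith K v (Icc (-(n:ℝ)) n))
    (h0 : ∀ z, 0 ≤ v z) (hA : ∀ z, v z ≤ A * (1 + exp (-z))) {N : ℝ → ℝ} (hN : Continuous N) :
    ∃ (Y : ℕ → ℝ → ℝ) (ζ : ℝ → ℝ),
      (∀ n t, 0 ≤ t → Tendsto (fun k => picIt (fun t x => vn v n (x + N t)) 0 k t) atTop (𝓝 (Y n t))) ∧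
      (∀ t, 0 ≤ t → Tendsto (fun n => Y n t) atTop (𝓝 (ζ t))) ∧
      (∀ t, ζ t = ζ (max t 0)) ∧ Continuous ζ ∧ ∀ t, 0 ≤ t → ζ t = ∫ s in (0:ℝ)..t, v (ζ s + N s) := by
  choose K hK using hv
  have hl := fun n => vn_lip (hK n)
  have hP : ∀ n, ∃ Y : ℝ → ℝ, Continuous Y ∧ Y 0 = 0 ∧ (∀ t, 0 ≤ t → HasDerivAt Y (vn v n (Y t + N t)) t) ∧
      ∀ t, 0 ≤ t → Tendsto (fun k => picIt (fun t x => vn v n (x + N t)) 0 k t) atTop (𝓝 (Y t)) := fun n => by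
    refine picard_exists (f := fun t x => vn v n (x + N t)) (K := K n + 1) ?_ (by positivity) (fun t x y => ?_) 0
    · exact (hl n).continuous.comp (by fun_prop)
    · have := (hl n).dist_le_mul (x + N t) (y + N t)
      rw [Real.dist_eq, Real.dist_eq, add_sub_add_right_eq_sub] at this
      refine this.trans (mul_le_mul_of_nonneg_right (by linarith) (abs_nonneg _))
  choose Y hY using hP
  have A0 : 0 ≤ A := by have := (h0 0).trans (hA 0); simp at this; linarith
  have hint : ∀ n t, 0 ≤ t → Y n t = ∫ s in (0:ℝ)..t, vn v n (Y n s + N s) := fun n t ht => by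
    have := intervalIntegral.integral_eq_sub_of_hasDerivAt (f := Y n) (f' := fun s => vn v n (Y n s + N s)) (a := 0) (b := t)
      (fun s hs => (hY n).2.2.1 s (by rw [uIcc_of_le ht] at hs; exact hs.1))
      (((hl n).continuous.comp ((hY n).1.add hN)).intervalIntegrable _ _)
    rw [this, (hY n).2.1, sub_zero]
  have key : ∀ T : ℝ, ∃ n0 : ℕ, ∀ n, n0 ≤ n → ∀ t ∈ Icc 0 T, Y n t = Y n0 t ∧ |Y n t + N t| ≤ n0 := fun T => by
    obtain ⟨M, hM⟩ := (isCompact_Icc (a := (0:ℝ)) (b := T)).exists_bound_of_continuousOn hN.continuousOn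
    obtain ⟨n0, hn0⟩ := exists_nat_ge (M + A * (1 + exp M) * T)
    have b : ∀ n, n0 ≤ n → ∀ t ∈ Icc 0 T, |Y n t + N t| ≤ n0 := fun n hn t ht => by
      have g1 : ∀ s ∈ Icc 0 T, 0 ≤ Y n s := fun s hs => by
        rw [hint n s hs.1]
        exact intervalIntegral.integral_nonneg hs.1 fun r _ => h0 _
      have hM0 : 0 ≤ M := (norm_nonneg _).trans (hM t ht)
      have g2 : Y n t ≤ A * (1 + exp M) * T := by
        rw [hint n t ht.1]
        have := intervalIntegral.integral_mono_on (μ := volume) (f := fun s => vn v n (Y n s + N s)) (g := fun _ => A * (1 + exp M)) ht.1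
          (((hl n).continuous.comp ((hY n).1.add hN)).intervalIntegrable _ _) (continuous_const.intervalIntegrable _ _)
          (fun s hs => by
            have hs' : s ∈ Icc 0 T := ⟨hs.1, hs.2.trans ht.2⟩
            refine (hA _).trans (mul_le_mul_of_nonneg_left ?_ A0)
            gcongr
            have := abs_le.1 (hM s hs')
            have q := g1 s hs'
            have : -M ≤ max (-(n:ℝ)) (min (Y n s + N s) n) := by
              by_cases h : M ≤ n
              · exact le_max_of_le_right (le_min (by linarith) (by linarith))
              · exact le_max_of_le_left (by linarith)
            linarith)
        refine this.trans ?_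
        rw [intervalIntegral.integral_const, smul_eq_mul, sub_zero, mul_comm]
        exact mul_le_mul_of_nonneg_left ht.2 (by positivity)
      have := abs_le.1 (hM t ht)
      have := g1 t ht
      have : 0 ≤ A * (1 + exp M) * T := by have := ht.1.trans ht.2; positivity
      exact abs_le.2 ⟨by linarith, by linarith⟩
    refine ⟨n0, fun n hn t ht => ⟨?_, b n hn t ht⟩⟩
    refine ODE_solution_unique (v := fun t x => vn v n0 (x + N t)) (K := K n0) (a := 0) (b := T) (fun t => ?_)
      (hY n).1.continuousOn (fun s hs => ?_) (hY n0).1.continuousOn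
      (fun s hs => ((hY n0).2.2.1 s hs.1).hasDerivWithinAt) (by rw [(hY n).2.1, (hY n0).2.1]) ht
    · refine LipschitzWith.of_dist_le_mul fun x y => ?_
      have := (hl n0).dist_le_mul (x + N t) (y + N t)
      rwa [dist_add_right] at this
    · have q := b n hn s (Ico_subset_Icc_self hs)
      have q' : |Y n s + N s| ≤ n := q.trans (by exact_mod_cast hn)
      have := (hY n).2.2.1 s hs.1
      rw [vn_eq q'] at this
      rw [vn_eq q]
      exact this.hasDerivWithinAt
  choose n0 hn0 using key
  have hz : ∀ T, ∀ t ≤ T, Y (n0 (max t 0)) (max t 0) = Y (n0 (max T 0)) (max t 0) := fun T t ht => by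
    have m1 : max t 0 ∈ Icc 0 (max t 0) := ⟨le_max_right _ _, le_rfl⟩
    have m2 : max t 0 ∈ Icc 0 (max T 0) := ⟨le_max_right _ _, max_le_max_right _ ht⟩
    rw [← (hn0 _ (max (n0 (max t 0)) (n0 (max T 0))) (le_max_left _ _) _ m1).1,
      (hn0 _ (max (n0 (max t 0)) (n0 (max T 0))) (le_max_right _ _) _ m2).1]
  refine ⟨Y, fun t => Y (n0 (max t 0)) (max t 0), fun n t ht => (hY n).2.2.2 t ht, fun t ht => ?_, fun t => ?_, ?_, fun t ht => ?_⟩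
  · refine tendsto_const_nhds.congr' ?_
    filter_upwards [eventually_ge_atTop (n0 t)] with n hn
    simp only [max_eq_left ht]
    exact ((hn0 t n hn t ⟨ht, le_rfl⟩).1).symm
  · simp
  · refine continuous_iff_continuousAt.2 fun t => ?_
    refine ContinuousAt.congr (f := fun s => Y (n0 (max (t+1) 0)) (max s 0)) ((hY _).1.comp (by fun_prop)).continuousAt ?_
    filter_upwards [Iio_mem_nhds (lt_add_one t)] with s hs using (hz (t+1) s hs.le).symm
  · simp only [max_eq_left ht]
    rw [hint _ t ht]
    refine intervalIntegral.integral_congr fun s hs => ?_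
    rw [uIcc_of_le ht] at hs
    have h1 := hz t s hs.2
    rw [max_eq_left hs.1, max_eq_left ht] at h1
    have h2 := (hn0 t _ le_rfl s hs).2
    simp only [max_eq_left hs.1, h1]
    exact vn_eq h2

lemma sp_of {F : Filtration ℝ mΩ} {f : ℝ → Ω → ℝ} (hf : ∀ t, Measurable[F t] (f t)) (hc : ∀ ω, Continuous fun t => f t ω) :
    IsStronglyProgressive F f :=
  StronglyAdapted.isStronglyProgressive_of_continuous (fun t => (hf t).stronglyMeasurable) hc

lemma ad_int {F : Filtration ℝ mΩ} {f : ℝ → Ω → ℝ} (hf : IsStronglyProgressive F f) (t : ℝ) :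
    Measurable[F t] (fun ω => ∫ s in (0:ℝ)..(max t 0), f s ω) := by
  rcases le_total 0 t with h | h
  · rw [max_eq_left h]; exact prog_adapt hf h
  · rw [max_eq_right h]; simp only [intervalIntegral.integral_same]; exact measurable_const

lemma picIt_ad {F : Filtration ℝ mΩ} {w : ℝ → ℝ} (hw : Continuous w) {N : ℝ → Ω → ℝ}
    (hN : ∀ t, Measurable[F t] (N t)) (hNc : ∀ ω, Continuous fun t => N t ω) (k : ℕ) :
    ∀ t, Measurable[F t] (fun ω => picIt (fun t x => w (x + N t ω)) (0:ℝ) k (max t 0)) := by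
  have hc : ∀ k ω, Continuous (picIt (fun t x => w (x + N t ω)) (0:ℝ) k) := fun k ω =>
    picIt_cont (f := fun t x => w (x + N t ω)) (hw.comp (continuous_snd.add ((hNc ω).comp continuous_fst))) 0 k
  induction k with
  | zero => exact fun t => measurable_const
  | succ k ih =>
    intro t
    have := ad_int (F := F) (f := fun s ω => w (picIt (fun t x => w (x + N t ω)) (0:ℝ) k (max s 0) + N s ω))
      (sp_of (fun s => hw.measurable.comp ((ih s).add (hN s)))
        (fun ω => hw.comp (((hc k ω).comp (by fun_prop)).add (hNc ω)))) t
    convert this using 2 with ω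
    simp only [picIt, zero_add]
    refine intervalIntegral.integral_congr fun s hs => ?_
    rw [uIcc_of_le (le_max_right _ _)] at hs
    simp only [max_eq_left hs.1]

lemma fb_proc {F : Filtration ℝ mΩ} {v : ℝ → ℝ} {A : ℝ} (hv : ∀ n : ℕ, ∃ K : ℝ≥0, LipschitzOnWith K v (Icc (-(n:ℝ)) n))
    (h0 : ∀ z, 0 ≤ v z) (hA : ∀ z, v z ≤ A * (1 + exp (-z))) {N : ℝ → Ω → ℝ}
    (hN : ∀ t, Measurable[F t] (N t)) (hNc : ∀ ω, Continuous fun t => N t ω) :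
    ∃ Z : ℝ → Ω → ℝ, (∀ t, Measurable[F t] (Z t)) ∧ (∀ ω, Continuous fun t => Z t ω) ∧
      ∀ t, 0 ≤ t → ∀ ω, Z t ω = N t ω + ∫ s in (0:ℝ)..t, v (Z s ω) := by
  choose Y ζ h1 h2 h3 h4 h5 using fun ω => fb_path hv h0 hA (hNc ω)
  refine ⟨fun t ω => ζ ω t + N t ω, fun t => Measurable.add ?_ (hN t), fun ω => (h4 ω).add (hNc ω), fun t ht ω => ?_⟩
  · have hY : ∀ n, Measurable[F t] (fun ω => Y ω n (max t 0)) := fun n => by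
      obtain ⟨K, hK⟩ := hv n
      refine @measurable_of_tendsto_metrizable _ _ (F t) _ _ _ _ _ _ (fun k => picIt_ad (vn_lip hK).continuous hN hNc k t) ?_
      exact tendsto_pi_nhds.2 fun ω => h1 ω n _ (le_max_right _ _)
    have := @measurable_of_tendsto_metrizable _ _ (F t) _ _ _ _ _ _ hY (tendsto_pi_nhds.2 fun ω => h2 ω _ (le_max_right _ _))
    rw [show (fun ω => ζ ω t) = fun ω => ζ ω (max t 0) from funext fun ω => h3 ω t]
    exact this
  · show ζ ω t + N t ω = _
    rw [add_comm, h5 ω t ht]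

end feedback
end HabitModel

namespace HabitModel
open Filter Topology
variable {Ω : Type*} [mΩ : MeasurableSpace Ω]

section fbc
variable {S : Setting Ω} {p : OP} {φ φ1 : ℝ → ℝ} {C : ℝ}

def us (p : OP) (φ φ1 : ℝ → ℝ) (z : ℝ) : ℝ := p.uO z (p.m * φ z + (1 + p.r * exp (-z)) * φ1 z)

lemma Sol_C1 (s : p.Sol φ φ1 C) : ContDiff ℝ 1 φ ∧ ContDiff ℝ 1 φ1 := by
  have c0 : Continuous φ := continuous_iff_continuousAt.2 fun z => (s.d0 z).continuousAt
  have c1 : Continuous φ1 := continuous_iff_continuousAt.2 fun z => (s.d1 z).continuousAt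
  constructor
  · rw [contDiff_one_iff_deriv, show deriv φ = φ1 from funext fun z => (s.d0 z).deriv]
    exact ⟨fun z => (s.d0 z).differentiableAt, c1⟩
  · rw [contDiff_one_iff_deriv, show deriv φ1 = fun z => p.F z (φ z) (φ1 z) from funext fun z => (s.d1 z).deriv]
    exact ⟨fun z => (s.d1 z).differentiableAt, p.F_cont.comp (by fun_prop : Continuous fun z => (z, φ z, φ1 z))⟩

lemma us_cont (s : p.Sol φ φ1 C) : Continuous (us p φ φ1) := by
  have c0 := (Sol_C1 s).1.continuous
  have c1 := (Sol_C1 s).2.continuous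
  exact p.uO_cont.comp (by fun_prop : Continuous fun z => (z, p.m * φ z + (1 + p.r * exp (-z)) * φ1 z))

lemma v_lip (s : p.Sol φ φ1 C) (n : ℕ) :
    ∃ K : ℝ≥0, LipschitzOnWith K (fun z => us p φ φ1 z * (1 + p.r * exp (-z))) (Icc (-(n:ℝ)) n) := by
  obtain ⟨c0, c1⟩ := Sol_C1 s
  refine LocallyLipschitzOn.exists_lipschitzOnWith_of_compact isCompact_Icc (LocallyLipschitz.locallyLipschitzOn ?_)
  set c := p.R ^ (-(p.b+1)) with hc
  have cpos : 0 < c := rpow_pos_of_pos p.hR _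
  set e := -(1/(p.b+1)) with he
  have hw : LocallyLipschitz fun z => (z, max c ((p.m * φ z + (1 + p.r * exp (-z)) * φ1 z) * exp (-p.a*z))) := by
    refine LocallyLipschitz.id.prodMk (LocallyLipschitz.const_max (ContDiff.locallyLipschitz (𝕂 := ℝ) ?_) c)
    fun_prop
  intro z
  obtain ⟨K, t, ht, hK⟩ := hw z
  have hG : ContDiffAt ℝ 1 (fun w : ℝ × ℝ => w.2 ^ e * (1 + p.r * exp (-w.1)))
      (z, max c ((p.m * φ z + (1 + p.r * exp (-z)) * φ1 z) * exp (-p.a*z))) := by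
    refine ContDiffAt.mul (contDiffAt_snd.rpow_const_of_ne (ne_of_gt (lt_of_lt_of_le cpos (le_max_left _ _)))) ?_
    fun_prop
  obtain ⟨K', t', ht', hK'⟩ := hG.exists_lipschitzOnWith
  refine ⟨K' * K, t ∩ _, inter_mem ht (hw.continuous.continuousAt.preimage_mem_nhds ht'), ?_⟩
  exact hK'.comp (hK.mono inter_subset_left) (fun x hx => hx.2)

lemma int_exp {g : ℝ → ℝ} (hg : Continuous g) (K t : ℝ) :
    ∫ s in (0:ℝ)..t, g s * (K * exp (∫ r in (0:ℝ)..s, g r)) = K * exp (∫ r in (0:ℝ)..t, g r) - K := by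
  have d : ∀ s, HasDerivAt (fun s => ∫ r in (0:ℝ)..s, g r) (g s) s := fun s =>
    intervalIntegral.integral_hasDerivAt_right (hg.intervalIntegrable _ _) (hg.stronglyMeasurableAtFilter _ _) hg.continuousAt
  have hcont : Continuous fun s => ∫ r in (0:ℝ)..s, g r := continuous_iff_continuousAt.2 fun s => (d s).continuousAt
  rw [intervalIntegral.integral_eq_sub_of_hasDerivAt (f := fun s => K * exp (∫ r in (0:ℝ)..s, g r))
    (fun s _ => (((d s).exp.const_mul K).congr_deriv (by ring))) (by
      apply Continuous.intervalIntegrable; fun_prop)]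
  simp

lemma exists_fb (hp : Par S p) (s : p.Sol φ φ1 C) {k₀ h₀ : ℝ} (hk : 0 < k₀) (hh : 0 < h₀) :
    ∃ c : ℝ → Ω → ℝ, IsAdmissible S k₀ h₀ c ∧ ∀ t, 0 ≤ t → ∀ ω, uC S k₀ c t ω = us p φ φ1 (YC S h₀ c t ω - XC S k₀ c t ω) := by
  have ucont := us_cont s
  have upos : ∀ z, 0 < us p φ φ1 z := fun z => p.uO_pos _ _
  have ule : ∀ z, us p φ φ1 z ≤ S.R := fun z => hp.hR ▸ p.uO_le _ _
  have hr := p.hr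
  have W1c := S.bm1.cont
  have W2c := S.bm2.cont
  have Wad : ∀ {W : ℝ → Ω → ℝ}, IsStdBM S.P S.F W → ∀ t, Measurable[S.F t] (W (max t 0)) := fun {W} hW t => by
    rcases le_total 0 t with h | h
    · rw [max_eq_left h]; exact hW.adapted t
    · rw [max_eq_right h, show W 0 = fun _ => 0 from funext hW.init]; exact measurable_const
  obtain ⟨Z, Zm, Zc, Ze⟩ := fb_proc (F := S.F) (A := p.R * (1 + p.r))
    (v := fun z => us p φ φ1 z * (1 + p.r * exp (-z))) (v_lip s)
    (fun z => mul_nonneg (upos z).le (by positivity))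
    (fun z => by
      have h1 : us p φ φ1 z * (1 + p.r * exp (-z)) ≤ p.R * (1 + p.r * exp (-z)) :=
        mul_le_mul_of_nonneg_right (p.uO_le _ _) (by positivity)
      refine h1.trans ?_
      rw [mul_assoc]
      refine mul_le_mul_of_nonneg_left ?_ p.hR.le
      nlinarith [exp_pos (-z)])
    (N := fun t ω => (log h₀ - log k₀) + (-S.ρ - S.β₂^2/2 - (S.B - S.β₁^2/2)) * max t 0 +
      (S.β₂ * S.W2 (max t 0) ω - S.β₁ * S.W1 (max t 0) ω))
    (fun t => measurable_const.add (((Wad S.bm2 t).const_mul _).sub ((Wad S.bm1 t).const_mul _)))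
    (fun ω => by
      have := W1c ω; have := W2c ω
      fun_prop)
  have uZc : ∀ ω, Continuous fun t => us p φ φ1 (Z t ω) := fun ω => ucont.comp (Zc ω)
  have uZe : ∀ ω, Continuous fun t => p.r * us p φ φ1 (Z t ω) * exp (-Z t ω) := fun ω => by
    have := uZc ω; have := Zc ω; fun_prop
  have Ic : ∀ ω, Continuous fun t => ∫ r in (0:ℝ)..t, us p φ φ1 (Z r ω) := fun ω =>
    intervalIntegral.continuous_primitive (fun a b => (uZc ω).intervalIntegrable a b) 0
  set X : ℝ → Ω → ℝ := fun t ω => log k₀ + (S.B - S.β₁^2/2) * max t 0 - (∫ r in (0:ℝ)..(max t 0), us p φ φ1 (Z r ω)) +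
    S.β₁ * S.W1 (max t 0) ω with hX
  have Xc : ∀ ω, Continuous fun t => X t ω := fun ω => by
    have := W1c ω
    have := (Ic ω).comp (continuous_id.max continuous_const : Continuous fun t : ℝ => max t 0)
    simp only [hX]
    fun_prop
  have Xm : ∀ t, Measurable[S.F t] (X t) := fun t =>
    ((measurable_const.sub (ad_int (sp_of (fun t => ucont.measurable.comp (Zm t)) uZc) t)).add ((Wad S.bm1 t).const_mul _))
  set c : ℝ → Ω → ℝ := fun t ω => us p φ φ1 (Z t ω) * exp (X t ω) with hc
  have cc : ∀ ω, Continuous fun t => c t ω := fun ω => (uZc ω).mul (continuous_exp.comp (Xc ω))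
  have ck : ∀ t, 0 ≤ t → ∀ ω, kProc S k₀ c t ω = exp (X t ω) := fun t ht ω => by
    have e1 : ∫ s in (0:ℝ)..t, c s ω * Real.exp (-((S.B - S.β₁ ^ 2 / 2) * s) - S.β₁ * S.W1 s ω) =
        k₀ - k₀ * exp (- ∫ r in (0:ℝ)..t, us p φ φ1 (Z r ω)) := by
      have := int_exp (g := fun t => -us p φ φ1 (Z t ω)) (uZc ω).neg k₀ t
      simp only [intervalIntegral.integral_neg] at this
      rw [← neg_sub (k₀ * _) k₀, ← this, ← intervalIntegral.integral_neg]
      refine intervalIntegral.integral_congr fun s hs => ?_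
      rw [uIcc_of_le ht] at hs
      simp only [hc, hX, max_eq_left hs.1]
      rw [mul_assoc, ← exp_add, show log k₀ + (S.B - S.β₁^2/2) * s - (∫ r in (0:ℝ)..s, us p φ φ1 (Z r ω)) +
        S.β₁ * S.W1 s ω + (-((S.B - S.β₁ ^ 2 / 2) * s) - S.β₁ * S.W1 s ω) = log k₀ + - ∫ r in (0:ℝ)..s, us p φ φ1 (Z r ω) by ring,
        exp_add, exp_log hk]
      ring
    rw [kProc, e1]
    simp only [hX, max_eq_left ht]
    rw [show log k₀ + (S.B - S.β₁^2/2) * t - (∫ r in (0:ℝ)..t, us p φ φ1 (Z r ω)) + S.β₁ * S.W1 t ω =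
      ((S.B - S.β₁^2/2) * t + S.β₁ * S.W1 t ω) + (log k₀ + - ∫ r in (0:ℝ)..t, us p φ φ1 (Z r ω)) by ring, exp_add (_ + _), exp_add (log k₀), exp_log hk]
    ring
  have XZ : ∀ t, 0 ≤ t → ∀ ω, X t ω + Z t ω = log h₀ + (-S.ρ - S.β₂^2/2) * t + S.β₂ * S.W2 t ω +
      ∫ r in (0:ℝ)..t, p.r * us p φ φ1 (Z r ω) * exp (-Z r ω) := fun t ht ω => by
    have e1 : ∫ r in (0:ℝ)..t, us p φ φ1 (Z r ω) * (1 + p.r * exp (-Z r ω)) = (∫ r in (0:ℝ)..t, us p φ φ1 (Z r ω)) +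
        ∫ r in (0:ℝ)..t, p.r * us p φ φ1 (Z r ω) * exp (-Z r ω) := by
      rw [← intervalIntegral.integral_add ((uZc ω).intervalIntegrable _ _) ((uZe ω).intervalIntegrable _ _)]
      refine intervalIntegral.integral_congr fun s hs => ?_
      ring
    rw [Ze t ht ω, e1]
    simp only [hX, max_eq_left ht]
    ring
  have ch : ∀ t, 0 ≤ t → ∀ ω, hProc S h₀ c t ω = exp (X t ω + Z t ω) := fun t ht ω => by
    have e1 : S.ρ * ∫ s in (0:ℝ)..t, c s ω * Real.exp ((S.ρ + S.β₂ ^ 2 / 2) * s - S.β₂ * S.W2 s ω) =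
        h₀ * exp (∫ r in (0:ℝ)..t, p.r * us p φ φ1 (Z r ω) * exp (-Z r ω)) - h₀ := by
      rw [← int_exp (uZe ω) h₀ t, ← intervalIntegral.integral_const_mul]
      refine intervalIntegral.integral_congr fun s hs => ?_
      rw [uIcc_of_le ht] at hs
      simp only [hc]
      rw [mul_assoc, ← exp_add, show X s ω + ((S.ρ + S.β₂ ^ 2 / 2) * s - S.β₂ * S.W2 s ω) =
        log h₀ + ((∫ r in (0:ℝ)..s, p.r * us p φ φ1 (Z r ω) * exp (-Z r ω)) + - Z s ω) by linarith [XZ s hs.1 ω],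
        exp_add, exp_add, exp_log hh, hp.hr]
      ring
    rw [hProc, e1, XZ t ht ω, exp_add (_ + _ + _), exp_add (log h₀ + _), exp_add (log h₀), exp_add (_ * t), exp_log hh]
    ring
  refine ⟨c, ⟨?_, ?_, ?_, ?_, ?_, ?_⟩, fun t ht ω => ?_⟩
  · exact sp_of (fun t => (ucont.measurable.comp (Zm t)).mul (Xm t).exp) cc
  · exact Eventually.of_forall fun ω t _ => (cc ω).intervalIntegrable _ _
  · exact Eventually.of_forall fun ω => Eventually.of_forall fun t => mul_pos (upos _) (exp_pos _)
  · exact Eventually.of_forall fun ω t ht => by rw [ck t ht]; exact exp_pos _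
  · exact Eventually.of_forall fun ω t ht => by rw [ch t ht]; exact exp_pos _
  · refine Eventually.of_forall fun ω => ?_
    filter_upwards [ae_restrict_mem measurableSet_Ici] with t ht
    rw [ck t ht]
    exact mul_le_mul_of_nonneg_right (ule _) (exp_pos _).le
  · rw [uC, YC, XC, ck t ht, ch t ht, log_exp, log_exp, add_sub_cancel_left]
    simp only [hc]
    rw [mul_div_cancel_right₀ _ (exp_pos _).ne', min_eq_right (ule _), max_eq_right (upos _).le]

lemma Vcost_eq (hp : Par S p) (s : p.Sol φ φ1 C) {k₀ h₀ : ℝ} (hk : 0 < k₀) (hh : 0 < h₀) :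
    Vcost S k₀ h₀ = ENNReal.ofReal (exp (-p.m * log k₀) * φ (log h₀ - log k₀)) := by
  obtain ⟨c, hc, h⟩ := exists_fb hp s hk hh
  simp only [us] at h
  have h1 := upper_adm hc hp hh s h
  have h2 := fun c : {c : ℝ → Ω → ℝ // IsAdmissible S k₀ h₀ c} => lower_adm c.2 hp hh s
  generalize ENNReal.ofReal (exp (-p.m * log k₀) * φ (log h₀ - log k₀)) = e at *
  unfold Vcost
  exact le_antisymm ((iInf_le (fun c : {c : ℝ → Ω → ℝ // IsAdmissible S k₀ h₀ c} => Jcost S k₀ h₀ c.1) ⟨c, hc⟩).trans h1)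
    (le_iInf h2)

lemma V_eq (hp : Par S p) (s : p.Sol φ φ1 C) {k₀ h₀ : ℝ} (hk : 0 < k₀) (hh : 0 < h₀) :
    (V S k₀ h₀).toReal = -(exp (-p.m * log k₀) * φ (log h₀ - log k₀)) := by
  rw [V, Vcost_eq hp s hk hh, EReal.toReal_neg_eq, EReal.toReal_coe_ennreal, ENNReal.toReal_ofReal]
  exact mul_nonneg (exp_pos _).le (s.nn _)

end fbc
end HabitModel

namespace HabitModel
open Filter Topology
variable {Ω : Type*} [mΩ : MeasurableSpace Ω]

section final

lemma exists_par (S : Setting Ω) (hA : Assumption1 S) (hγσ : S.γ * (S.σ - 1) ≤ 1) : ∃ p : OP, Par S p := by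
  obtain ⟨-, hγ, h1, h2⟩ := hA
  have hb : 0 < S.σ - 1 := by linarith [S.hσ]
  have hB := S.hB
  have hρ := S.hρ₀
  obtain ⟨b, hbd⟩ : ∃ b, b = S.σ - 1 := ⟨_, rfl⟩
  obtain ⟨a, had⟩ : ∃ a, a = S.γ * (S.σ - 1) := ⟨_, rfl⟩
  obtain ⟨x1, hx1⟩ : ∃ x, x = S.β₁^2 := ⟨_, rfl⟩
  obtain ⟨x2, hx2⟩ : ∃ x, x = S.β₂^2 := ⟨_, rfl⟩
  have p1 : 0 < x1 := hx1 ▸ pow_pos S.hβ₁ 2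
  have p2 : 0 < x2 := hx2 ▸ pow_pos S.hβ₂ 2
  have ha : 0 < a := had ▸ mul_pos hγ hb
  rw [← hbd] at hb
  have hab : a < b := by rw [had, ← hbd]; nlinarith [S.hγ₁]
  rw [← had] at h1 h2 hγσ
  rw [← hbd, ← hx1, ← hx2] at h1 h2
  have hag : S.γ * b = a := by rw [had, hbd]
  obtain ⟨l, hl⟩ : ∃ l, l = max 2 (1/a) := ⟨_, rfl⟩
  rw [← hl] at h1 h2
  have l2 : 2 ≤ l := hl ▸ le_max_left _ _
  have la : 1 ≤ l * a := by
    have : 1/a ≤ l := hl ▸ le_max_right _ _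
    rwa [div_le_iff₀ ha] at this
  set M := l * (b^2 * x1 + a^2 * x2) with hM
  have Mb : a * (x1 + x2) ≤ M := by
    have e1 : a ≤ l * a^2 := by nlinarith
    have e2 : a^2 ≤ b^2 := by nlinarith
    have e3 : l * a^2 ≤ l * b^2 := by nlinarith
    have : M = (l * b^2) * x1 + (l * a^2) * x2 := by rw [hM]; ring
    nlinarith
  have Mc : b^2 * x1 + a^2 * x2 ≤ M / 2 := by
    have : 0 ≤ b^2 * x1 + a^2 * x2 := by positivity
    nlinarith
  have t1 : (b - a) * x1 / 2 + M < S.θ := by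
    rcases le_or_gt (S.ρ + (x2 - x1)/2) 0 with h | h
    · have := h1 h
      have e : b * (-S.γ * S.ρ - (S.γ * x2 - x1) / 2 + l * b * (x1 + S.γ^2 * x2)) =
        -a * (S.ρ + (x2 - x1)/2) + (b - a) * x1/2 + M := by rw [hM, ← hag]; ring
      rw [e] at this
      nlinarith
    · have := h2 h
      have e : b * (x1 * (1 - S.γ) / 2 + l * b * (x1 + S.γ^2 * x2)) = (b - a) * x1/2 + M := by rw [hM, ← hag]; ring
      rw [e] at this
      exact this
  have t2 : -a * S.ρ - a * x2/2 + b * x1/2 + M < S.θ := by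
    rcases le_or_gt (S.ρ + (x2 - x1)/2) 0 with h | h
    · have := h1 h
      have e : b * (-S.γ * S.ρ - (S.γ * x2 - x1) / 2 + l * b * (x1 + S.γ^2 * x2)) =
        -a * S.ρ - a * x2/2 + b * x1/2 + M := by rw [hM, ← hag]; ring
      rw [e] at this
      exact this
    · nlinarith [mul_pos ha h]
  set D := (x1 + x2)/2 with hD
  set m := b - a with hm
  set E := -S.B - S.ρ + x1/2*(2*m+1) - x2/2 with hE
  set L := S.θ + S.B*m - x1/2*(m*(m+1)) with hL
  have m0 : 0 < m := by linarith
  have D0 : 0 < D := by positivity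
  have L1 : 3/2 * (a * D) ≤ L := by
    have : m^2 * x1 ≤ b^2 * x1 := mul_le_mul_of_nonneg_right (pow_le_pow_left₀ m0.le (by linarith) 2) p1.le
    have : 0 ≤ S.B * m := by positivity
    have : 0 ≤ a^2 * x2 := by positivity
    have : a * D = a * (x1 + x2)/2 := by rw [hD]; ring
    have : L = S.θ + S.B*m - m^2*x1/2 - m*x1/2 := by rw [hL]; ring
    linarith
  have L2 : D * a^2 + E * a - L ≤ -(3/2 * (a * D)) := by
    have : D * a^2 + E * a - L = -S.B * b - a * S.ρ + (b^2 * x1 + a^2 * x2)/2 + b * x1/2 - a * x2/2 - S.θ := by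
      rw [hD, hE, hL, hm]; ring
    have : 0 ≤ S.B * b := by positivity
    have : a * D = a * (x1 + x2)/2 := by rw [hD]; ring
    linarith
  have aD : 0 < a * D := by positivity
  clear_value M
  refine ⟨⟨D, E, L, m, a, b, S.ρ, S.R, a * D, D0, by linarith, m0, ha, hγσ, hb, hρ, S.hR, aD, fun s h0 hs => ?_⟩, ?_⟩
  · have e : D * (a^2*s^2 + a*s*(1-s)) + E*a*s - L = (1-s) * (-L) + s * (D * a^2 + E * a - L) + (a*D)*((1-a)*(s*(1-s))) := by ring
    rw [e]
    have s1 : 0 ≤ s * (1-s) := mul_nonneg h0 (by linarith)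
    have : (1-a)*(s*(1-s)) ≤ 1/4 := by
      have e1 : (1-a)*(s*(1-s)) ≤ 1 * (s*(1-s)) := mul_le_mul_of_nonneg_right (by linarith) s1
      have e2 : s*(1-s) = 1/4 - (s-1/2)^2 := by ring
      have := sq_nonneg (s-1/2)
      linarith
    have := mul_le_mul_of_nonneg_left this aD.le
    clear h1 h2 t1 t2 Mb Mc
    have : (1-s) * (-L) ≤ (1-s) * (-(3/2 * (a * D))) := mul_le_mul_of_nonneg_left (by linarith) (by linarith)
    have := mul_le_mul_of_nonneg_left L2 h0
    linarith
  · exact ⟨by simp only [hD, hx1, hx2], by simp only [hE, hx1, hx2], by simp only [hL, hx1], rfl, rfl, hbd, had, rfl⟩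

lemma GFun_eq {S : Setting Ω} {p : OP} (hp : Par S p) (x y q P : ℝ) (hP : P = exp (-(p.m+1)*x) * q) (pk ph : ℝ)
    (hpk : pk - S.ρ * ph = P) :
    GFun S.ρ S.σ S.γ S.R (exp x) (exp y) pk ph = -(exp (-p.m*x) * p.Hm (y - x) q) := by
  have hσ : S.σ = p.b + 1 := by rw [hp.hb]; ring
  have hb := p.hb
  have hb1 := p.hb1
  have hR := p.hR
  have hag : S.γ * p.b = p.a := by rw [hp.hb, hp.ha]
  have hm := hp.hm
  have hs1 : S.σ - 1 = p.b := hp.hb.symm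
  simp only [GFun, hpk, hs1, hag, ← hp.hR]
  rw [hσ]
  have hR' := rpow_pos_of_pos hR (-(p.b+1))
  have c : exp y ^ p.a * (p.R * exp x) ^ (-(p.b+1)) = exp (-(p.m+1)*x) * (exp (p.a*(y-x)) * p.R ^ (-(p.b+1))) := by
    rw [mul_rpow hR.le (exp_pos x).le, ← exp_mul, ← exp_mul, mul_left_comm, ← exp_add, ← mul_assoc, ← exp_add, mul_comm]
    congr 2
    rw [hm]; ring
  have c2 : P ≤ exp y ^ p.a * (p.R * exp x) ^ (-(p.b+1)) ↔ q * exp (-p.a*(y-x)) ≤ p.R ^ (-(p.b+1)) := by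
    rw [c, hP, mul_le_mul_iff_right₀ (exp_pos _), neg_mul, exp_neg, ← div_eq_mul_inv, div_le_iff₀ (exp_pos _), mul_comm (p.R ^ _)]
  have ex : exp x ≠ 0 := (exp_pos x).ne'
  split_ifs with h
  · rw [c2] at h
    have u : p.uO (y-x) q = p.R := by
      rw [OP.uO, max_eq_left h, ← rpow_mul hR.le, show -(p.b+1) * -(1/(p.b+1)) = 1 by field_simp, rpow_one]
    rw [OP.Hm, u, div_rpow (by positivity) (by positivity), ← exp_mul, ← exp_mul, mul_rpow hR.le (exp_pos x).le, ← exp_mul,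
      rpow_neg hR.le, hP, show exp (-(p.m+1)*x) = exp (-p.m*x) * (exp x)⁻¹ by rw [← exp_neg, ← exp_add]; congr 1; ring,
      show y * S.γ * p.b = p.a * (y-x) + -p.m * x + x * p.b by rw [hm, ← hag]; ring, exp_add, exp_add]
    have := (rpow_pos_of_pos hR p.b).ne'
    field_simp
    ring
  · rw [c2, not_le] at h
    set Q := q * exp (-p.a*(y-x)) with hQ
    have Q0 : 0 < Q := hR'.trans h
    have qe : q = exp (p.a*(y-x)) * Q := by
      rw [hQ, mul_left_comm, ← exp_add]; simp
    have u : p.uO (y-x) q = Q ^ (-(1/(p.b+1))) := by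
      rw [OP.uO, max_eq_right h.le]
    have e1 : Q ^ (-(1/(p.b+1))) * Q = Q ^ (1 - 1/(p.b+1)) := by
      rw [← rpow_add_one Q0.ne']; congr 1; ring
    have e2 : (Q ^ (-(1/(p.b+1)))) ^ (-p.b) = Q ^ (1 - 1/(p.b+1)) := by
      rw [← rpow_mul Q0.le]; congr 1; field_simp; ring
    have e3 : (exp y ^ S.γ * P) ^ (1 - 1/(p.b+1)) = exp (-p.m*x) * exp (p.a*(y-x)) * Q ^ (1 - 1/(p.b+1)) := by
      rw [hP, qe, ← exp_mul, ← mul_assoc, ← mul_assoc, ← exp_add, ← exp_add, mul_rpow (exp_pos _).le Q0.le, ← exp_mul, ← exp_add]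
      congr 2
      rw [hm, ← hag]; field_simp; ring
    rw [OP.Hm, u, e2, e3]
    linear_combination (exp (-p.m*x) * exp (p.a*(y-x))) * e1 + exp (-p.m*x) * Q ^ (-(1/(p.b+1))) * qe

def GG (α β : ℝ) (ψ : ℝ → ℝ) (z : ℝ × ℝ) : ℝ := exp (α * log z.1 + β * log z.2) * ψ (log z.2 - log z.1)

lemma GG_pd {α β : ℝ} {ψ ψ1 : ℝ → ℝ} (h : ∀ t, HasDerivAt ψ (ψ1 t) t) {f : ℝ × ℝ → ℝ}
    (hf : ∀ z : ℝ × ℝ, z ∈ Ioi (0:ℝ) ×ˢ Ioi (0:ℝ) → f z = GG α β ψ z) {z : ℝ × ℝ} (hz : z ∈ Ioi (0:ℝ) ×ˢ Ioi (0:ℝ)) :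
    pd1 f z = GG (α-1) β (fun t => α * ψ t - ψ1 t) z ∧ pd2 f z = GG α (β-1) (fun t => β * ψ t + ψ1 t) z := by
  have hz1 : 0 < z.1 := hz.1
  have hz2 : 0 < z.2 := hz.2
  have hn : f =ᶠ[𝓝 z] GG α β ψ := by
    filter_upwards [(isOpen_Ioi.prod isOpen_Ioi).mem_nhds hz] with w hw using hf w hw
  have l1 : HasFDerivAt (fun z : ℝ × ℝ => log z.1) (z.1⁻¹ • ContinuousLinearMap.fst ℝ ℝ ℝ) z := hasFDerivAt_fst.log hz1.ne'
  have l2 : HasFDerivAt (fun z : ℝ × ℝ => log z.2) (z.2⁻¹ • ContinuousLinearMap.snd ℝ ℝ ℝ) z := hasFDerivAt_snd.log hz2.ne'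
  have d := (((l1.const_mul α).fun_add (l2.const_mul β)).exp).fun_mul ((h _).comp_hasFDerivAt z (l2.fun_sub l1))
  have e1 : ∀ γ, exp ((γ-1) * log z.1) = exp (γ * log z.1) * z.1⁻¹ := fun γ => by
    rw [sub_mul, exp_sub, one_mul, exp_log hz1]; rfl
  have e2 : ∀ γ, exp ((γ-1) * log z.2) = exp (γ * log z.2) * z.2⁻¹ := fun γ => by
    rw [sub_mul, exp_sub, one_mul, exp_log hz2]; rfl
  have d' : fderiv ℝ f z = _ := hn.fderiv_eq.trans d.fderiv
  rw [pd1, pd2, d']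
  constructor
  · simp [GG, exp_add, e1]; ring
  · simp [GG, exp_add, e2]; ring

end final
end HabitModel

namespace HabitModel
open Filter Topology
variable {Ω : Type*} [mΩ : MeasurableSpace Ω]

/-- Under Assumption 1 and `γ(σ-1) ≤ 1`, the value function is of class `C²` on `(0,∞)²`
and satisfies the HJB equation `θV = H_max(k,h,∇V,D²V)` there in the classical sense. -/
theorem V_classical_solution (S : Setting Ω) (hA : Assumption1 S)
    (hγσ : S.γ * (S.σ - 1) ≤ 1) :
    ContDiffOn ℝ 2 (fun z : ℝ × ℝ => (V S z.1 z.2).toReal)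
        (Set.Ioi (0:ℝ) ×ˢ Set.Ioi (0:ℝ)) ∧
      ∀ z ∈ Set.Ioi (0:ℝ) ×ˢ Set.Ioi (0:ℝ),
        S.θ * (V S z.1 z.2).toReal =
          Hmax S.B S.β₁ S.β₂ S.ρ S.σ S.γ S.R z.1 z.2
            (gradVec (fun w : ℝ × ℝ => (V S w.1 w.2).toReal) z)
            (hessMat (fun w : ℝ × ℝ => (V S w.1 w.2).toReal) z) := by
  obtain ⟨p, hp⟩ := exists_par S hA hγσ
  obtain ⟨φ, φ1, C, hC, d0, d1, nn, up, b1, b2⟩ := p.exists_sol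
  have s : p.Sol φ φ1 C := ⟨hC, d0, d1, nn, up, b1, b2⟩
  set f := fun z : ℝ × ℝ => (V S z.1 z.2).toReal with hf
  have f0 : ∀ z : ℝ × ℝ, z ∈ Ioi (0:ℝ) ×ˢ Ioi (0:ℝ) → f z = GG (-p.m) 0 (fun t => -φ t) z := fun z hz => by
    simp only [hf, GG, V_eq hp s hz.1 hz.2]
    rw [zero_mul, add_zero, mul_neg]
  constructor
  · refine ContDiffOn.congr ?_ f0
    have c2 : ContDiff ℝ 2 φ := by
      rw [show (2 : WithTop ℕ∞) = 1 + 1 by norm_num, contDiff_succ_iff_deriv]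
      refine ⟨fun z => (d0 z).differentiableAt, by simp, ?_⟩
      rw [show deriv φ = φ1 from funext fun z => (d0 z).deriv]
      exact (Sol_C1 s).2
    have l1 : ContDiffOn ℝ 2 (fun z : ℝ × ℝ => log z.1) (Ioi (0:ℝ) ×ˢ Ioi (0:ℝ)) :=
      contDiffOn_fst.log fun z hz => (ne_of_gt hz.1)
    have l2 : ContDiffOn ℝ 2 (fun z : ℝ × ℝ => log z.2) (Ioi (0:ℝ) ×ˢ Ioi (0:ℝ)) :=
      contDiffOn_snd.log fun z hz => (ne_of_gt hz.2)
    exact ((((contDiffOn_const.mul l1).add (contDiffOn_const.mul l2)).exp).mul (c2.neg.comp_contDiffOn (l2.sub l1)))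
  · intro z hz
    have D0 : ∀ t, HasDerivAt (fun t => -φ t) (-φ1 t) t := fun t => (d0 t).neg
    have g1 : ∀ w ∈ Ioi (0:ℝ) ×ˢ Ioi (0:ℝ), pd1 f w = _ := fun w hw => (GG_pd D0 f0 hw).1
    have g2 : ∀ w ∈ Ioi (0:ℝ) ×ˢ Ioi (0:ℝ), pd2 f w = _ := fun w hw => (GG_pd D0 f0 hw).2
    have g11 := (GG_pd (fun t => ((D0 t).const_mul (-p.m)).fun_sub (d1 t).fun_neg) g1 hz).1
    have g22 := (GG_pd (fun t => ((D0 t).const_mul 0).fun_add (d1 t).fun_neg) g2 hz).2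
    have o := s.ode (log z.2 - log z.1)
    have hD := hp.hD
    have hE := hp.hE
    have hL := hp.hL
    have hz1 : 0 < z.1 := hz.1
    have hz2 : 0 < z.2 := hz.2
    obtain ⟨x, hx⟩ : ∃ x, x = log z.1 := ⟨_, rfl⟩
    obtain ⟨y, hy⟩ : ∃ y, y = log z.2 := ⟨_, rfl⟩
    have ex : z.1 = exp x := by rw [hx, exp_log hz1]
    have ey : z.2 = exp y := by rw [hy, exp_log hz2]
    have v := f0 z hz
    have g1 := g1 z hz
    have g2 := g2 z hz
    simp only [GG, ← hx, ← hy] at v g1 g2 g11 g22 o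
    show S.θ * f z = _
    have G := GFun_eq hp x y (p.m * φ (y-x) + (1 + p.r * exp (-(y-x))) * φ1 (y-x)) _ rfl (pd1 f z) (pd2 f z) (by
      rw [g1, g2, hp.hr, show (-p.m - 1) * x + 0 * y = -(p.m+1)*x by ring,
        show -p.m * x + (0-1) * y = -(p.m+1)*x + -(y-x) by ring, exp_add]
      ring)
    have q1 : exp x * pd1 f z = exp (-p.m*x) * (p.m * φ (y-x) + φ1 (y-x)) := by
      rw [g1, ← mul_assoc, ← exp_add, show x + ((-p.m - 1) * x + 0 * y) = -p.m*x by ring]; ring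
    have q2 : exp y * pd2 f z = exp (-p.m*x) * (- φ1 (y-x)) := by
      rw [g2, ← mul_assoc, ← exp_add, show y + (-p.m * x + (0-1) * y) = -p.m*x by ring]; ring
    have q11 : exp x ^ 2 * pd1 (pd1 f) z = exp (-p.m*x) * ((-p.m-1) * (p.m * φ (y-x) + φ1 (y-x)) -
        (p.m * φ1 (y-x) + p.F (y-x) (φ (y-x)) (φ1 (y-x)))) := by
      rw [g11, ← mul_assoc, sq, ← exp_add, ← exp_add, show x + x + ((-p.m - 1 - 1) * x + 0 * y) = -p.m*x by ring]; ring
    have q22 : exp y ^ 2 * pd2 (pd2 f) z = exp (-p.m*x) * (φ1 (y-x) - p.F (y-x) (φ (y-x)) (φ1 (y-x))) := by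
      rw [g22, ← mul_assoc, sq, ← exp_add, ← exp_add, show y + y + (-p.m * x + (0 - 1 - 1) * y) = -p.m*x by ring]; ring
    rw [zero_mul, add_zero] at v
    simp only [Hmax, gradVec, hessMat, ex, ey, G, Matrix.of_apply, Matrix.cons_val_zero, Matrix.cons_val_one]
    rw [hD, hE, hL] at o
    rw [v]
    linear_combination (-S.B) * q1 + S.ρ * q2 - S.β₁^2/2 * q11 - S.β₂^2/2 * q22 + exp (-p.m*x) * o

end HabitModel
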